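/- Let D ⊂ ℝ^N be a bounded open set satisfying the exterior cone condition: for every z ∈ ∂D there exist a nonempty open cone C with vertex z and r > 0 such that C ∩ B(z,r) ⊆ ℝ^N ∖ D. Then for every bounded continuous f : ℝ^N ∖ D → [0,∞) there exists exactly one bounded continuous function u : ℝ^N → [0,∞) such that u = f on ℝ^N ∖ D and Δ^{α/2}u = ρ·φ(u) holds in the distributional sense on D. -/

import Mathlib

open MeasureTheory Real Filter Topology

noncomputable section

/-- The constant `c_{N,-α} = 2^α · π^{-N/2} · Γ((N+α)/2) / |Γ(-α/2)|`. -/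
def fracLapCoeff (N : ℕ) (α : ℝ) : ℝ :=
  2 ^ α * Real.pi ^ (-(N : ℝ) / 2) * Real.Gamma (((N : ℝ) + α) / 2) / |Real.Gamma (-α / 2)|

/-- The fractional Laplacian `Δ^{α/2}θ` of a test function `θ`. -/
def fracLap (N : ℕ) (α : ℝ) (θ : EuclideanSpace ℝ (Fin N) → ℝ)
    (x : EuclideanSpace ℝ (Fin N)) : ℝ :=
  (fracLapCoeff N α / 2) *
    ∫ z : EuclideanSpace ℝ (Fin N), (θ (x + z) + θ (x - z) - 2 * θ x) / ‖z‖ ^ ((N : ℝ) + α)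

section FracLapTheory

variable {N : ℕ} {α : ℝ}

local notation "𝔼" => EuclideanSpace ℝ (Fin N)

/-- The admissible parameters: dimension `N ≥ 3` and order `α ∈ (0, 2)`. -/
class StableParams (N : ℕ) (α : ℝ) : Prop where
  three_le : 3 ≤ N
  pos : 0 < α
  lt_two : α < 2

lemma StableParams.dim_pos (N : ℕ) (α : ℝ) [h : StableParams N α] : 0 < N := by
  have := h.three_le
  omega

variable (N α) in
lemma fracLapCoeff_pos [h : StableParams N α] : 0 < fracLapCoeff N α := by
  have hα1 := h.pos
  have hα2 := h.lt_two
  unfold fracLapCoeff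
  have h1 : Real.Gamma (-α / 2) ≠ 0 := by
    refine Real.Gamma_ne_zero fun m hm => ?_
    have h2 : (m : ℝ) < 1 := by linarith
    have h3 : m = 0 := by
      have : m < 1 := by exact_mod_cast h2
      omega
    subst h3
    simp at hm
    linarith
  have h2 : 0 < Real.Gamma (((N : ℝ) + α) / 2) := Real.Gamma_pos_of_pos (by positivity)
  positivity

/-- The second difference of `θ` at `x` in the direction `z`. -/
def secDiff (θ : 𝔼 → ℝ) (x z : 𝔼) : ℝ := θ (x + z) + θ (x - z) - 2 * θ x

lemma fracLap_def (θ : 𝔼 → ℝ) (x : 𝔼) :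
    fracLap N α θ x =
      fracLapCoeff N α / 2 * ∫ z, secDiff θ x z / ‖z‖ ^ ((N : ℝ) + α) := rfl

/-- Smooth compactly supported functions. -/
structure IsTest (θ : 𝔼 → ℝ) : Prop where
  smooth : ContDiff ℝ (⊤ : ℕ∞) θ
  compact : HasCompactSupport θ

/-- The integrable majorant of second differences against the jump kernel. -/
def levyWeight (N : ℕ) (α : ℝ) (z : EuclideanSpace ℝ (Fin N)) : ℝ :=
  min 1 (‖z‖ ^ 2) / ‖z‖ ^ ((N : ℝ) + α)

lemma levyWeight_nonneg (z : 𝔼) : 0 ≤ levyWeight N α z := by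
  unfold levyWeight; positivity

lemma nontrivial_of_pos (hN : 0 < N) : Nontrivial 𝔼 := by
  have : Nonempty (Fin N) := ⟨⟨0, hN⟩⟩
  infer_instance

lemma integrable_levyWeight [h : StableParams N α] : Integrable (levyWeight N α) := by
  have hα1 := h.pos
  have hα2 := h.lt_two
  have hN := h.dim_pos
  have := nontrivial_of_pos hN
  have := (integrable_fun_norm_addHaar (E := 𝔼) (F := ℝ) volume
    (f := fun r => min 1 (r ^ 2) / r ^ ((N : ℝ) + α)))
  refine this.2 ?_
  rw [finrank_euclideanSpace_fin, ← Set.Ioc_union_Ioi_eq_Ioi zero_le_one]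
  refine IntegrableOn.union ?_ ?_
  · have h1 : IntegrableOn (fun y : ℝ => y ^ (1 - α)) (Set.Ioc 0 1) := by
      have := (intervalIntegral.intervalIntegrable_rpow' (a := 0) (b := 1) (r := 1 - α)
        (by linarith))
      rwa [intervalIntegrable_iff_integrableOn_Ioc_of_le zero_le_one] at this
    refine h1.congr_fun (fun y hy => ?_) measurableSet_Ioc
    have hy0 : 0 < y := hy.1
    have h2 : min 1 (y ^ 2) = y ^ 2 := min_eq_right (by nlinarith [hy.2])
    simp only [h2, smul_eq_mul]
    rw [← Real.rpow_natCast, ← Real.rpow_natCast, ← mul_div_assoc, ← Real.rpow_add hy0,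
      ← Real.rpow_sub hy0]
    congr 1
    push_cast [Nat.cast_sub (show 1 ≤ N from hN)]
    ring
  · have h1 : IntegrableOn (fun y : ℝ => y ^ (-1 - α)) (Set.Ioi 1) :=
      integrableOn_Ioi_rpow_of_lt (by linarith) one_pos
    refine h1.congr_fun (fun y hy => ?_) measurableSet_Ioi
    have hy1 : 1 < y := hy
    have hy0 : 0 < y := by linarith
    have h2 : min 1 (y ^ 2) = 1 := min_eq_left (by nlinarith)
    simp only [h2, smul_eq_mul]
    rw [← Real.rpow_natCast, ← mul_div_assoc, mul_one, ← Real.rpow_sub hy0]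
    congr 1
    push_cast [Nat.cast_sub (show 1 ≤ N from hN)]
    ring

lemma secDiff_bound_of_abs_le {θ : 𝔼 → ℝ} {M : ℝ} (h : ∀ x, |θ x| ≤ M) (x z : 𝔼) :
    |secDiff θ x z| ≤ 4 * M := by
  have h1 := abs_le.1 (h (x + z))
  have h2 := abs_le.1 (h (x - z))
  have h3 := abs_le.1 (h x)
  unfold secDiff
  rw [abs_le]
  constructor <;> linarith

lemma IsTest.bounded {θ : 𝔼 → ℝ} (hθ : IsTest θ) : ∃ M, 0 ≤ M ∧ ∀ x, |θ x| ≤ M := by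
  obtain ⟨C, hC⟩ := hθ.compact.exists_bound_of_continuous hθ.smooth.continuous
  exact ⟨C, (norm_nonneg _).trans (hC 0), hC⟩

lemma IsTest.integrable {θ : 𝔼 → ℝ} (hθ : IsTest θ) : Integrable θ :=
  hθ.smooth.continuous.integrable_of_hasCompactSupport hθ.compact

lemma IsTest.secDiff_le_sq {θ : 𝔼 → ℝ} (hθ : IsTest θ) :
    ∃ C, 0 ≤ C ∧ ∀ x z, |secDiff θ x z| ≤ C * ‖z‖ ^ 2 := by
  have hd : ContDiff ℝ 1 (fderiv ℝ θ) :=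
    hθ.smooth.fderiv_right (by norm_cast)
  obtain ⟨C, hC⟩ := ContDiff.lipschitzWith_of_hasCompactSupport (hθ.compact.fderiv ℝ) hd
    one_ne_zero
  have hdiff : Differentiable ℝ θ := hθ.smooth.differentiable (by simp)
  have key : ∀ x z : 𝔼, |θ (x + z) - θ x - fderiv ℝ θ x z| ≤ C * ‖z‖ ^ 2 := by
    intro x z
    have := Convex.norm_image_sub_le_of_norm_fderiv_le' (f := θ) (φ := fderiv ℝ θ x)
      (C := C * ‖z‖) (s := Metric.closedBall x ‖z‖) (x := x) (y := x + z) (𝕜 := ℝ)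
      (fun y _ => hdiff y) (fun y hy => ?_) (convex_closedBall _ _) (by simp) (by simp)
    · simpa [pow_two, mul_assoc] using this
    · refine (hC.norm_sub_le y x).trans ?_
      gcongr
      simpa [dist_eq_norm] using hy
  refine ⟨2 * C, by positivity, fun x z => ?_⟩
  have h1 := abs_le.1 (key x z)
  have h2 := abs_le.1 (key x (-z))
  rw [norm_neg, map_neg, ← sub_eq_add_neg] at h2
  unfold secDiff
  rw [abs_le]
  constructor <;> linarith

lemma IsTest.secDiff_le {θ : 𝔼 → ℝ} (hθ : IsTest θ) :
    ∃ C, 0 ≤ C ∧ ∀ x z, |secDiff θ x z| ≤ C * min 1 (‖z‖ ^ 2) := by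
  obtain ⟨C, hC0, hC⟩ := hθ.secDiff_le_sq
  obtain ⟨M, hM0, hM⟩ := hθ.bounded
  refine ⟨max C (4 * M), by positivity, fun x z => ?_⟩
  rcases min_cases 1 (‖z‖ ^ 2) with h | h <;> rw [h.1]
  · rw [mul_one]
    exact (secDiff_bound_of_abs_le hM x z).trans (le_max_right _ _)
  · refine (hC x z).trans ?_
    gcongr
    exact le_max_left _ _

/-- Second differences of `w` at `x` are dominated, so that the singular integral converges. -/
def SecBound (w : 𝔼 → ℝ) (C : ℝ) (x : 𝔼) : Prop := ∀ z, |secDiff w x z| ≤ C * min 1 (‖z‖ ^ 2)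

lemma SecBound.div_le {w : 𝔼 → ℝ} {C : ℝ} {x : 𝔼} (h : SecBound w C x) (z : 𝔼) :
    |secDiff w x z / ‖z‖ ^ ((N : ℝ) + α)| ≤ C * levyWeight N α z := by
  rw [abs_div, abs_of_nonneg (a := ‖z‖ ^ ((N : ℝ) + α)) (by positivity), levyWeight,
    ← mul_div_assoc]
  have := h z
  gcongr

lemma measurable_secDiff {w : 𝔼 → ℝ} (hw : Measurable w) :
    Measurable fun p : 𝔼 × 𝔼 => secDiff w p.1 p.2 / ‖p.2‖ ^ ((N : ℝ) + α) := by
  unfold secDiff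
  fun_prop

lemma SecBound.integrable [StableParams N α] {w : 𝔼 → ℝ}
    (hw : Measurable w) {C : ℝ} {x : 𝔼} (h : SecBound w C x) :
    Integrable fun z => secDiff w x z / ‖z‖ ^ ((N : ℝ) + α) := by
  refine Integrable.mono' ((integrable_levyWeight (N := N) (α := α)).const_mul C) ?_
    (Eventually.of_forall fun z => h.div_le (α := α) z)
  exact ((measurable_secDiff hw).comp (measurable_const.prodMk measurable_id)).aestronglyMeasurable

lemma SecBound.abs_fracLap_le [StableParams N α] {w : 𝔼 → ℝ}
    {C : ℝ} {x : 𝔼} (h : SecBound w C x) :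
    |fracLap N α w x| ≤ fracLapCoeff N α / 2 * (C * ∫ z, levyWeight N α z) := by
  have hc := fracLapCoeff_pos N α
  rw [fracLap_def, abs_mul, abs_of_pos (by positivity), ← integral_const_mul]
  gcongr
  exact norm_integral_le_of_norm_le (f := fun z => secDiff w x z / ‖z‖ ^ ((N : ℝ) + α))
    ((integrable_levyWeight (N := N) (α := α)).const_mul C)
    (Eventually.of_forall fun z => h.div_le (α := α) z)

lemma IsTest.abs_fracLap_le [StableParams N α] {θ : 𝔼 → ℝ}
    (hθ : IsTest θ) : ∃ K, 0 ≤ K ∧ ∀ x, |fracLap N α θ x| ≤ K := by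
  obtain ⟨C, hC0, hC⟩ := hθ.secDiff_le
  have := fun x => SecBound.abs_fracLap_le (α := α) (hC x)
  exact ⟨_, (abs_nonneg _).trans (this 0), this⟩

lemma measurable_fracLap {w : 𝔼 → ℝ} (hw : Measurable w) : Measurable (fracLap N α w) := by
  have : StronglyMeasurable fun x => ∫ z, secDiff w x z / ‖z‖ ^ ((N : ℝ) + α) :=
    StronglyMeasurable.integral_prod_right (measurable_secDiff hw).stronglyMeasurable
  exact this.measurable.const_mul _

lemma IsTest.integrable_secDiff {θ : 𝔼 → ℝ} (hθ : IsTest θ) (z : 𝔼) :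
    Integrable fun x => secDiff θ x z := by
  have h := hθ.integrable
  exact ((h.comp_add_right z).add (h.comp_sub_right z)).sub (h.const_mul 2)

lemma IsTest.integral_abs_secDiff_le {θ : 𝔼 → ℝ} (hθ : IsTest θ) :
    ∃ C, 0 ≤ C ∧ ∀ z, ∫ x, |secDiff θ x z| ≤ C * min 1 (‖z‖ ^ 2) := by
  have h := hθ.integrable
  obtain ⟨C, hC0, hC⟩ := hθ.secDiff_le_sq
  obtain ⟨R, hR⟩ := hθ.compact.isBounded.subset_closedBall 0
  set S : Set 𝔼 := Metric.closedBall 0 (R + 1) with hS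
  have hSfin : volume S ≠ ⊤ := (isCompact_closedBall _ _).measure_lt_top.ne
  refine ⟨max (4 * ∫ x, |θ x|) (C * volume.real S), ?_, fun z => ?_⟩
  · exact le_max_of_le_right (by positivity)
  rcases min_cases 1 (‖z‖ ^ 2) with hm | hm <;> rw [hm.1]
  · rw [mul_one]
    refine le_trans ?_ (le_max_left _ _)
    have e1 : ∫ x, |θ (x + z)| = ∫ x, |θ x| := integral_add_right_eq_self (fun x => |θ x|) z
    have e2 : ∫ x, |θ (x - z)| = ∫ x, |θ x| := integral_sub_right_eq_self (fun x => |θ x|) z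
    have i1 := (h.comp_add_right z).abs
    have i2 := (h.comp_sub_right z).abs
    calc ∫ x, |secDiff θ x z| ≤ ∫ x, (|θ (x + z)| + |θ (x - z)| + 2 * |θ x|) := by
          refine integral_mono (hθ.integrable_secDiff z).abs
            ((i1.add i2).add (h.abs.const_mul 2)) fun x => ?_
          have h1 := abs_sub (θ (x + z) + θ (x - z)) (2 * θ x)
          have h2 := abs_add_le (θ (x + z)) (θ (x - z))
          rw [abs_mul, abs_two] at h1
          simp only [secDiff]
          linarith
      _ = 4 * ∫ x, |θ x| := by
          have i12 : Integrable fun x => |θ (x + z)| + |θ (x - z)| := i1.add i2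
          rw [integral_add i12 (h.abs.const_mul 2), integral_add i1 i2, e1, e2,
            integral_const_mul]
          ring
  · have hz : ‖z‖ ≤ 1 := by nlinarith [norm_nonneg z]
    have hb : ∀ x, |secDiff θ x z| ≤ S.indicator (fun _ => C * ‖z‖ ^ 2) x := by
      intro x
      by_cases hx : x ∈ S
      · rw [Set.indicator_of_mem hx]
        exact hC x z
      · rw [Set.indicator_of_notMem hx]
        have hx' : R + 1 < ‖x‖ := by simpa [hS] using hx
        have key : ∀ y : 𝔼, R < ‖y‖ → θ y = 0 := fun y hy =>
          image_eq_zero_of_notMem_tsupport fun hy' => by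
            have := hR hy'
            rw [mem_closedBall_zero_iff] at this
            linarith
        have n1 : ‖x‖ ≤ ‖x + z‖ + ‖z‖ := by simpa using norm_sub_le (x + z) z
        have n2 : ‖x‖ ≤ ‖x - z‖ + ‖z‖ := by simpa using norm_add_le (x - z) z
        simp [secDiff, key x (by linarith), key (x + z) (by linarith),
          key (x - z) (by linarith)]
    calc ∫ x, |secDiff θ x z| ≤ ∫ x, S.indicator (fun _ => C * ‖z‖ ^ 2) x := by
          refine integral_mono (hθ.integrable_secDiff z).abs ?_ hb
          exact (integrable_indicator_iff Metric.isClosed_closedBall.measurableSet).2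
            (integrableOn_const hSfin)
      _ = (C * volume.real S) * ‖z‖ ^ 2 := by
          rw [integral_indicator Metric.isClosed_closedBall.measurableSet, setIntegral_const,
            smul_eq_mul]
          ring
      _ ≤ _ := by
          gcongr
          exact le_max_right _ _

lemma IsTest.measurable {θ : 𝔼 → ℝ} (hθ : IsTest θ) : Measurable θ :=
  hθ.smooth.continuous.measurable

lemma IsTest.integral_mul_secDiff {θ : 𝔼 → ℝ} (hθ : IsTest θ) {w : 𝔼 → ℝ}
    (hw : Measurable w) {M : ℝ} (hM : ∀ x, |w x| ≤ M) (z : 𝔼) :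
    ∫ x, w x * secDiff θ x z = ∫ x, θ x * secDiff w x z := by
  have hi : ∀ (a b : 𝔼), Integrable fun x => w (x + a) * θ (x + b) := fun a b =>
    (hθ.integrable.comp_add_right b).bdd_mul
      (hw.comp (measurable_id.add_const a)).aestronglyMeasurable (Eventually.of_forall fun x => hM _)
  have e1 : ∫ x, w x * θ (x + z) = ∫ x, w (x - z) * θ x := by
    rw [← integral_sub_right_eq_self _ z]; simp
  have e2 : ∫ x, w x * θ (x - z) = ∫ x, w (x + z) * θ x := by
    rw [← integral_add_right_eq_self _ z]; simp
  have i0 : Integrable fun x => w x * θ x := by simpa using hi 0 0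
  have i1 : Integrable fun x => w x * θ (x + z) := by simpa using hi 0 z
  have i2 : Integrable fun x => w x * θ (x - z) := by simpa [sub_eq_add_neg] using hi 0 (-z)
  have i3 : Integrable fun x => w (x + z) * θ x := by simpa using hi z 0
  have i4 : Integrable fun x => w (x - z) * θ x := by simpa [sub_eq_add_neg] using hi (-z) 0
  calc ∫ x, w x * secDiff θ x z
      = ∫ x, (w x * θ (x + z) + w x * θ (x - z) - 2 * (w x * θ x)) := by
        congr 1; ext x; simp only [secDiff]; ring
    _ = ∫ x, (w (x + z) * θ x + w (x - z) * θ x - 2 * (w x * θ x)) := by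
        have i12 : Integrable fun x => w x * θ (x + z) + w x * θ (x - z) := i1.add i2
        have i34 : Integrable fun x => w (x + z) * θ x + w (x - z) * θ x := i3.add i4
        rw [integral_sub i12 (i0.const_mul 2), integral_add i1 i2,
          integral_sub i34 (i0.const_mul 2), integral_add i3 i4, e1, e2]
        ring
    _ = _ := by
        congr 1; ext x; simp only [secDiff]; ring

section Fubini

variable [StableParams N α]

lemma IsTest.integrable_prod {θ : 𝔼 → ℝ}
    (hθ : IsTest θ) :
    Integrable (fun p : 𝔼 × 𝔼 => secDiff θ p.1 p.2 / ‖p.2‖ ^ ((N : ℝ) + α))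
      (volume.prod volume) := by
  have hm := measurable_secDiff (N := N) (α := α) hθ.measurable
  obtain ⟨C, hC0, hC⟩ := hθ.integral_abs_secDiff_le
  rw [integrable_prod_iff' hm.aestronglyMeasurable]
  refine ⟨Eventually.of_forall fun z => ?_, ?_⟩
  · exact (hθ.integrable_secDiff z).div_const (‖z‖ ^ ((N : ℝ) + α))
  · refine Integrable.mono' ((integrable_levyWeight (N := N) (α := α)).const_mul C) ?_
      (Eventually.of_forall fun z => ?_)
    · exact (StronglyMeasurable.integral_prod_left'
        (hm.norm.stronglyMeasurable)).aestronglyMeasurable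
    · have e : ∀ x, ‖secDiff θ x z / ‖z‖ ^ ((N : ℝ) + α)‖ =
          |secDiff θ x z| / ‖z‖ ^ ((N : ℝ) + α) := fun x => by
        rw [Real.norm_eq_abs, abs_div, abs_of_nonneg (a := ‖z‖ ^ ((N : ℝ) + α)) (by positivity)]
      simp only [e, integral_div]
      rw [Real.norm_eq_abs, abs_of_nonneg (by positivity), levyWeight, ← mul_div_assoc]
      have := hC z
      gcongr

lemma IsTest.integrable_fracLap {θ : 𝔼 → ℝ}
    (hθ : IsTest θ) : Integrable (fracLap N α θ) :=
  (hθ.integrable_prod.integral_prod_left).const_mul _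

lemma IsTest.integrable_mul_fracLap {θ : 𝔼 → ℝ} (hθ : IsTest θ) {w : 𝔼 → ℝ}
    (hw : Measurable w) {M : ℝ} (hM : ∀ x, |w x| ≤ M) :
    Integrable fun x => w x * fracLap N α θ x :=
  hθ.integrable_fracLap.bdd_mul hw.aestronglyMeasurable (Eventually.of_forall hM)

lemma IsTest.integrable_prod_mul {θ : 𝔼 → ℝ} (hθ : IsTest θ) {w : 𝔼 → ℝ}
    (hw : Measurable w) {M : ℝ} (hM : ∀ x, |w x| ≤ M) :
    Integrable (fun p : 𝔼 × 𝔼 => w p.1 * (secDiff θ p.1 p.2 / ‖p.2‖ ^ ((N : ℝ) + α)))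
      (volume.prod volume) :=
  hθ.integrable_prod.bdd_mul (hw.comp measurable_fst).aestronglyMeasurable
    (Eventually.of_forall fun p => hM p.1)

lemma IsTest.integrable_integral_mul_secDiff {θ : 𝔼 → ℝ} (hθ : IsTest θ) {w : 𝔼 → ℝ}
    (hw : Measurable w) {M : ℝ} (hM : ∀ x, |w x| ≤ M) :
    Integrable fun z => (∫ x, w x * secDiff θ x z) / ‖z‖ ^ ((N : ℝ) + α) := by
  have := (hθ.integrable_prod_mul (α := α) hw hM).integral_prod_right
  simpa only [← mul_div_assoc, integral_div] using this

lemma IsTest.integral_mul_fracLap {θ : 𝔼 → ℝ} (hθ : IsTest θ) {w : 𝔼 → ℝ}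
    (hw : Measurable w) {M : ℝ} (hM : ∀ x, |w x| ≤ M) :
    ∫ x, w x * fracLap N α θ x =
      fracLapCoeff N α / 2 * ∫ z, (∫ x, w x * secDiff θ x z) / ‖z‖ ^ ((N : ℝ) + α) := by
  have h := hθ.integrable_prod_mul (α := α) hw hM
  have := integral_integral_swap (f := fun x z => w x * (secDiff θ x z / ‖z‖ ^ ((N : ℝ) + α))) h
  simp only [integral_const_mul] at this
  simp only [← mul_div_assoc, integral_div] at this
  rw [← this, ← integral_const_mul]
  congr 1
  ext x
  rw [fracLap_def]
  ring

/-- The fractional Laplacian of a function with controlled second differences on the support of a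
test function can be evaluated pointwise. -/
lemma IsTest.integral_mul_fracLap_comm {θ : 𝔼 → ℝ} (hθ : IsTest θ) {w : 𝔼 → ℝ}
    (hw : Measurable w) {M : ℝ} (hM : ∀ x, |w x| ≤ M) {C : ℝ}
    (hC : ∀ x ∈ tsupport θ, SecBound w C x) :
    ∫ x, w x * fracLap N α θ x = ∫ x, fracLap N α w x * θ x := by
  have hm := measurable_secDiff (N := N) (α := α) hw
  have hp : Integrable (fun p : 𝔼 × 𝔼 => θ p.1 * (secDiff w p.1 p.2 / ‖p.2‖ ^ ((N : ℝ) + α)))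
      (volume.prod volume) := by
    refine Integrable.mono' (hθ.integrable.abs.mul_prod
      ((integrable_levyWeight (N := N) (α := α)).const_mul C)) ?_ (Eventually.of_forall fun p => ?_)
    · exact ((hθ.measurable.comp measurable_fst).mul hm).aestronglyMeasurable
    · by_cases h : p.1 ∈ tsupport θ
      · rw [norm_mul]
        exact mul_le_mul_of_nonneg_left ((hC p.1 h).div_le p.2) (abs_nonneg _)
      · simp [image_eq_zero_of_notMem_tsupport h]
  have := integral_integral_swap (f := fun x z => θ x * (secDiff w x z / ‖z‖ ^ ((N : ℝ) + α))) hp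
  simp only [integral_const_mul] at this
  simp only [← mul_div_assoc, integral_div] at this
  rw [hθ.integral_mul_fracLap hw hM]
  simp only [hθ.integral_mul_secDiff hw hM]
  rw [← this, ← integral_const_mul]
  congr 1
  ext x
  rw [fracLap_def]
  ring

end Fubini

end FracLapTheory

section FracLapTheory

set_option linter.unusedSectionVars false

variable {N : ℕ} {α : ℝ} [StableParams N α]

local notation "𝔼" => EuclideanSpace ℝ (Fin N)

/-- `Δ^{α/2} w = g` on `U` in the sense of distributions. -/
def FracEq (N : ℕ) (α : ℝ) (U : Set (EuclideanSpace ℝ (Fin N)))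
    (w g : EuclideanSpace ℝ (Fin N) → ℝ) : Prop :=
  ∀ θ, IsTest θ → tsupport θ ⊆ U → ∫ x, w x * fracLap N α θ x = ∫ x, g x * θ x

lemma IsTest.comp_sub_left {η : 𝔼 → ℝ} (hη : IsTest η) (x : 𝔼) : IsTest fun y => η (x - y) where
  smooth := hη.smooth.comp (contDiff_const.sub contDiff_id)
  compact := hη.compact.comp_homeomorph (Homeomorph.subLeft x)

lemma exists_ne_zero_of_integral_nonneg {F : 𝔼 → ℝ} (hF : Integrable F) (h0 : ∀ z, F z ≤ 0)
    (hint : 0 ≤ ∫ z, F z) {U : Set 𝔼} (hU : IsOpen U) (hne : U.Nonempty) : ∃ z ∈ U, F z = 0 := by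
  have h1 : ∫ z, (-F) z = 0 := by
    rw [integral_neg']
    have := integral_nonpos (μ := volume) h0
    linarith
  rw [integral_eq_zero_iff_of_nonneg (fun z => by simpa using h0 z) hF.neg] at h1
  by_contra! hcon
  have h2 : volume U = 0 := by
    refine measure_mono_null (fun z hz => ?_) (ae_iff.1 h1)
    simpa using hcon z hz
  exact (hU.measure_pos volume hne).ne' h2

/-- The maximum principle for continuous functions that are subsolutions, in the sense of
distributions, where they are positive. -/
theorem nonpos_of_integral_mul_fracLap_nonneg {w : 𝔼 → ℝ} (hw : Continuous w) {M : ℝ}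
    (hM : ∀ x, |w x| ≤ M) (hbd : ∀ η > 0, Bornology.IsBounded {x | η ≤ w x})
    (hΔ : ∀ θ, IsTest θ → (∀ x, 0 ≤ θ x) → tsupport θ ⊆ {x | 0 < w x} →
      0 ≤ ∫ x, w x * fracLap N α θ x) (x : 𝔼) : w x ≤ 0 := by
  by_contra! hx
  have hcpt : ∀ η > 0, IsCompact {x | η ≤ w x} := fun η hη =>
    Metric.isCompact_of_isClosed_isBounded (isClosed_le continuous_const hw) (hbd η hη)
  obtain ⟨x₀, hx₀, hmax⟩ := (hcpt _ hx).exists_isMaxOn ⟨x, by simp⟩ hw.continuousOn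
  set m := w x₀ with hm
  have hm0 : 0 < m := hx.trans_le hx₀
  have hK := hcpt (m / 2) (by positivity)
  set K := {x | m / 2 ≤ w x} with hKdef
  have hx₀K : x₀ ∈ K := by simp only [hKdef, Set.mem_ofPred_eq]; linarith
  obtain ⟨δ, hδ0, hδ⟩ := hK.exists_cthickening_subset_open (t := {x | 0 < w x})
    (isOpen_lt continuous_const hw) (fun y hy => by
      simp only [hKdef, Set.mem_ofPred_eq] at hy ⊢
      linarith)
  obtain ⟨ε', hε'0, hε'⟩ := Metric.isOpen_iff.1 (isOpen_lt (continuous_const (y := 3 * m / 4)) hw)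
    x₀ (by simp only [Set.mem_ofPred_eq]; linarith)
  set ε := min (δ / 2) ε' with hε
  have hε0 : 0 < ε := by positivity
  let η : ContDiffBump (0 : 𝔼) := ⟨ε / 2, ε, by positivity, by linarith⟩
  have hη : IsTest η := ⟨η.contDiff, η.hasCompactSupport⟩
  have hη0 : ∀ y : 𝔼, ε ≤ ‖y‖ → η y = 0 := fun y hy => η.zero_of_le_dist (by simpa [η] using hy)
  set I := ∫ y, η y with hI
  have hI0 : 0 < I := η.integral_pos
  set W : 𝔼 → ℝ := fun x => ∫ y, w y * η (x - y) with hW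
  have hW' : ∀ x, W x = ∫ y, w (x - y) * η y := fun x => by
    rw [hW, ← integral_sub_left_eq_self _ volume x]; simp
  have hWi : ∀ x, Integrable fun y => w (x - y) * η y := fun x =>
    hη.integrable.bdd_mul (by fun_prop) (Eventually.of_forall fun y => hM _)
  have hWc : Continuous W := by
    rw [funext hW']
    refine continuous_of_dominated (bound := fun y => M * η y) (fun x => ?_) (fun x => ?_)
      (hη.integrable.const_mul M) ?_
    · exact (hWi x).aestronglyMeasurable
    · refine Eventually.of_forall fun y => ?_
      rw [norm_mul, Real.norm_of_nonneg (η.nonneg)]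
      exact mul_le_mul_of_nonneg_right (hM _) η.nonneg
    · exact Eventually.of_forall fun y => by fun_prop
  have hW0 : 3 * m / 4 * I ≤ W x₀ := by
    rw [hW', hI, ← integral_const_mul]
    refine integral_mono (hη.integrable.const_mul _) (hWi x₀) fun y => ?_
    by_cases hy : ‖y‖ < ε
    · refine mul_le_mul_of_nonneg_right ?_ η.nonneg
      have : x₀ - y ∈ Metric.ball x₀ ε' := by
        simpa using hy.trans_le (min_le_right _ _)
      exact (hε' this).le
    · simp [hη0 y (not_lt.1 hy)]
  have hWout : ∀ x, x ∉ Metric.cthickening ε K → W x ≤ m / 2 * I := by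
    intro x hx
    rw [hW', hI, ← integral_const_mul]
    refine integral_mono (hWi x) (hη.integrable.const_mul _) fun y => ?_
    by_cases hy : ‖y‖ < ε
    · refine mul_le_mul_of_nonneg_right ?_ η.nonneg
      by_contra! hlt
      refine hx (Metric.mem_cthickening_of_dist_le x (x - y) ε K hlt.le ?_)
      simpa [dist_eq_norm] using hy.le
    · simp [hη0 y (not_lt.1 hy)]
  have hKε : IsCompact (Metric.cthickening ε K) := hK.cthickening
  have hsub : K ⊆ Metric.cthickening ε K := Metric.self_subset_cthickening K
  obtain ⟨x₁, hx₁, hmax₁⟩ := hKε.exists_isMaxOn ⟨x₀, hsub hx₀K⟩ hWc.continuousOn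
  have hx₁0 : 3 * m / 4 * I ≤ W x₁ := hW0.trans (hmax₁ (hsub hx₀K))
  have hmI : m / 2 * I < 3 * m / 4 * I := by nlinarith [mul_pos hm0 hI0]
  have hglob : ∀ x, W x ≤ W x₁ := fun x => by
    by_cases hx : x ∈ Metric.cthickening ε K
    · exact hmax₁ hx
    · linarith [hWout x hx]
  have hθ := hη.comp_sub_left x₁
  have h0 := hΔ _ hθ (fun y => η.nonneg) (by
    refine Set.Subset.trans ?_ hδ
    refine closure_minimal (fun y hy => ?_) Metric.isClosed_cthickening
    have hy' : ‖x₁ - y‖ < ε := by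
      by_contra! hcon
      exact hy (hη0 _ hcon)
    obtain ⟨k, hk, hkd⟩ : ∃ k ∈ K, dist x₁ k ≤ ε := by
      rw [hK.cthickening_eq_biUnion_closedBall hε0.le] at hx₁
      simpa using hx₁
    refine Metric.mem_cthickening_of_dist_le y k δ K hk ?_
    have h1 := dist_triangle_left y k x₁
    have h2 : ε ≤ δ / 2 := min_le_left _ _
    rw [dist_eq_norm x₁ y] at h1
    linarith)
  rw [hθ.integral_mul_fracLap hw.measurable hM] at h0
  have hc := fracLapCoeff_pos N α
  have hF := hθ.integrable_integral_mul_secDiff (α := α) hw.measurable hM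
  have hsec : ∀ z, ∫ y, w y * secDiff (fun y => η (x₁ - y)) y z =
      W (x₁ - z) + W (x₁ + z) - 2 * W x₁ := by
    intro z
    have hi : ∀ x, Integrable fun y => w y * η (x - y) := fun x =>
      (hη.comp_sub_left x).integrable.bdd_mul hw.aestronglyMeasurable
        (Eventually.of_forall fun y => hM _)
    have hi2 : Integrable fun y => w y * η (x₁ - z - y) + w y * η (x₁ + z - y) :=
      (hi _).add (hi _)
    rw [hW]
    simp only
    rw [← integral_const_mul, ← integral_add (hi _) (hi _), ← integral_sub hi2 ((hi _).const_mul 2)]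
    congr 1
    ext y
    simp only [secDiff]
    rw [show x₁ - (y + z) = x₁ - z - y by abel, show x₁ - (y - z) = x₁ + z - y by abel]
    ring
  have hneg : ∀ z, (∫ y, w y * secDiff (fun y => η (x₁ - y)) y z) / ‖z‖ ^ ((N : ℝ) + α) ≤ 0 := by
    intro z
    rw [hsec]
    refine div_nonpos_of_nonpos_of_nonneg ?_ (by positivity)
    linarith [hglob (x₁ - z), hglob (x₁ + z)]
  obtain ⟨R, hR⟩ := hKε.isBounded.subset_ball 0
  have := nontrivial_of_pos (StableParams.dim_pos N α)
  obtain ⟨z, hz, hz0⟩ := exists_ne_zero_of_integral_nonneg hF hneg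
    (nonneg_of_mul_nonneg_right h0 (by positivity)) (U := {z | max (R + ‖x₁‖) 0 < ‖z‖})
    (isOpen_lt continuous_const continuous_norm) (NormedSpace.exists_lt_norm ℝ 𝔼 _)
  simp only [Set.mem_ofPred_eq, max_lt_iff] at hz
  have hout : ∀ y : 𝔼, R ≤ ‖y‖ → W y ≤ m / 2 * I := fun y hy =>
    hWout y fun h => by simpa [not_lt.2 hy] using hR h
  have n1 := hout (x₁ - z) (by
    have := norm_sub_norm_le z x₁
    rw [norm_sub_rev] at this; linarith)
  have n2 := hout (x₁ + z) (by
    have := norm_sub_norm_le z (-x₁)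
    rw [norm_neg, sub_neg_eq_add, add_comm z] at this; linarith)
  rw [hsec, div_eq_zero_iff] at hz0
  rcases hz0 with h | h
  · linarith
  · exact (Real.rpow_pos_of_pos hz.2 _).ne' h

/-- The maximum principle for continuous distributional solutions. -/
theorem FracEq.nonpos {U : Set 𝔼} {w g : 𝔼 → ℝ} (h : FracEq N α U w g) (hw : Continuous w) {M : ℝ}
    (hM : ∀ x, |w x| ≤ M) (hbd : ∀ η > 0, Bornology.IsBounded {x | η ≤ w x})
    (hU : ∀ x ∉ U, w x ≤ 0) (hg : ∀ x ∈ U, 0 < w x → 0 ≤ g x) (x : 𝔼) : w x ≤ 0 := by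
  have hsub : {x | 0 < w x} ⊆ U := fun y hy => by
    by_contra hyU
    exact (hU y hyU).not_gt hy
  refine nonpos_of_integral_mul_fracLap_nonneg (α := α) hw hM hbd (fun θ hθ hθ0 hθU => ?_) x
  rw [h θ hθ (hθU.trans hsub)]
  refine integral_nonneg fun y => ?_
  by_cases hy : y ∈ tsupport θ
  · exact mul_nonneg (hg y (hsub (hθU hy)) (hθU hy)) (hθ0 y)
  · simp [image_eq_zero_of_notMem_tsupport hy]

lemma fracLap_const (c : ℝ) : fracLap N α (fun _ => c) = 0 := by
  ext x
  have : ∀ z : 𝔼, secDiff (fun _ => c) x z = 0 := fun z => by simp only [secDiff]; ring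
  simp [fracLap_def, this]

/-- A bounded continuous distributional solution with bounded measurable right-hand side. -/
structure FracSol (N : ℕ) (α : ℝ) (U : Set (EuclideanSpace ℝ (Fin N)))
    (w g : EuclideanSpace ℝ (Fin N) → ℝ) : Prop where
  cont : Continuous w
  bdd : ∃ M, ∀ x, |w x| ≤ M
  meas : Measurable g
  rhs_bdd : ∃ M, ∀ x, |g x| ≤ M
  eq : FracEq N α U w g

lemma FracSol.mono {U V : Set 𝔼} {w g : 𝔼 → ℝ} (h : FracSol N α U w g) (hVU : V ⊆ U) :
    FracSol N α V w g :=
  ⟨h.cont, h.bdd, h.meas, h.rhs_bdd, fun θ hθ hs => h.eq θ hθ (hs.trans hVU)⟩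

lemma FracEq.congr_rhs {U : Set 𝔼} {w g g' : 𝔼 → ℝ} (h : FracEq N α U w g)
    (hg : ∀ x ∈ U, g x = g' x) : FracEq N α U w g' := fun θ hθ hs => by
  rw [h θ hθ hs]
  refine integral_congr_ae (Eventually.of_forall fun x => ?_)
  by_cases hx : x ∈ tsupport θ
  · simp only [hg x (hs hx)]
  · simp [image_eq_zero_of_notMem_tsupport hx]

lemma FracSol.congr_rhs {U : Set 𝔼} {w g g' : 𝔼 → ℝ} (h : FracSol N α U w g)
    (hm : Measurable g') (hb : ∃ M, ∀ x, |g' x| ≤ M) (hg : ∀ x ∈ U, g x = g' x) :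
    FracSol N α U w g' :=
  ⟨h.cont, h.bdd, hm, hb, h.eq.congr_rhs hg⟩

lemma FracSol.add {U : Set 𝔼} {w₁ w₂ g₁ g₂ : 𝔼 → ℝ} (h₁ : FracSol N α U w₁ g₁)
    (h₂ : FracSol N α U w₂ g₂) :
    FracSol N α U (fun x => w₁ x + w₂ x) (fun x => g₁ x + g₂ x) := by
  obtain ⟨M₁, hM₁⟩ := h₁.bdd
  obtain ⟨M₂, hM₂⟩ := h₂.bdd
  obtain ⟨K₁, hK₁⟩ := h₁.rhs_bdd
  obtain ⟨K₂, hK₂⟩ := h₂.rhs_bdd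
  refine ⟨h₁.cont.add h₂.cont, ⟨M₁ + M₂, fun x => (abs_add_le _ _).trans
    (add_le_add (hM₁ x) (hM₂ x))⟩, h₁.meas.add h₂.meas, ⟨K₁ + K₂, fun x => (abs_add_le _ _).trans
    (add_le_add (hK₁ x) (hK₂ x))⟩, fun θ hθ hs => ?_⟩
  simp only [add_mul]
  rw [integral_add (hθ.integrable_mul_fracLap h₁.cont.measurable hM₁)
    (hθ.integrable_mul_fracLap h₂.cont.measurable hM₂), h₁.eq θ hθ hs, h₂.eq θ hθ hs,
    integral_add]
  · exact hθ.integrable.bdd_mul h₁.meas.aestronglyMeasurable (Eventually.of_forall hK₁)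
  · exact hθ.integrable.bdd_mul h₂.meas.aestronglyMeasurable (Eventually.of_forall hK₂)

lemma FracSol.const_mul {U : Set 𝔼} {w g : 𝔼 → ℝ} (h : FracSol N α U w g) (c : ℝ) :
    FracSol N α U (fun x => c * w x) (fun x => c * g x) := by
  obtain ⟨M, hM⟩ := h.bdd
  obtain ⟨K, hK⟩ := h.rhs_bdd
  refine ⟨h.cont.const_mul c, ⟨|c| * M, fun x => ?_⟩, h.meas.const_mul c, ⟨|c| * K, fun x => ?_⟩,
    fun θ hθ hs => ?_⟩
  · rw [abs_mul]; exact mul_le_mul_of_nonneg_left (hM x) (abs_nonneg c)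
  · rw [abs_mul]; exact mul_le_mul_of_nonneg_left (hK x) (abs_nonneg c)
  · simp only [mul_assoc, integral_const_mul, h.eq θ hθ hs]

lemma FracSol.neg {U : Set 𝔼} {w g : 𝔼 → ℝ} (h : FracSol N α U w g) :
    FracSol N α U (fun x => -w x) (fun x => -g x) := by
  simpa using h.const_mul (-1)

lemma FracSol.sub {U : Set 𝔼} {w₁ w₂ g₁ g₂ : 𝔼 → ℝ} (h₁ : FracSol N α U w₁ g₁)
    (h₂ : FracSol N α U w₂ g₂) :
    FracSol N α U (fun x => w₁ x - w₂ x) (fun x => g₁ x - g₂ x) := by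
  simpa [sub_eq_add_neg] using h₁.add h₂.neg

lemma FracSol.of_secBound {U : Set 𝔼} {w g : 𝔼 → ℝ} (hw : Continuous w)
    (hM : ∃ M, ∀ x, |w x| ≤ M) {C : ℝ} (hC : ∀ x ∈ U, SecBound w C x) (hg : Measurable g)
    (hgb : ∃ M, ∀ x, |g x| ≤ M) (hgU : ∀ x ∈ U, g x = fracLap N α w x) : FracSol N α U w g := by
  obtain ⟨M, hM⟩ := hM
  refine ⟨hw, ⟨M, hM⟩, hg, hgb, FracEq.congr_rhs (g := fracLap N α w) (fun θ hθ hs => ?_)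
    fun x hx => (hgU x hx).symm⟩
  exact hθ.integral_mul_fracLap_comm hw.measurable hM fun x hx => hC x (hs hx)

variable (N α) in
lemma FracSol.const (c : ℝ) : FracSol N α Set.univ (fun _ => c) 0 :=
  .of_secBound continuous_const ⟨|c|, fun _ => le_rfl⟩ (C := 0)
    (fun x _ z => by simp only [secDiff]; ring_nf; simp) measurable_zero ⟨0, by simp⟩
    fun x _ => by rw [fracLap_const]

lemma IsTest.fracSol {θ : 𝔼 → ℝ} (hθ : IsTest θ) :
    FracSol N α Set.univ θ (fracLap N α θ) := by
  obtain ⟨C, -, hC⟩ := hθ.secDiff_le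
  obtain ⟨M, -, hM⟩ := hθ.bounded
  obtain ⟨K, -, hK⟩ := hθ.abs_fracLap_le (α := α)
  exact .of_secBound hθ.smooth.continuous ⟨M, hM⟩ (fun x _ => hC x)
    (measurable_fracLap hθ.measurable) ⟨K, hK⟩ fun _ _ => rfl

/-- The comparison principle. -/
theorem FracSol.le {U : Set 𝔼} {w₁ w₂ g₁ g₂ : 𝔼 → ℝ} (h₁ : FracSol N α U w₁ g₁)
    (h₂ : FracSol N α U w₂ g₂) (hbd : ∀ η > 0, Bornology.IsBounded {x | η ≤ w₁ x - w₂ x})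
    (hU : ∀ x ∉ U, w₁ x ≤ w₂ x) (hg : ∀ x ∈ U, w₂ x < w₁ x → g₂ x ≤ g₁ x) (x : 𝔼) :
    w₁ x ≤ w₂ x := by
  obtain ⟨M, hM⟩ := (h₁.sub h₂).bdd
  have := FracEq.nonpos (h₁.sub h₂).eq (h₁.sub h₂).cont hM hbd
    (fun x hx => sub_nonpos.2 (hU x hx))
    (fun x hx h => sub_nonneg.2 (hg x hx (by linarith))) x
  linarith

theorem FracSol.le_of_isBounded {U : Set 𝔼} {w₁ w₂ g₁ g₂ : 𝔼 → ℝ} (h₁ : FracSol N α U w₁ g₁)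
    (h₂ : FracSol N α U w₂ g₂) (hb : Bornology.IsBounded U)
    (hU : ∀ x ∉ U, w₁ x ≤ w₂ x) (hg : ∀ x ∈ U, w₂ x < w₁ x → g₂ x ≤ g₁ x) (x : 𝔼) :
    w₁ x ≤ w₂ x := by
  refine h₁.le h₂ (fun η hη => hb.subset fun y hy => ?_) hU hg x
  by_contra hcon
  have h3 := hU y hcon
  simp only [Set.mem_ofPred_eq] at hy
  linarith

lemma isBounded_of_tendsto_cocompact {w : 𝔼 → ℝ} (hw : Tendsto w (cocompact 𝔼) (𝓝 0)) {η : ℝ}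
    (hη : 0 < η) : Bornology.IsBounded {x | η ≤ w x} := by
  have h := hw.eventually_lt_const hη
  rw [← Metric.cobounded_eq_cocompact] at h
  rw [Bornology.isBounded_def]
  filter_upwards [h] with x hx
  simp only [Set.mem_compl_iff, Set.mem_ofPred_eq]
  linarith

theorem FracSol.le_of_tendsto {w₁ w₂ g₁ g₂ : 𝔼 → ℝ} (h₁ : FracSol N α Set.univ w₁ g₁)
    (h₂ : FracSol N α Set.univ w₂ g₂) (t₁ : Tendsto w₁ (cocompact 𝔼) (𝓝 0))
    (t₂ : Tendsto w₂ (cocompact 𝔼) (𝓝 0)) (hg : ∀ x, w₂ x < w₁ x → g₂ x ≤ g₁ x) (x : 𝔼) :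
    w₁ x ≤ w₂ x :=
  h₁.le h₂ (fun η hη => isBounded_of_tendsto_cocompact (by simpa using t₁.sub t₂) hη)
    (fun x hx => absurd (Set.mem_univ x) hx) (fun x _ => hg x) x

/-- Distributional equations pass to uniform limits. -/
lemma FracEq.of_tendstoUniformly {U : Set 𝔼} {w g : ℕ → 𝔼 → ℝ} {w' g' : 𝔼 → ℝ}
    (h : ∀ n, FracSol N α U (w n) (g n)) (hw : TendstoUniformly w w' atTop)
    (hg : ∀ x ∈ U, Tendsto (fun n => g n x) atTop (𝓝 (g' x))) {K : ℝ}
    (hK : ∀ n, ∀ x ∈ U, |g n x| ≤ K) : FracEq N α U w' g' := by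
  intro θ hθ hs
  have hc : Continuous w' := hw.continuous (Frequently.of_forall fun n => (h n).cont)
  obtain ⟨n₀, hn₀⟩ := (Metric.tendstoUniformly_iff.1 hw 1 one_pos).exists
  obtain ⟨M₀, hM₀⟩ := (h n₀).bdd
  have hM' : ∀ x, |w' x| ≤ M₀ + 1 := fun x => by
    have h1 := hn₀ x
    rw [Real.dist_eq] at h1
    have h2 := abs_sub_abs_le_abs_sub (w' x) (w n₀ x)
    linarith [hM₀ x]
  have l1 : Tendsto (fun n => ∫ x, w n x * fracLap N α θ x) atTop
      (𝓝 (∫ x, w' x * fracLap N α θ x)) := by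
    refine tendsto_integral_filter_of_dominated_convergence
      (fun x => (M₀ + 2) * |fracLap N α θ x|) (Eventually.of_forall fun n => ?_) ?_
      ((hθ.integrable_fracLap.abs).const_mul _) (Eventually.of_forall fun x => ?_)
    · obtain ⟨M, hM⟩ := (h n).bdd
      exact (hθ.integrable_mul_fracLap (h n).cont.measurable hM).aestronglyMeasurable
    · filter_upwards [Metric.tendstoUniformly_iff.1 hw 1 one_pos] with n hn
      refine Eventually.of_forall fun x => ?_
      rw [norm_mul, Real.norm_eq_abs, Real.norm_eq_abs]
      refine mul_le_mul_of_nonneg_right ?_ (abs_nonneg _)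
      have h1 := hn x
      rw [dist_comm, Real.dist_eq] at h1
      have h2 := abs_sub_abs_le_abs_sub (w n x) (w' x)
      linarith [hM' x]
    · exact (hw.tendsto_at x).mul_const _
  have l2 : Tendsto (fun n => ∫ x, g n x * θ x) atTop (𝓝 (∫ x, g' x * θ x)) := by
    refine tendsto_integral_of_dominated_convergence (fun x => K * |θ x|) (fun n => ?_)
      (hθ.integrable.abs.const_mul K) (fun n => Eventually.of_forall fun x => ?_)
      (Eventually.of_forall fun x => ?_)
    · exact ((h n).meas.mul hθ.measurable).aestronglyMeasurable
    · by_cases hx : x ∈ tsupport θ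
      · rw [norm_mul, Real.norm_eq_abs, Real.norm_eq_abs]
        exact mul_le_mul_of_nonneg_right (hK n x (hs hx)) (abs_nonneg _)
      · simp [image_eq_zero_of_notMem_tsupport hx]
    · by_cases hx : x ∈ tsupport θ
      · exact (hg x (hs hx)).mul_const _
      · simp [image_eq_zero_of_notMem_tsupport hx]
  refine tendsto_nhds_unique l1 (l2.congr fun n => ?_)
  exact ((h n).eq θ hθ hs).symm

lemma IsTest.comp_scale {θ : 𝔼 → ℝ} (hθ : IsTest θ) (p : 𝔼) {t : ℝ} (ht : 0 < t) :
    IsTest fun x => θ (t⁻¹ • (x - p)) where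
  smooth := hθ.smooth.comp ((contDiff_id.sub contDiff_const).const_smul t⁻¹)
  compact := hθ.compact.comp_homeomorph
    ((Homeomorph.subRight p).trans (Homeomorph.smulOfNeZero t⁻¹ (inv_ne_zero ht.ne')))

lemma fracLap_scale (θ : 𝔼 → ℝ) (p : 𝔼) {t : ℝ} (ht : 0 < t) (x : 𝔼) :
    fracLap N α (fun x => θ (t⁻¹ • (x - p))) x = t ^ (-α) * fracLap N α θ (t⁻¹ • (x - p)) := by
  rw [fracLap_def, fracLap_def]
  have h1 := Measure.integral_comp_smul volume
    (fun z : 𝔼 => secDiff θ (t⁻¹ • (x - p)) z / ‖z‖ ^ ((N : ℝ) + α)) t⁻¹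
  have h2 : ∀ z : 𝔼, secDiff (fun x => θ (t⁻¹ • (x - p))) x z / ‖z‖ ^ ((N : ℝ) + α) =
      (t⁻¹) ^ ((N : ℝ) + α) *
        (secDiff θ (t⁻¹ • (x - p)) (t⁻¹ • z) / ‖t⁻¹ • z‖ ^ ((N : ℝ) + α)) := by
    intro z
    have e1 : t⁻¹ • (x + z - p) = t⁻¹ • (x - p) + t⁻¹ • z := by rw [← smul_add]; congr 1; abel
    have e2 : t⁻¹ • (x - z - p) = t⁻¹ • (x - p) - t⁻¹ • z := by rw [← smul_sub]; congr 1; abel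
    simp only [secDiff, e1, e2]
    rw [norm_smul, Real.norm_of_nonneg (by positivity : 0 ≤ t⁻¹),
      Real.mul_rpow (by positivity) (norm_nonneg _)]
    have : (t⁻¹) ^ ((N : ℝ) + α) ≠ 0 := (Real.rpow_pos_of_pos (by positivity) _).ne'
    field_simp
  simp_rw [h2]
  rw [integral_const_mul, h1]
  simp only [finrank_euclideanSpace, Fintype.card_fin, smul_eq_mul]
  rw [abs_of_nonneg (by positivity), inv_pow, inv_inv, Real.inv_rpow ht.le, Real.rpow_neg ht.le,
    Real.rpow_add ht, Real.rpow_natCast]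
  field_simp

/-- A nonnegative test function has positive fractional Laplacian off its support. -/
lemma IsTest.le_fracLap {ψ : 𝔼 → ℝ} (hψ : IsTest ψ) (h0 : ∀ x, 0 ≤ ψ x) {x : 𝔼} {R : ℝ}
    (hx : ψ x = 0) (hR : ∀ y, ψ y ≠ 0 → ‖y - x‖ ≤ R) (hR0 : 0 < R) :
    fracLapCoeff N α / 2 * (R ^ (-((N : ℝ) + α)) * ∫ y, ψ y) ≤ fracLap N α ψ x := by
  obtain ⟨C, -, hC⟩ := hψ.secDiff_le
  have hi := SecBound.integrable (α := α) hψ.measurable (hC x)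
  have hc := fracLapCoeff_pos N α
  have hα := StableParams.pos N (α := α)
  rw [fracLap_def]
  refine mul_le_mul_of_nonneg_left ?_ (by positivity)
  rw [← integral_add_left_eq_self ψ x, ← integral_const_mul]
  refine integral_mono ((hψ.integrable.comp_add_left x).const_mul _) hi fun z => ?_
  simp only [secDiff, hx, mul_zero, sub_zero]
  by_cases hz : ψ (x + z) = 0
  · simp only [hz, mul_zero, zero_add]
    exact div_nonneg (h0 _) (by positivity)
  · have hz' := hR _ hz
    rw [add_sub_cancel_left] at hz'
    have hz0 : z ≠ 0 := fun h => hz (by simpa [h] using hx)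
    have hn : 0 < ‖z‖ := norm_pos_iff.2 hz0
    rw [Real.rpow_neg hR0.le, mul_comm, ← div_eq_mul_inv]
    refine (div_le_div_of_nonneg_left (h0 _) (by positivity)
      (Real.rpow_le_rpow hn.le hz' (by positivity))).trans ?_
    gcongr
    linarith [h0 (x - z)]

end FracLapTheory

section AbelKernel

/-- The kernel `s^(a-1) t^(-1-a)` restricted to the pairs of positive numbers with
`s < u ≤ s + t`. -/
def abelKer (a u : ℝ) (p : ℝ × ℝ) : ℝ :=
  open Classical in
  if 0 < p.1 ∧ 0 < p.2 ∧ p.1 < u ∧ u ≤ p.1 + p.2 then p.1 ^ (a - 1) * p.2 ^ (-1 - a) else 0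

lemma abelKer_nonneg (a u : ℝ) (p : ℝ × ℝ) : 0 ≤ abelKer a u p := by
  unfold abelKer
  split_ifs with h
  · have := h.1; have := h.2.1; positivity
  · exact le_rfl

lemma measurable_abelKer (a : ℝ) : Measurable fun q : ℝ × (ℝ × ℝ) => abelKer a q.1 q.2 := by
  classical
  unfold abelKer
  refine Measurable.ite ?_ (by fun_prop) measurable_const
  have h0 : Measurable fun q : ℝ × (ℝ × ℝ) => (0 : ℝ) := measurable_const
  have h1 : Measurable fun q : ℝ × (ℝ × ℝ) => q.2.1 := by fun_prop
  have h2 : Measurable fun q : ℝ × (ℝ × ℝ) => q.2.2 := by fun_prop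
  have h3 : Measurable fun q : ℝ × (ℝ × ℝ) => q.1 := by fun_prop
  exact (measurableSet_lt h0 h1).inter ((measurableSet_lt h0 h2).inter
    ((measurableSet_lt h1 h3).inter (measurableSet_le h3 (h1.add h2))))

lemma abelKer_scale (a : ℝ) {u : ℝ} (hu : 0 < u) (p : ℝ × ℝ) :
    abelKer a u p = (u ^ 2)⁻¹ * abelKer a 1 (u⁻¹ • p) := by
  unfold abelKer
  have hiff : (0 < (u⁻¹ • p).1 ∧ 0 < (u⁻¹ • p).2 ∧ (u⁻¹ • p).1 < 1 ∧
      1 ≤ (u⁻¹ • p).1 + (u⁻¹ • p).2) ↔ (0 < p.1 ∧ 0 < p.2 ∧ p.1 < u ∧ u ≤ p.1 + p.2) := by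
    simp only [Prod.smul_fst, Prod.smul_snd, smul_eq_mul, ← mul_add]
    rw [inv_mul_lt_iff₀ hu, mul_one, le_inv_mul_iff₀ hu, mul_one]
    simp [hu]
  by_cases h : 0 < p.1 ∧ 0 < p.2 ∧ p.1 < u ∧ u ≤ p.1 + p.2
  · rw [if_pos h, if_pos (hiff.2 h)]
    simp only [Prod.smul_fst, Prod.smul_snd, smul_eq_mul]
    rw [Real.mul_rpow (by positivity) h.1.le, Real.mul_rpow (by positivity) h.2.1.le]
    have e : u⁻¹ ^ (a - 1) * u⁻¹ ^ (-1 - a) = u ^ 2 := by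
      rw [← Real.rpow_add (by positivity), show a - 1 + (-1 - a) = -2 by ring,
        Real.inv_rpow hu.le, Real.rpow_neg hu.le, inv_inv]
      norm_cast
    calc _ = (u ^ 2)⁻¹ * u ^ 2 * (p.1 ^ (a - 1) * p.2 ^ (-1 - a)) := by
          rw [inv_mul_cancel₀ (by positivity), one_mul]
      _ = _ := by rw [← e]; ring
  · rw [if_neg h, if_neg (fun h' => h (hiff.1 h'))]; simp

lemma integrable_beta {a : ℝ} (ha : 0 < a) (ha1 : a < 1) :
    IntegrableOn (fun s : ℝ => s ^ (a - 1) * (1 - s) ^ (-a)) (Set.Ioo 0 1) := by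
  have i1 : IntegrableOn (fun s : ℝ => s ^ (a - 1)) (Set.Ioo 0 1) :=
    (intervalIntegrable_iff_integrableOn_Ioo_of_le zero_le_one).1
      (intervalIntegral.intervalIntegrable_rpow' (by linarith))
  have i2 : IntegrableOn (fun s : ℝ => (1 - s) ^ (-a)) (Set.Ioo 0 1) := by
    have := (intervalIntegral.intervalIntegrable_rpow' (a := 0) (b := 1) (r := -a)
      (by linarith)).comp_sub_left 1
    simp only [sub_zero, sub_self] at this
    exact (intervalIntegrable_iff_integrableOn_Ioo_of_le zero_le_one).1 this.symm
  have i3 : IntegrableOn (fun s : ℝ => 2 * s ^ (a - 1) + 2 * (1 - s) ^ (-a)) (Set.Ioo 0 1) :=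
    (i1.const_mul 2).add (i2.const_mul 2)
  refine Integrable.mono' i3 (by fun_prop) ?_
  rw [ae_restrict_iff' measurableSet_Ioo]
  refine Eventually.of_forall fun s hs => ?_
  have hs1 : 0 < 1 - s := by linarith [hs.2]
  have p1 := Real.rpow_pos_of_pos hs.1 (a - 1)
  have p2 := Real.rpow_pos_of_pos hs1 (-a)
  rw [Real.norm_of_nonneg (by positivity)]
  have half : ∀ b : ℝ, -1 ≤ b → b ≤ 0 → ∀ x : ℝ, 1 / 2 ≤ x → x ^ b ≤ 2 := by
    intro b hb hb0 x hx
    calc x ^ b ≤ (1 / 2 : ℝ) ^ b := Real.rpow_le_rpow_of_nonpos (by norm_num) hx hb0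
      _ ≤ (1 / 2 : ℝ) ^ (-1 : ℝ) :=
        Real.rpow_le_rpow_of_exponent_ge (by norm_num) (by norm_num) hb
      _ = 2 := by rw [Real.rpow_neg_one]; norm_num
  rcases le_total s (1 / 2) with h | h
  · have := half (-a) (by linarith) (by linarith) (1 - s) (by linarith)
    nlinarith
  · have := half (a - 1) (by linarith) (by linarith) s h
    nlinarith

lemma integrable_abelKer_one {a : ℝ} (ha : 0 < a) (ha1 : a < 1) : Integrable (abelKer a 1) := by
  have hm : Measurable (abelKer a 1) :=
    (measurable_abelKer a).comp (measurable_const.prodMk measurable_id)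
  have key : ∀ s t : ℝ, abelKer a 1 (s, t) = Set.indicator (Set.Ioo (0 : ℝ) 1)
      (fun s => s ^ (a - 1) * Set.indicator (Set.Ici (1 - s)) (fun t => t ^ (-1 - a)) t) s := by
    intro s t
    unfold abelKer
    by_cases hs : s ∈ Set.Ioo (0 : ℝ) 1
    · rw [Set.indicator_of_mem hs]
      by_cases ht : t ∈ Set.Ici (1 - s)
      · have : 1 - s ≤ t := ht
        rw [Set.indicator_of_mem ht, if_pos ⟨hs.1, by linarith [hs.2], hs.2, by linarith⟩]
      · rw [Set.indicator_of_notMem ht, if_neg, mul_zero]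
        rintro ⟨-, -, -, h⟩
        exact ht (show 1 - s ≤ t by linarith)
    · rw [Set.indicator_of_notMem hs, if_neg]
      exact fun h => hs ⟨h.1, h.2.2.1⟩
  have hin : ∀ s ∈ Set.Ioo (0 : ℝ) 1, IntegrableOn (fun t : ℝ => t ^ (-1 - a)) (Set.Ici (1 - s)) :=
    fun s hs => (integrableOn_Ici_iff_integrableOn_Ioi).2
      (integrableOn_Ioi_rpow_of_lt (by linarith) (by linarith [hs.2]))
  rw [Measure.volume_eq_prod, integrable_prod_iff hm.aestronglyMeasurable]
  constructor
  · refine Eventually.of_forall fun s => ?_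
    simp only [key]
    by_cases hs : s ∈ Set.Ioo (0 : ℝ) 1
    · simp only [Set.indicator_of_mem hs]
      exact ((hin s hs).integrable_indicator measurableSet_Ici).const_mul _
    · simp only [Set.indicator_of_notMem hs]
      exact integrable_zero _ _ _
  · have : (fun s : ℝ => ∫ t, ‖abelKer a 1 (s, t)‖) = Set.indicator (Set.Ioo (0 : ℝ) 1)
        (fun s => (s ^ (a - 1) * (1 - s) ^ (-a)) * a⁻¹) := by
      ext s
      simp_rw [Real.norm_of_nonneg (abelKer_nonneg a 1 _), key]
      by_cases hs : s ∈ Set.Ioo (0 : ℝ) 1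
      · simp only [Set.indicator_of_mem hs]
        rw [integral_const_mul, integral_indicator measurableSet_Ici, integral_Ici_eq_integral_Ioi,
          integral_Ioi_rpow_of_lt (by linarith) (by linarith [hs.2]),
          show -1 - a + 1 = -a by ring]
        field_simp
      · simp only [Set.indicator_of_notMem hs, integral_zero]
    rw [this]
    exact IntegrableOn.integrable_indicator ((integrable_beta ha ha1).mul_const _) measurableSet_Ioo

lemma integrable_abelKer {a : ℝ} (ha : 0 < a) (ha1 : a < 1) {u : ℝ} (hu : 0 < u) :
    Integrable (abelKer a u) := by
  rw [funext (abelKer_scale a hu)]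
  exact ((integrable_abelKer_one ha ha1).comp_smul (by positivity)).const_mul _

lemma integral_abelKer (a : ℝ) {u : ℝ} (hu : 0 < u) :
    ∫ p, abelKer a u p = ∫ p, abelKer a 1 p := by
  rw [funext (abelKer_scale a hu), integral_const_mul, Measure.integral_comp_smul]
  simp only [Module.finrank_prod, Module.finrank_self, smul_eq_mul]
  rw [abs_of_nonneg (by positivity)]
  norm_num
  field_simp

lemma integral_abelKer_one_pos {a : ℝ} (ha : 0 < a) (ha1 : a < 1) :
    0 < ∫ p, abelKer a 1 p := by
  rw [integral_pos_iff_support_of_nonneg (abelKer_nonneg a 1) (integrable_abelKer_one ha ha1)]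
  refine lt_of_lt_of_le ((isOpen_Ioo.prod isOpen_Ioo).measure_pos volume
    (U := Set.Ioo (0 : ℝ) 1 ×ˢ Set.Ioo (1 : ℝ) 2) ⟨(1 / 2, 3 / 2), by norm_num⟩)
    (measure_mono fun p hp => ?_)
  obtain ⟨⟨h1, h2⟩, h3, h4⟩ := hp
  have h5 : 0 < p.2 := by linarith
  rw [Function.mem_support, abelKer, if_pos ⟨h1, h5, h2, by linarith⟩]
  positivity

/-- Abel's inversion formula in the form needed for the composition of the Riesz potential and the
fractional Laplacian. -/
theorem integral_abel {a : ℝ} (ha : 0 < a) (ha1 : a < 1) {F F' : ℝ → ℝ}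
    (hF0 : ContinuousWithinAt F (Set.Ici 0) 0) (hF : ∀ u > 0, HasDerivAt F (F' u) u)
    (hF' : IntegrableOn F' (Set.Ioi 0)) (hlim : Tendsto F atTop (𝓝 0)) :
    ∫ p in Set.Ioi (0 : ℝ) ×ˢ Set.Ioi (0 : ℝ),
      p.1 ^ (a - 1) * p.2 ^ (-1 - a) * (F (p.1 + p.2) - F p.1) =
      -(∫ p, abelKer a 1 p) * F 0 := by
  have hm := measurable_abelKer a
  have hint : Integrable (fun q : (ℝ × ℝ) × ℝ => abelKer a q.2 q.1 * F' q.2)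
      (volume.prod (volume.restrict (Set.Ioi 0))) := by
    have hmeas : AEStronglyMeasurable (fun q : (ℝ × ℝ) × ℝ => abelKer a q.2 q.1 * F' q.2)
        (volume.prod (volume.restrict (Set.Ioi 0))) :=
      (hm.comp measurable_swap).aestronglyMeasurable.mul hF'.1.comp_snd
    rw [integrable_prod_iff' hmeas]
    constructor
    · rw [ae_restrict_iff' measurableSet_Ioi]
      exact Eventually.of_forall fun u hu => (integrable_abelKer ha ha1 hu).mul_const (F' u)
    · refine Integrable.congr (f := fun u => (∫ p, abelKer a 1 p) * ‖F' u‖)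
        (hF'.norm.const_mul _) ?_
      rw [EventuallyEq, ae_restrict_iff' measurableSet_Ioi]
      refine Eventually.of_forall fun u hu => ?_
      simp_rw [norm_mul, Real.norm_of_nonneg (abelKer_nonneg a u _)]
      rw [integral_mul_const, integral_abelKer a hu]
  have hswap := integral_integral_swap (f := fun p u => abelKer a u p * F' u) hint
  have hright : ∫ u in Set.Ioi 0, ∫ p, abelKer a u p * F' u = -(∫ p, abelKer a 1 p) * F 0 := by
    have : ∫ u in Set.Ioi 0, ∫ p, abelKer a u p * F' u =
        ∫ u in Set.Ioi 0, (∫ p, abelKer a 1 p) * F' u :=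
      setIntegral_congr_fun measurableSet_Ioi fun u hu => by
        simp only [integral_mul_const, integral_abelKer a hu]
    rw [this, integral_const_mul, integral_Ioi_of_hasDerivAt_of_tendsto hF0 hF hF' hlim]
    ring
  rw [← hright, ← hswap, ← integral_indicator (measurableSet_Ioi.prod measurableSet_Ioi)]
  congr 1
  ext p
  by_cases hp : p ∈ Set.Ioi (0 : ℝ) ×ˢ Set.Ioi (0 : ℝ)
  · obtain ⟨h1 : 0 < p.1, h2 : 0 < p.2⟩ := hp
    rw [Set.indicator_of_mem (show p ∈ Set.Ioi (0 : ℝ) ×ˢ Set.Ioi (0 : ℝ) from ⟨h1, h2⟩)]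
    have hle : p.1 ≤ p.1 + p.2 := by linarith
    have hsub : Set.Ioc p.1 (p.1 + p.2) ⊆ Set.Ioi 0 := fun u hu => h1.trans hu.1
    have e1 : F (p.1 + p.2) - F p.1 = ∫ u in Set.Ioc p.1 (p.1 + p.2), F' u := by
      rw [← intervalIntegral.integral_of_le hle,
        intervalIntegral.integral_eq_sub_of_hasDerivAt]
      · intro u hu
        rw [Set.uIcc_of_le hle] at hu
        exact hF u (h1.trans_le hu.1)
      · rw [intervalIntegrable_iff_integrableOn_Ioc_of_le hle]
        exact hF'.mono_set hsub
    have e2 : ∀ᵐ u : ℝ, u ∈ Set.Ioi (0 : ℝ) → abelKer a u p * F' u =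
        Set.indicator (Set.Ioc p.1 (p.1 + p.2))
          (fun u => p.1 ^ (a - 1) * p.2 ^ (-1 - a) * F' u) u := by
      refine Eventually.of_forall fun u hu => ?_
      unfold abelKer
      by_cases hu' : u ∈ Set.Ioc p.1 (p.1 + p.2)
      · rw [Set.indicator_of_mem hu', if_pos ⟨h1, h2, hu'.1, hu'.2⟩]
      · rw [Set.indicator_of_notMem hu', if_neg, zero_mul]
        exact fun h => hu' ⟨h.2.2.1, h.2.2.2⟩
    rw [setIntegral_congr_ae measurableSet_Ioi e2, setIntegral_indicator measurableSet_Ioc,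
      Set.inter_eq_right.2 hsub, integral_const_mul, e1]
  · rw [Set.indicator_of_notMem hp]
    have : ∀ u, abelKer a u p * F' u = 0 := fun u => by
      rw [abelKer, if_neg, zero_mul]
      exact fun h => hp ⟨h.1, h.2.1⟩
    simp [this]

end AbelKernel

section FracLapTheory

set_option linter.unusedSectionVars false

variable {N : ℕ} {α : ℝ}

local notation "𝔼" => EuclideanSpace ℝ (Fin N)

/-- The heat kernel `s^(-N/2) exp(-π‖y‖²/s)`, with time normalised so that no constants appear. -/
def gauss (N : ℕ) (s : ℝ) (y : EuclideanSpace ℝ (Fin N)) : ℝ :=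
  s ^ (-((N : ℝ) / 2)) * rexp (-(π / s) * ‖y‖ ^ 2)

lemma gauss_nonneg {s : ℝ} (hs : 0 < s) (y : 𝔼) : 0 ≤ gauss N s y := by
  unfold gauss; positivity

lemma measurable_gauss : Measurable fun q : ℝ × 𝔼 => gauss N q.1 q.2 := by
  unfold gauss; fun_prop

lemma integral_gauss {s : ℝ} (hs : 0 < s) : ∫ y, gauss N s y = 1 := by
  unfold gauss
  rw [integral_const_mul, GaussianFourier.integral_rexp_neg_mul_sq_norm (by positivity)]
  rw [div_div_cancel₀ pi_ne_zero, finrank_euclideanSpace, Fintype.card_fin,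
    ← Real.rpow_add hs, neg_add_cancel, Real.rpow_zero]

lemma integrable_gauss {s : ℝ} (hs : 0 < s) : Integrable (gauss N s) := by
  by_contra h
  have := integral_gauss (N := N) hs
  rw [integral_undef h] at this
  exact zero_ne_one this

lemma gauss_mul_gauss {s t : ℝ} (hs : 0 < s) (ht : 0 < t) (x y : 𝔼) :
    gauss N s y * gauss N t (x - y) =
      gauss N (s + t) x * gauss N (s * t / (s + t)) (y - (s / (s + t)) • x) := by
  have hst : 0 < s + t := by positivity
  unfold gauss
  rw [mul_mul_mul_comm, mul_mul_mul_comm ((s + t) ^ _), ← Real.mul_rpow hs.le ht.le,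
    ← Real.mul_rpow hst.le (by positivity), mul_div_cancel₀ _ hst.ne', ← Real.exp_add,
    ← Real.exp_add]
  congr 2
  rw [norm_sub_sq_real, norm_sub_sq_real, norm_smul, inner_smul_right, Real.norm_eq_abs, mul_pow,
    sq_abs, real_inner_comm]
  field_simp
  ring

lemma integral_gauss_mul_gauss {s t : ℝ} (hs : 0 < s) (ht : 0 < t) (x : 𝔼) :
    ∫ y, gauss N s y * gauss N t (x - y) = gauss N (s + t) x := by
  simp_rw [gauss_mul_gauss hs ht]
  rw [integral_const_mul, integral_sub_right_eq_self (gauss N (s * t / (s + t))),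
    integral_gauss (by positivity), mul_one]

/-- The heat extension at the origin. -/
def heat (N : ℕ) (θ : EuclideanSpace ℝ (Fin N) → ℝ) (s : ℝ) : ℝ := ∫ y, gauss N s y * θ y

lemma IsTest.heat_add {θ : 𝔼 → ℝ} (hθ : IsTest θ) {s t : ℝ} (hs : 0 < s) (ht : 0 < t) :
    ∫ p : 𝔼 × 𝔼, gauss N s p.1 * gauss N t p.2 * θ (p.1 + p.2) = heat N θ (s + t) := by
  obtain ⟨M, -, hM⟩ := hθ.bounded
  have hi : Integrable (fun p : 𝔼 × 𝔼 => gauss N s p.1 * gauss N t p.2)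
      (volume.prod volume) := (integrable_gauss hs).mul_prod (integrable_gauss ht)
  have hi2 : Integrable (fun p : 𝔼 × 𝔼 => gauss N s p.1 * gauss N t p.2 * θ (p.1 + p.2))
      (volume.prod volume) := by
    simp_rw [mul_comm _ (θ _)]
    exact hi.bdd_mul (hθ.measurable.comp (measurable_fst.add measurable_snd)).aestronglyMeasurable
      (Eventually.of_forall fun p => hM _)
  have hmp := measurePreserving_prod_add (volume : Measure 𝔼) (volume : Measure 𝔼)
  have hi3 : Integrable (fun p : 𝔼 × 𝔼 => gauss N s p.1 * gauss N t (p.2 - p.1) * θ p.2)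
      (volume.prod volume) := by
    rw [← hmp.integrable_comp_emb (MeasurableEquiv.shearAddRight 𝔼).measurableEmbedding]
    refine hi2.congr (Eventually.of_forall fun p => ?_)
    simp
  rw [Measure.volume_eq_prod]
  have e1 : ∫ p : 𝔼 × 𝔼, gauss N s p.1 * gauss N t p.2 * θ (p.1 + p.2) ∂volume.prod volume =
      ∫ p : 𝔼 × 𝔼, gauss N s p.1 * gauss N t (p.2 - p.1) * θ p.2 ∂volume.prod volume := by
    rw [← hmp.integral_comp (MeasurableEquiv.shearAddRight 𝔼).measurableEmbedding
      (fun p => gauss N s p.1 * gauss N t (p.2 - p.1) * θ p.2)]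
    simp
  rw [e1, integral_prod_symm _ hi3]
  simp only [integral_mul_const, integral_gauss_mul_gauss hs ht]
  rfl

lemma IsTest.heat_sub {θ : 𝔼 → ℝ} (hθ : IsTest θ) {s t : ℝ} (hs : 0 < s) (ht : 0 < t) :
    ∫ p : 𝔼 × 𝔼, gauss N s p.1 * gauss N t p.2 * θ (p.1 - p.2) = heat N θ (s + t) := by
  rw [← hθ.heat_add hs ht, Measure.volume_eq_prod]
  have hmp : MeasurePreserving (Prod.map id (Neg.neg) : 𝔼 × 𝔼 → 𝔼 × 𝔼)
      (volume.prod volume) (volume.prod volume) :=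
    (MeasurePreserving.id _).prod (Measure.measurePreserving_neg _)
  rw [← hmp.integral_comp
    ((MeasurableEquiv.refl 𝔼).prodCongr (MeasurableEquiv.neg 𝔼)).measurableEmbedding]
  simp [gauss, sub_eq_add_neg]

lemma heat_mul_one (θ : 𝔼 → ℝ) (s : ℝ) {t : ℝ} (ht : 0 < t) :
    ∫ p : 𝔼 × 𝔼, gauss N s p.1 * gauss N t p.2 * θ p.1 = heat N θ s := by
  have : ∀ p : 𝔼 × 𝔼, gauss N s p.1 * gauss N t p.2 * θ p.1 =
      (gauss N s p.1 * θ p.1) * gauss N t p.2 := fun p => by ring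
  simp_rw [this]
  rw [Measure.volume_eq_prod, integral_prod_mul (fun y => gauss N s y * θ y), integral_gauss ht,
    mul_one]
  rfl

lemma IsTest.integral_gauss_mul_secDiff {θ : 𝔼 → ℝ} (hθ : IsTest θ) {s t : ℝ} (hs : 0 < s)
    (ht : 0 < t) : ∫ p : 𝔼 × 𝔼, gauss N s p.1 * gauss N t p.2 * secDiff θ p.1 p.2 =
      2 * (heat N θ (s + t) - heat N θ s) := by
  obtain ⟨M, -, hM⟩ := hθ.bounded
  have hi : Integrable (fun p : 𝔼 × 𝔼 => gauss N s p.1 * gauss N t p.2) :=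
    (integrable_gauss hs).mul_prod (integrable_gauss ht)
  have hf : ∀ f : 𝔼 × 𝔼 → 𝔼, Measurable f →
      Integrable (fun p : 𝔼 × 𝔼 => gauss N s p.1 * gauss N t p.2 * θ (f p)) := fun f hf => by
    simp_rw [mul_comm _ (θ _)]
    exact hi.bdd_mul (hθ.measurable.comp hf).aestronglyMeasurable
      (Eventually.of_forall fun p => hM _)
  have h1 := hf (fun p => p.1 + p.2) (by fun_prop)
  have h2 := hf (fun p => p.1 - p.2) (by fun_prop)
  have h3 := hf (fun p => p.1) (by fun_prop)
  have h12 : Integrable (fun p : 𝔼 × 𝔼 => gauss N s p.1 * gauss N t p.2 * θ (p.1 + p.2) +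
    gauss N s p.1 * gauss N t p.2 * θ (p.1 - p.2)) := h1.add h2
  have : ∀ p : 𝔼 × 𝔼, gauss N s p.1 * gauss N t p.2 * secDiff θ p.1 p.2 =
      gauss N s p.1 * gauss N t p.2 * θ (p.1 + p.2) + gauss N s p.1 * gauss N t p.2 * θ (p.1 - p.2)
        - 2 * (gauss N s p.1 * gauss N t p.2 * θ p.1) := fun p => by simp only [secDiff]; ring
  simp_rw [this]
  rw [integral_sub h12 (h3.const_mul 2), integral_add h1 h2, integral_const_mul, hθ.heat_add hs ht,
    hθ.heat_sub hs ht, heat_mul_one θ s ht]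
  ring

lemma heat_eq (θ : 𝔼 → ℝ) {s : ℝ} (hs : 0 < s) :
    heat N θ s = ∫ y : 𝔼, rexp (-π * ‖y‖ ^ 2) * θ (√s • y) := by
  have h := Measure.integral_comp_smul volume (fun y : 𝔼 => gauss N s y * θ y) (√s)
  rw [finrank_euclideanSpace, Fintype.card_fin, abs_of_nonneg (by positivity), smul_eq_mul] at h
  have hs' : (0 : ℝ) < √s ^ N := by positivity
  have e : s ^ (-((N : ℝ) / 2)) = (√s ^ N)⁻¹ := by
    rw [Real.rpow_neg hs.le, Real.sqrt_eq_rpow, ← Real.rpow_natCast, ← Real.rpow_mul hs.le]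
    congr 2; ring
  rw [heat, ← mul_inv_cancel_left₀ hs'.ne' (∫ y, gauss N s y * θ y), ← h, ← integral_const_mul]
  congr 1
  ext y
  rw [gauss, e, norm_smul, Real.norm_of_nonneg (Real.sqrt_nonneg s), mul_pow, Real.sq_sqrt hs.le,
    show -(π / s) * (s * ‖y‖ ^ 2) = -π * ‖y‖ ^ 2 by field_simp]
  field_simp

lemma integrableOn_sub {q A : ℝ} (hq : 0 < q) (hA : 0 < A) :
    IntegrableOn (fun s : ℝ => s ^ (-q - 1) * rexp (-(A / s))) (Set.Ioi 0) ∧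
      ∫ s in Set.Ioi 0, s ^ (-q - 1) * rexp (-(A / s)) = (1 / A) ^ q * Real.Gamma q := by
  have key : ∀ s ∈ Set.Ioi (0 : ℝ), (|(-1 : ℝ)| * s ^ ((-1 : ℝ) - 1)) •
      ((s ^ (-1 : ℝ)) ^ (q - 1) * rexp (-(A * s ^ (-1 : ℝ)))) =
        s ^ (-q - 1) * rexp (-(A / s)) := by
    intro s (hs : 0 < s)
    rw [← Real.rpow_mul hs.le, smul_eq_mul, abs_neg, abs_one, one_mul, ← mul_assoc,
      ← Real.rpow_add hs, Real.rpow_neg_one, div_eq_mul_inv]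
    congr 2; ring
  constructor
  · have h := (integrableOn_Ioi_comp_rpow_iff (fun x : ℝ => x ^ (q - 1) * rexp (-(A * x)))
      (p := -1) (by norm_num)).2 (by
        have := integrableOn_rpow_mul_exp_neg_mul_rpow (p := 1) (s := q - 1) (b := A)
          (by linarith) one_pos hA
        simpa using this)
    exact h.congr_fun key measurableSet_Ioi
  · rw [← Real.integral_rpow_mul_exp_neg_mul_Ioi hq hA,
      ← integral_comp_rpow_Ioi (fun x : ℝ => x ^ (q - 1) * rexp (-(A * x))) (p := -1)
        (by norm_num)]
    exact (setIntegral_congr_fun measurableSet_Ioi key).symm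

/-- Powers of the norm are superpositions of heat kernels. -/
lemma integral_rpow_mul_gauss {b : ℝ} (hb : b + 1 < (N : ℝ) / 2) {y : 𝔼} (hy : y ≠ 0) :
    IntegrableOn (fun s : ℝ => s ^ b * gauss N s y) (Set.Ioi 0) ∧
      ∫ s in Set.Ioi 0, s ^ b * gauss N s y =
        π ^ (b + 1 - (N : ℝ) / 2) * Real.Gamma ((N : ℝ) / 2 - b - 1) *
          ‖y‖ ^ (2 * b + 2 - (N : ℝ)) := by
  have hn : 0 < ‖y‖ := norm_pos_iff.2 hy
  obtain ⟨h1, h2⟩ := integrableOn_sub (q := (N : ℝ) / 2 - b - 1) (A := π * ‖y‖ ^ 2)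
    (by linarith) (by positivity)
  have key : ∀ s ∈ Set.Ioi (0 : ℝ),
      s ^ (-((N : ℝ) / 2 - b - 1) - 1) * rexp (-(π * ‖y‖ ^ 2 / s)) = s ^ b * gauss N s y := by
    intro s (hs : 0 < s)
    rw [gauss, ← mul_assoc, ← Real.rpow_add hs]
    congr 2
    · ring
    · ring
  refine ⟨h1.congr_fun key measurableSet_Ioi, ?_⟩
  rw [← setIntegral_congr_fun measurableSet_Ioi key, h2, one_div, ← Real.rpow_neg_one,
    ← Real.rpow_mul (by positivity), Real.mul_rpow (by positivity) (by positivity),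
    ← Real.rpow_natCast, ← Real.rpow_mul hn.le]
  rw [show -1 * ((N : ℝ) / 2 - b - 1) = b + 1 - (N : ℝ) / 2 by ring,
    show ((2 : ℕ) : ℝ) * (b + 1 - (N : ℝ) / 2) = 2 * b + 2 - (N : ℝ) by push_cast; ring]
  ring

end FracLapTheory

section FracLapTheory

set_option linter.unusedSectionVars false

variable {N : ℕ} {α : ℝ} [StableParams N α]

local notation "𝔼" => EuclideanSpace ℝ (Fin N)

lemma integrable_exp_neg_norm_sq : Integrable fun y : 𝔼 => rexp (-π * ‖y‖ ^ 2) := by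
  have := integrable_gauss (N := N) one_pos
  unfold gauss at this
  simpa using this

lemma integral_exp_neg_norm_sq : ∫ y : 𝔼, rexp (-π * ‖y‖ ^ 2) = 1 := by
  have := integral_gauss (N := N) one_pos
  unfold gauss at this
  simpa using this

lemma integrable_exp_neg_norm_sq_mul_norm :
    Integrable fun y : 𝔼 => rexp (-π * ‖y‖ ^ 2) * ‖y‖ := by
  have h2 := (integrable_gauss (N := N) two_pos).const_mul ((2 : ℝ) ^ (-((N : ℝ) / 2)))⁻¹
  refine h2.mono' (by fun_prop) (Eventually.of_forall fun y => ?_)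
  rw [Real.norm_of_nonneg (by positivity), gauss, inv_mul_cancel_left₀ (by positivity),
    show -π * ‖y‖ ^ 2 = -(π / 2) * ‖y‖ ^ 2 + -(π / 2 * ‖y‖ ^ 2) by ring, Real.exp_add, mul_assoc]
  refine mul_le_of_le_one_right (by positivity) ?_
  rw [Real.exp_neg, inv_mul_le_one₀ (by positivity)]
  have h3 := Real.add_one_le_exp (π / 2 * ‖y‖ ^ 2)
  nlinarith [Real.two_le_pi, sq_nonneg (‖y‖ - 1), sq_nonneg ‖y‖]

lemma IsTest.hasDerivAt_integral_exp {θ : 𝔼 → ℝ} (hθ : IsTest θ) :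
    ∃ C, 0 ≤ C ∧ ∃ H' : ℝ → ℝ,
      (∀ r, HasDerivAt (fun r : ℝ => ∫ y : 𝔼, rexp (-π * ‖y‖ ^ 2) * θ (r • y)) (H' r) r) ∧
      (∀ r, |H' r| ≤ C) ∧ ∀ r > 0, |H' r| ≤ C * (r ^ (N + 1))⁻¹ := by
  have hdiff : Differentiable ℝ θ := hθ.smooth.differentiable (by simp)
  have hcont : Continuous (fderiv ℝ θ) := hθ.smooth.continuous_fderiv (by simp)
  have hcs : HasCompactSupport (fderiv ℝ θ) := hθ.compact.fderiv ℝ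
  obtain ⟨L, hL⟩ := hcs.exists_bound_of_continuous hcont
  have hL0 : 0 ≤ L := (norm_nonneg _).trans (hL 0)
  have hle : ∀ (r : ℝ) (y : 𝔼), |fderiv ℝ θ (r • y) y| ≤ L * ‖y‖ := fun r y =>
    ((fderiv ℝ θ (r • y)).le_opNorm y).trans (mul_le_mul_of_nonneg_right (hL _) (norm_nonneg y))
  have hi := (integrable_exp_neg_norm_sq_mul_norm (N := N)).const_mul L
  have hbd : ∀ (r : ℝ) (y : 𝔼), ‖rexp (-π * ‖y‖ ^ 2) * fderiv ℝ θ (r • y) y‖ ≤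
      L * (rexp (-π * ‖y‖ ^ 2) * ‖y‖) := fun r y => by
    rw [norm_mul, Real.norm_of_nonneg (by positivity), Real.norm_eq_abs, mul_left_comm]
    exact mul_le_mul_of_nonneg_left (hle r y) (by positivity)
  have hmeas : ∀ r : ℝ, Continuous fun y : 𝔼 => rexp (-π * ‖y‖ ^ 2) * fderiv ℝ θ (r • y) y :=
    fun r => by
      have : Continuous fun y : 𝔼 => fderiv ℝ θ (r • y) y :=
        (hcont.comp (continuous_const_smul r)).clm_apply continuous_id
      fun_prop
  obtain ⟨M, -, hM⟩ := hθ.bounded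
  have hθc := hθ.smooth.continuous
  set k : 𝔼 → ℝ := fun x => |fderiv ℝ θ x x| with hk
  have hki : Integrable k := by
    refine Continuous.integrable_of_hasCompactSupport (hcont.clm_apply continuous_id).abs ?_
    refine hcs.mono fun x hx => ?_
    rw [Function.mem_support] at hx ⊢
    contrapose! hx
    simp [hk, hx]
  refine ⟨max (∫ y : 𝔼, L * (rexp (-π * ‖y‖ ^ 2) * ‖y‖)) (∫ x, k x),
    le_max_of_le_right (integral_nonneg fun x => abs_nonneg _),
    fun r => ∫ y : 𝔼, rexp (-π * ‖y‖ ^ 2) * fderiv ℝ θ (r • y) y, fun r => ?_, fun r => ?_,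
    fun r hr => ?_⟩
  · refine (hasDerivAt_integral_of_dominated_loc_of_deriv_le
      (F := fun r y => rexp (-π * ‖y‖ ^ 2) * θ (r • y))
      (F' := fun r y => rexp (-π * ‖y‖ ^ 2) * fderiv ℝ θ (r • y) y)
      (bound := fun y => L * (rexp (-π * ‖y‖ ^ 2) * ‖y‖))
      univ_mem (Eventually.of_forall fun r => ?_) ?_ (hmeas r).aestronglyMeasurable
      (Eventually.of_forall fun y r _ => hbd r y) hi
      (Eventually.of_forall fun y r _ => ?_)).2
    · exact Continuous.aestronglyMeasurable (by fun_prop)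
    · simp_rw [mul_comm _ (θ _)]
      exact integrable_exp_neg_norm_sq.bdd_mul (by fun_prop) (Eventually.of_forall fun y => hM _)
    · have h1 : HasDerivAt (fun r : ℝ => r • y) y r := by
        simpa using (hasDerivAt_id r).smul_const y
      exact ((hdiff (r • y)).hasFDerivAt.comp_hasDerivAt r h1).const_mul _
  · exact le_max_of_le_left (norm_integral_le_of_norm_le hi (Eventually.of_forall (hbd r)))
  · have h1 : ∫ y : 𝔼, r⁻¹ * k (r • y) = (r ^ (N + 1))⁻¹ * ∫ x, k x := by
      rw [integral_const_mul, Measure.integral_comp_smul, finrank_euclideanSpace, Fintype.card_fin,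
        abs_of_nonneg (by positivity), smul_eq_mul]
      field_simp
      ring
    have h2 : |∫ y : 𝔼, rexp (-π * ‖y‖ ^ 2) * fderiv ℝ θ (r • y) y| ≤ ∫ y : 𝔼, r⁻¹ * k (r • y) := by
      rw [← Real.norm_eq_abs]
      refine norm_integral_le_of_norm_le ((hki.comp_smul hr.ne').const_mul r⁻¹)
        (Eventually.of_forall fun y => ?_)
      rw [norm_mul, Real.norm_of_nonneg (by positivity), Real.norm_eq_abs]
      simp only [hk, map_smul, smul_eq_mul, abs_mul, abs_of_pos hr]
      rw [inv_mul_cancel_left₀ hr.ne']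
      refine mul_le_of_le_one_left (abs_nonneg _) (Real.exp_le_one_iff.2 ?_)
      rw [neg_mul]
      exact neg_nonpos.2 (by positivity)
    rw [h1] at h2
    refine h2.trans ?_
    rw [mul_comm]
    exact mul_le_mul_of_nonneg_right (le_max_right _ _) (by positivity)

lemma integrableOn_rpow_min : IntegrableOn
    (fun u : ℝ => if u ≤ 1 then u ^ (-(1 / 2) : ℝ) else u ^ (-(3 / 2) : ℝ)) (Set.Ioi 0) := by
  rw [← Set.Ioc_union_Ioi_eq_Ioi (zero_le_one (α := ℝ))]
  refine IntegrableOn.union ?_ ?_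
  · refine IntegrableOn.congr_fun (f := fun u : ℝ => u ^ (-(1 / 2) : ℝ)) ?_
      (fun u hu => by simp [hu.2]) measurableSet_Ioc
    exact (intervalIntegrable_iff_integrableOn_Ioc_of_le zero_le_one).1
      (intervalIntegral.intervalIntegrable_rpow' (by norm_num))
  · refine IntegrableOn.congr_fun (f := fun u : ℝ => u ^ (-(3 / 2) : ℝ)) ?_
      (fun u hu => by simp [not_le.2 (Set.mem_Ioi.1 hu)]) measurableSet_Ioi
    exact integrableOn_Ioi_rpow_of_lt (by norm_num) one_pos

lemma IsTest.integral_heat {θ : 𝔼 → ℝ} (hθ : IsTest θ) (hN : 0 < N) {a : ℝ} (ha : 0 < a)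
    (ha1 : a < 1) :
    ∫ p in Set.Ioi (0 : ℝ) ×ˢ Set.Ioi (0 : ℝ),
      p.1 ^ (a - 1) * p.2 ^ (-1 - a) * (heat N θ (p.1 + p.2) - heat N θ p.1) =
      -(∫ p, abelKer a 1 p) * θ 0 := by
  obtain ⟨C, hC0, H', hd, hC, hC'⟩ := hθ.hasDerivAt_integral_exp
  set H : ℝ → ℝ := fun r => ∫ y : 𝔼, rexp (-π * ‖y‖ ^ 2) * θ (r • y) with hH
  have hH0 : H (√0) = θ 0 := by
    simp only [hH, Real.sqrt_zero, zero_smul]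
    rw [integral_mul_const, integral_exp_neg_norm_sq, one_mul]
  have hHc : Continuous H := continuous_iff_continuousAt.2 fun r => (hd r).continuousAt
  have hHm : Measurable H' := by
    rw [show H' = deriv H from funext fun r => (hd r).deriv.symm]
    exact measurable_deriv H
  have hlim : Tendsto H atTop (𝓝 0) := by
    have h1 : ∀ r > 0, |H r| ≤ (r ^ N)⁻¹ * ∫ y : 𝔼, |θ y| := fun r hr => by
      have h2 : ∫ y : 𝔼, |θ (r • y)| = (r ^ N)⁻¹ * ∫ y : 𝔼, |θ y| := by
        rw [Measure.integral_comp_smul volume (fun y : 𝔼 => |θ y|), finrank_euclideanSpace,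
          Fintype.card_fin, abs_of_nonneg (by positivity), smul_eq_mul]
      rw [← h2, ← Real.norm_eq_abs]
      refine norm_integral_le_of_norm_le (hθ.integrable.abs.comp_smul hr.ne')
        (Eventually.of_forall fun y => ?_)
      rw [norm_mul, Real.norm_of_nonneg (by positivity), Real.norm_eq_abs]
      refine mul_le_of_le_one_left (abs_nonneg _) (Real.exp_le_one_iff.2 ?_)
      rw [neg_mul]
      exact neg_nonpos.2 (by positivity)
    refine squeeze_zero_norm' ((eventually_gt_atTop 0).mono h1) ?_
    simpa using (tendsto_inv_atTop_zero.comp (tendsto_pow_atTop hN.ne')).mul_const (∫ y : 𝔼, |θ y|)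
  have key := integral_abel ha ha1 (F := fun u => H (√u)) (F' := fun u => H' (√u) * (1 / (2 * √u)))
    (hHc.comp Real.continuous_sqrt).continuousWithinAt
    (fun u hu => (hd (√u)).comp u (Real.hasDerivAt_sqrt hu.ne')) ?_
    (hlim.comp Real.tendsto_sqrt_atTop)
  · rw [hH0] at key
    rw [← key]
    refine setIntegral_congr_fun (measurableSet_Ioi.prod measurableSet_Ioi) fun p hp => ?_
    obtain ⟨h1 : 0 < p.1, h2 : 0 < p.2⟩ := hp
    simp only [heat_eq θ (add_pos h1 h2), heat_eq θ h1, hH]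
  · refine Integrable.mono' ((integrableOn_rpow_min).const_mul C)
      (Measurable.aestronglyMeasurable (by fun_prop)) ?_
    rw [ae_restrict_iff' measurableSet_Ioi]
    refine Eventually.of_forall fun u (hu : 0 < u) => ?_
    have hs : 0 < √u := Real.sqrt_pos.2 hu
    have hinv : 1 / (2 * √u) ≤ u ^ (-(1 / 2) : ℝ) := by
      rw [Real.rpow_neg hu.le, ← Real.sqrt_eq_rpow, one_div, mul_inv]
      have : 0 < (√u)⁻¹ := by positivity
      linarith
    rw [norm_mul, Real.norm_eq_abs, Real.norm_of_nonneg (r := 1 / (2 * √u)) (by positivity)]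
    split_ifs with h
    · exact mul_le_mul (hC _) hinv (by positivity) hC0
    · have hs1 : 1 ≤ √u := Real.one_le_sqrt.2 (not_le.1 h).le
      have h3 : |H' (√u)| ≤ C * u ^ (-1 : ℝ) := by
        refine (hC' _ hs).trans (mul_le_mul_of_nonneg_left ?_ hC0)
        rw [Real.rpow_neg_one]
        refine inv_anti₀ hu ?_
        calc u = √u ^ 2 := (Real.sq_sqrt hu.le).symm
          _ ≤ √u ^ (N + 1) := pow_le_pow_right₀ hs1 (by omega)
      refine (mul_le_mul h3 hinv (by positivity) (by positivity)).trans_eq ?_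
      rw [mul_assoc, ← Real.rpow_add hu]
      norm_num

/-- The Riesz kernel, without normalisation. -/
def riesz (N : ℕ) (α : ℝ) (y : EuclideanSpace ℝ (Fin N)) : ℝ := ‖y‖ ^ (α - (N : ℝ))

lemma riesz_nonneg (y : 𝔼) : 0 ≤ riesz N α y := by unfold riesz; positivity

lemma measurable_riesz : Measurable (riesz N α) := by unfold riesz; fun_prop

lemma StableParams.sub_neg (N : ℕ) (α : ℝ) [h : StableParams N α] : α - N < 0 := by
  have h1 : (3 : ℝ) ≤ N := by exact_mod_cast h.three_le
  linarith [h.lt_two]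

lemma integrableOn_riesz (R : ℝ) : IntegrableOn (riesz N α) (Metric.ball 0 R) := by
  have hN := StableParams.dim_pos N α
  have := nontrivial_of_pos hN
  refine (integrableOn_fun_norm_addHaar (E := 𝔼) (F := ℝ) volume
    (f := fun r => r ^ (α - (N : ℝ)))).2 ?_
  rcases le_or_gt R 0 with hR | hR
  · simp [Set.Ioo_eq_empty_of_le hR]
  have h1 : IntegrableOn (fun r : ℝ => r ^ (α - 1)) (Set.Ioo 0 R) :=
    (intervalIntegrable_iff_integrableOn_Ioo_of_le hR.le).1
      (intervalIntegral.intervalIntegrable_rpow' (by linarith [StableParams.pos N (α := α)]))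
  refine h1.congr_fun (fun r hr => ?_) measurableSet_Ioo
  have hr0 : 0 < r := hr.1
  rw [finrank_euclideanSpace, Fintype.card_fin, smul_eq_mul, ← Real.rpow_natCast,
    ← Real.rpow_add hr0, Nat.cast_sub hN]
  push_cast
  ring_nf

lemma riesz_le_one {y : 𝔼} (hy : 1 ≤ ‖y‖) : riesz N α y ≤ 1 :=
  Real.rpow_le_one_of_one_le_of_nonpos hy (StableParams.sub_neg N α).le

/-- The Riesz kernel times a bounded integrable function is integrable. -/
lemma integrable_riesz_mul {f : 𝔼 → ℝ} (hf : Integrable f) {M : ℝ} (hM : ∀ x, |f x| ≤ M) :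
    Integrable fun y => riesz N α y * f y := by
  have hr := measurable_riesz (N := N) (α := α)
  rw [← integrableOn_univ, ← Set.union_compl_self (Metric.ball (0 : 𝔼) 1)]
  refine IntegrableOn.union ?_ ?_
  · simp_rw [mul_comm]
    exact (integrableOn_riesz 1).bdd_mul hf.1.restrict (Eventually.of_forall hM)
  · refine hf.integrableOn.bdd_mul (c := 1) hr.aestronglyMeasurable ?_
    rw [ae_restrict_iff' measurableSet_ball.compl]
    refine Eventually.of_forall fun y hy => ?_
    rw [Real.norm_of_nonneg (riesz_nonneg y)]
    exact riesz_le_one (by simpa using hy)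

lemma IsTest.integrable_riesz_mul_secDiff {θ : 𝔼 → ℝ} (hθ : IsTest θ) :
    Integrable (fun p : 𝔼 × 𝔼 => riesz N α p.1 * (secDiff θ p.1 p.2 / ‖p.2‖ ^ ((N : ℝ) + α)))
      (volume.prod volume) := by
  have hm := measurable_secDiff (N := N) (α := α) hθ.measurable
  have hr := measurable_riesz (N := N) (α := α)
  obtain ⟨C, hC0, hC⟩ := hθ.secDiff_le
  have hmeas : AEStronglyMeasurable (fun p : 𝔼 × 𝔼 => riesz N α p.1 *
      (secDiff θ p.1 p.2 / ‖p.2‖ ^ ((N : ℝ) + α))) (volume.prod volume) :=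
    ((hr.comp measurable_fst).mul hm).aestronglyMeasurable
  rw [integrable_prod_iff hmeas]
  refine ⟨Eventually.of_forall fun y =>
    (SecBound.integrable (α := α) hθ.measurable (hC y)).const_mul (riesz N α y), ?_⟩
  have h1 := (hθ.integrable_prod (α := α)).norm.integral_prod_left
  refine (integrable_riesz_mul (α := α) h1 (M := ∫ z, C * levyWeight N α z) fun y => ?_).congr
    (Eventually.of_forall fun y => ?_)
  · rw [abs_of_nonneg (integral_nonneg fun z => norm_nonneg _)]
    exact integral_mono (SecBound.integrable (α := α) hθ.measurable (hC y)).norm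
      (integrable_levyWeight.const_mul _) fun z => SecBound.div_le (α := α) (hC y) z
  · simp only [norm_mul, Real.norm_of_nonneg (riesz_nonneg _), integral_const_mul]

variable (N α) in
/-- The Riesz kernel is a fundamental solution of the fractional Laplacian, up to a constant. -/
theorem exists_integral_riesz_mul_fracLap : ∃ κ : ℝ, 0 < κ ∧
    ∀ θ : 𝔼 → ℝ, IsTest θ → ∫ y, riesz N α y * fracLap N α θ y = -κ * θ 0 := by
  have hN := StableParams.dim_pos N α
  have hN3 : (3 : ℝ) ≤ N := by exact_mod_cast (StableParams.three_le α : 3 ≤ N)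
  have hα := StableParams.pos N (α := α)
  have hα2 := StableParams.lt_two N (α := α)
  have hc := fracLapCoeff_pos N α
  have := nontrivial_of_pos hN
  set a := α / 2 with ha
  set K := ∫ p, abelKer a 1 p with hK
  have hK0 : 0 < K := integral_abelKer_one_pos (by linarith) (by linarith)
  obtain ⟨A₁, hA₁, h₁i, h₁⟩ : ∃ A : ℝ, 0 < A ∧ (∀ y : 𝔼, y ≠ 0 →
      IntegrableOn (fun s : ℝ => s ^ (a - 1) * gauss N s y) (Set.Ioi 0)) ∧ ∀ y : 𝔼, y ≠ 0 →
      ∫ s in Set.Ioi 0, s ^ (a - 1) * gauss N s y = A * riesz N α y := by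
    refine ⟨π ^ (a - 1 + 1 - (N : ℝ) / 2) * Real.Gamma ((N : ℝ) / 2 - (a - 1) - 1), ?_,
      fun y hy => (integral_rpow_mul_gauss (by linarith) hy).1, fun y hy => ?_⟩
    rotate_left
    · rw [(integral_rpow_mul_gauss (by linarith) hy).2, riesz,
        show 2 * (a - 1) + 2 - (N : ℝ) = α - N by rw [ha]; ring]
    · exact mul_pos (by positivity) (Real.Gamma_pos_of_pos (by linarith))
  obtain ⟨A₂, hA₂, h₂i, h₂⟩ : ∃ A : ℝ, 0 < A ∧ (∀ y : 𝔼, y ≠ 0 →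
      IntegrableOn (fun s : ℝ => s ^ (-1 - a) * gauss N s y) (Set.Ioi 0)) ∧ ∀ y : 𝔼, y ≠ 0 →
      ∫ s in Set.Ioi 0, s ^ (-1 - a) * gauss N s y = A / ‖y‖ ^ ((N : ℝ) + α) := by
    refine ⟨π ^ (-1 - a + 1 - (N : ℝ) / 2) * Real.Gamma ((N : ℝ) / 2 - (-1 - a) - 1), ?_,
      fun y hy => (integral_rpow_mul_gauss (by linarith) hy).1, fun y hy => ?_⟩
    rotate_left
    · rw [(integral_rpow_mul_gauss (by linarith) hy).2,
        show 2 * (-1 - a) + 2 - (N : ℝ) = -((N : ℝ) + α) by rw [ha]; ring,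
        Real.rpow_neg (norm_nonneg _), ← div_eq_mul_inv]
    · exact mul_pos (by positivity) (Real.Gamma_pos_of_pos (by linarith))
  refine ⟨fracLapCoeff N α * K / (A₁ * A₂), by positivity, fun θ hθ => ?_⟩
  obtain ⟨C, hC0, hC⟩ := hθ.secDiff_le
  have hG := hθ.integrable_riesz_mul_secDiff (α := α)
  set G : 𝔼 × 𝔼 → ℝ :=
    fun p => riesz N α p.1 * (secDiff θ p.1 p.2 / ‖p.2‖ ^ ((N : ℝ) + α)) with hGdef
  have hIG : ∫ y, riesz N α y * fracLap N α θ y =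
      fracLapCoeff N α / 2 * ∫ p, G p ∂volume.prod volume := by
    rw [integral_prod _ hG, ← integral_const_mul]
    congr 1
    ext y
    simp only [hGdef, integral_const_mul, fracLap_def]
    ring
  let ν : Measure (ℝ × ℝ) := (volume.restrict (Set.Ioi 0)).prod (volume.restrict (Set.Ioi 0))
  let f : 𝔼 × 𝔼 → ℝ × ℝ → ℝ := fun p q =>
    secDiff θ p.1 p.2 * ((q.1 ^ (a - 1) * gauss N q.1 p.1) * (q.2 ^ (-1 - a) * gauss N q.2 p.2))
  have hne : ∀ᵐ p : 𝔼 × 𝔼 ∂volume.prod volume, p.1 ≠ 0 ∧ p.2 ≠ 0 :=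
    (Measure.quasiMeasurePreserving_fst.ae (Measure.ae_ne volume 0)).and
      (Measure.quasiMeasurePreserving_snd.ae (Measure.ae_ne volume 0))
  have hfm : Measurable (Function.uncurry f) := by
    have hm := measurable_gauss (N := N)
    have m1 : Measurable fun x : (𝔼 × 𝔼) × (ℝ × ℝ) => gauss N x.2.1 x.1.1 :=
      hm.comp (f := fun x : (𝔼 × 𝔼) × (ℝ × ℝ) => (x.2.1, x.1.1)) (by fun_prop)
    have m2 : Measurable fun x : (𝔼 × 𝔼) × (ℝ × ℝ) => gauss N x.2.2 x.1.2 :=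
      hm.comp (f := fun x : (𝔼 × 𝔼) × (ℝ × ℝ) => (x.2.2, x.1.2)) (by fun_prop)
    have hθm := hθ.measurable
    have m3 : Measurable fun x : (𝔼 × 𝔼) × (ℝ × ℝ) => secDiff θ x.1.1 x.1.2 := by
      unfold secDiff; fun_prop
    change Measurable fun x : (𝔼 × 𝔼) × (ℝ × ℝ) => secDiff θ x.1.1 x.1.2 *
      ((x.2.1 ^ (a - 1) * gauss N x.2.1 x.1.1) * (x.2.2 ^ (-1 - a) * gauss N x.2.2 x.1.2))
    fun_prop
  have hfint : ∀ p : 𝔼 × 𝔼, p.1 ≠ 0 ∧ p.2 ≠ 0 → ∫ q, f p q ∂ν = A₁ * A₂ * G p := by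
    rintro p ⟨hp1, hp2⟩
    simp only [f, ν]
    rw [integral_const_mul, integral_prod_mul (fun s => s ^ (a - 1) * gauss N s p.1)
      (fun t => t ^ (-1 - a) * gauss N t p.2), h₁ _ hp1, h₂ _ hp2]
    simp only [hGdef]
    ring
  have hnn : ∀ᵐ q : ℝ × ℝ ∂ν, 0 < q.1 ∧ 0 < q.2 := by
    have h : ∀ᵐ s : ℝ ∂volume.restrict (Set.Ioi 0), 0 < s := by
      rw [ae_restrict_iff' measurableSet_Ioi]
      exact Eventually.of_forall fun s hs => hs
    exact (Measure.quasiMeasurePreserving_fst.ae h).and (Measure.quasiMeasurePreserving_snd.ae h)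
  have hfi : Integrable (Function.uncurry f) ((volume.prod volume).prod ν) := by
    rw [integrable_prod_iff hfm.aestronglyMeasurable]
    constructor
    · filter_upwards [hne] with p hp
      exact ((h₁i _ hp.1).mul_prod (h₂i _ hp.2)).const_mul (secDiff θ p.1 p.2)
    · refine (hG.norm.const_mul (A₁ * A₂)).congr ?_
      filter_upwards [hne] with p hp
      have e1 : ∫ q, ‖f p q‖ ∂ν = ∫ q, |secDiff θ p.1 p.2| *
          ((q.1 ^ (a - 1) * gauss N q.1 p.1) * (q.2 ^ (-1 - a) * gauss N q.2 p.2)) ∂ν := by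
        refine integral_congr_ae ?_
        filter_upwards [hnn] with q hq
        have g1 := gauss_nonneg hq.1 p.1
        have g2 := gauss_nonneg hq.2 p.2
        have := hq.1
        have := hq.2
        rw [norm_mul, Real.norm_eq_abs, Real.norm_of_nonneg]
        positivity
      simp only [Function.uncurry_apply_pair]
      rw [e1, integral_const_mul]
      simp only [ν]
      rw [integral_prod_mul (fun s => s ^ (a - 1) * gauss N s p.1)
        (fun t => t ^ (-1 - a) * gauss N t p.2), h₁ _ hp.1, h₂ _ hp.2]
      simp only [hGdef]
      rw [norm_mul, Real.norm_of_nonneg (riesz_nonneg _), norm_div, Real.norm_eq_abs,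
        Real.norm_of_nonneg (r := ‖p.2‖ ^ ((N : ℝ) + α)) (by positivity)]
      ring
  have hswap := integral_integral_swap hfi
  have hleft : ∫ p, ∫ q, f p q ∂ν ∂volume.prod volume =
      A₁ * A₂ * ∫ p, G p ∂volume.prod volume := by
    rw [← integral_const_mul]
    refine integral_congr_ae ?_
    filter_upwards [hne] with p hp using hfint p hp
  have hright : ∫ q, ∫ p, f p q ∂volume.prod volume ∂ν = 2 * (-K * θ 0) := by
    rw [hK, ← hθ.integral_heat hN (by linarith) (by linarith), ← integral_const_mul,
      Measure.volume_eq_prod, ← Measure.prod_restrict]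
    refine integral_congr_ae ?_
    filter_upwards [hnn] with q hq
    have := hθ.integral_gauss_mul_secDiff hq.1 hq.2
    rw [Measure.volume_eq_prod] at this
    rw [mul_left_comm, ← this, ← integral_const_mul]
    congr 1
    ext p
    simp only [f]
    ring
  rw [hleft, hright] at hswap
  rw [hIG, show ∫ p, G p ∂volume.prod volume = 2 * (-K * θ 0) / (A₁ * A₂) by
    rw [← hswap]; field_simp]
  field_simp

variable (N α) in
/-- The normalising constant of the Riesz kernel. -/
def rieszConst : ℝ := Classical.choose (exists_integral_riesz_mul_fracLap N α)

variable (N α) in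
lemma rieszConst_pos : 0 < rieszConst N α :=
  (Classical.choose_spec (exists_integral_riesz_mul_fracLap N α)).1

lemma IsTest.integral_riesz_mul_fracLap {θ : 𝔼 → ℝ} (hθ : IsTest θ) :
    ∫ y, riesz N α y * fracLap N α θ y = -rieszConst N α * θ 0 :=
  (Classical.choose_spec (exists_integral_riesz_mul_fracLap N α)).2 θ hθ

/-- The potential inverting the fractional Laplacian. -/
def rieszPot (N : ℕ) (α : ℝ) [StableParams N α] (g : EuclideanSpace ℝ (Fin N) → ℝ)
    (x : EuclideanSpace ℝ (Fin N)) : ℝ :=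
  -(rieszConst N α)⁻¹ * ∫ y, riesz N α (x - y) * g y

/-- Measurable functions bounded by `C` and vanishing outside the ball of radius `R`. -/
structure IsDatum (C R : ℝ) (g : 𝔼 → ℝ) : Prop where
  meas : Measurable g
  bdd : ∀ x, |g x| ≤ C
  supp : ∀ x, R ≤ ‖x‖ → g x = 0

lemma IsDatum.nonneg {C R : ℝ} {g : 𝔼 → ℝ} (hg : IsDatum C R g) : 0 ≤ C :=
  (abs_nonneg _).trans (hg.bdd 0)

lemma IsDatum.abs_le {C R : ℝ} {g : 𝔼 → ℝ} (hg : IsDatum C R g) (x : 𝔼) :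
    |g x| ≤ (Metric.ball (0 : 𝔼) R).indicator (fun _ => C) x := by
  by_cases hx : x ∈ Metric.ball (0 : 𝔼) R
  · rw [Set.indicator_of_mem hx]; exact hg.bdd x
  · rw [Set.indicator_of_notMem hx, hg.supp x (by simpa using hx), abs_zero]

lemma integrable_ball_const (C R : ℝ) :
    Integrable ((Metric.ball (0 : 𝔼) R).indicator fun _ => C) :=
  (integrable_indicator_iff measurableSet_ball).2
    (integrableOn_const (measure_ball_lt_top.ne))

lemma IsDatum.integrable {C R : ℝ} {g : 𝔼 → ℝ} (hg : IsDatum C R g) : Integrable g :=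
  (integrable_ball_const C R).mono' hg.meas.aestronglyMeasurable (Eventually.of_forall hg.abs_le)

lemma IsDatum.integral_abs_le {C R : ℝ} {g : 𝔼 → ℝ} (hg : IsDatum C R g) :
    ∫ x, |g x| ≤ C * volume.real (Metric.ball (0 : 𝔼) R) := by
  refine (integral_mono hg.integrable.abs (integrable_ball_const C R) hg.abs_le).trans_eq ?_
  rw [integral_indicator measurableSet_ball, setIntegral_const, smul_eq_mul, mul_comm]

lemma integrable_riesz_sub_mul {g : 𝔼 → ℝ} (hg : Integrable g) {C : ℝ} (hC : ∀ x, |g x| ≤ C)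
    (x : 𝔼) : Integrable fun y => riesz N α (x - y) * g y := by
  have := (integrable_riesz_mul (α := α) (hg.comp_sub_left x) (M := C) fun y => hC _).comp_sub_left x
  simpa using this

lemma riesz_le_indicator_add_one (y : 𝔼) :
    riesz N α y ≤ (Metric.ball (0 : 𝔼) 1).indicator (riesz N α) y + 1 := by
  by_cases hy : y ∈ Metric.ball (0 : 𝔼) 1
  · rw [Set.indicator_of_mem hy]; linarith
  · rw [Set.indicator_of_notMem hy, zero_add]
    exact riesz_le_one (by simpa using hy)

lemma integrable_indicator_riesz (R : ℝ) :
    Integrable ((Metric.ball (0 : 𝔼) R).indicator (riesz N α)) :=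
  (integrable_indicator_iff measurableSet_ball).2 (integrableOn_riesz R)

lemma integral_riesz_mul_abs_le {g : 𝔼 → ℝ} (hg : Integrable g) {C : ℝ} (hC : ∀ x, |g x| ≤ C) :
    ∫ y, riesz N α y * |g y| ≤
      C * (∫ y, (Metric.ball (0 : 𝔼) 1).indicator (riesz N α) y) + ∫ y, |g y| := by
  have i1 := (integrable_indicator_riesz (N := N) (α := α) 1).const_mul C
  have i2 := hg.abs
  have i12 : Integrable fun y =>
      C * (Metric.ball (0 : 𝔼) 1).indicator (riesz N α) y + |g y| := i1.add i2
  rw [← integral_const_mul, ← integral_add i1 i2]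
  refine integral_mono (integrable_riesz_mul i2 (M := C) fun x => by simpa using hC x) i12
    fun y => ?_
  have h1 := riesz_le_indicator_add_one (α := α) y
  have h2 : 0 ≤ (Metric.ball (0 : 𝔼) 1).indicator (riesz N α) y :=
    Set.indicator_nonneg (fun z _ => riesz_nonneg z) y
  nlinarith [hC y, abs_nonneg (g y)]

variable (N α) in
/-- The bound for the potential of data supported in the ball of radius `R`. -/
def potBound (R : ℝ) : ℝ :=
  (rieszConst N α)⁻¹ * ((∫ y, (Metric.ball (0 : EuclideanSpace ℝ (Fin N)) 1).indicator
    (riesz N α) y) + volume.real (Metric.ball (0 : EuclideanSpace ℝ (Fin N)) R))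

lemma potBound_nonneg (R : ℝ) : 0 ≤ potBound N α R := by
  have := rieszConst_pos N α
  have : 0 ≤ ∫ y, (Metric.ball (0 : 𝔼) 1).indicator (riesz N α) y :=
    integral_nonneg fun y => Set.indicator_nonneg (fun z _ => riesz_nonneg z) y
  unfold potBound
  positivity

lemma IsDatum.abs_rieszPot_le {C R : ℝ} {g : 𝔼 → ℝ} (hg : IsDatum C R g) (x : 𝔼) :
    |rieszPot N α g x| ≤ potBound N α R * C := by
  have hκ := rieszConst_pos N α
  rw [rieszPot, potBound, abs_mul, abs_neg, abs_inv, abs_of_pos hκ, mul_assoc]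
  refine mul_le_mul_of_nonneg_left ?_ (by positivity)
  have h1 : ∫ y, riesz N α (x - y) * g y = ∫ y, riesz N α y * g (x - y) := by
    rw [← integral_sub_left_eq_self (fun y => riesz N α y * g (x - y)) volume x]
    simp
  rw [h1]
  have i := hg.integrable.comp_sub_left x
  refine (abs_integral_le_integral_abs).trans ?_
  simp_rw [abs_mul, abs_of_nonneg (riesz_nonneg _)]
  refine (integral_riesz_mul_abs_le i fun y => hg.bdd _).trans ?_
  rw [integral_sub_left_eq_self (fun y => |g y|) volume x]
  linarith [hg.integral_abs_le]

lemma IsDatum.sub {C C' R : ℝ} {g g' : 𝔼 → ℝ} (hg : IsDatum C R g) (hg' : IsDatum C R g')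
    (h : ∀ x, |g x - g' x| ≤ C') : IsDatum C' R fun x => g x - g' x :=
  ⟨hg.meas.sub hg'.meas, h, fun x hx => by rw [hg.supp x hx, hg'.supp x hx, sub_zero]⟩

/-- The Riesz kernel truncated at height `ε ^ (α - N)`. -/
def rieszTrunc (N : ℕ) (α ε : ℝ) (y : EuclideanSpace ℝ (Fin N)) : ℝ :=
  (max ‖y‖ ε) ^ (α - (N : ℝ))

lemma abs_riesz_sub_rieszTrunc_le {ε : ℝ} {y : 𝔼} (hy : y ≠ 0) :
    |riesz N α y - rieszTrunc N α ε y| ≤ (Metric.ball (0 : 𝔼) ε).indicator (riesz N α) y := by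
  have hn : 0 < ‖y‖ := norm_pos_iff.2 hy
  by_cases h : y ∈ Metric.ball (0 : 𝔼) ε
  · rw [Set.indicator_of_mem h]
    have h' : ‖y‖ < ε := by simpa using h
    have h1 : rieszTrunc N α ε y ≤ riesz N α y :=
      Real.rpow_le_rpow_of_nonpos hn (le_max_left _ _) (StableParams.sub_neg N α).le
    have h2 : 0 ≤ rieszTrunc N α ε y := by unfold rieszTrunc; positivity
    rw [abs_of_nonneg (by linarith)]
    linarith
  · rw [Set.indicator_of_notMem h, rieszTrunc, max_eq_left (by simpa using h), riesz]
    simp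

lemma continuous_rieszTrunc {ε : ℝ} (hε : 0 < ε) : Continuous (rieszTrunc N α ε) := by
  unfold rieszTrunc
  refine Continuous.rpow_const (by fun_prop) fun y => Or.inl ?_
  have := le_max_right ‖y‖ ε
  linarith

lemma rieszTrunc_le {ε : ℝ} (hε : 0 < ε) (y : 𝔼) : |rieszTrunc N α ε y| ≤ ε ^ (α - (N : ℝ)) := by
  unfold rieszTrunc
  rw [abs_of_nonneg (by positivity)]
  exact Real.rpow_le_rpow_of_nonpos hε (le_max_right _ _) (StableParams.sub_neg N α).le

lemma continuous_rieszTrunc_conv {ε : ℝ} (hε : 0 < ε) {g : 𝔼 → ℝ} (hg : Integrable g) :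
    Continuous fun x => ∫ y, rieszTrunc N α ε (x - y) * g y := by
  have hc := continuous_rieszTrunc (N := N) (α := α) hε
  refine continuous_of_dominated (bound := fun y => ε ^ (α - (N : ℝ)) * |g y|) (fun x => ?_)
    (fun x => Eventually.of_forall fun y => ?_) (hg.abs.const_mul _)
    (Eventually.of_forall fun y => ?_)
  · exact (hc.comp (continuous_const.sub continuous_id)).aestronglyMeasurable.mul hg.1
  · rw [norm_mul]
    exact mul_le_mul_of_nonneg_right (rieszTrunc_le hε _) (norm_nonneg _)
  · exact (hc.comp (continuous_id.sub continuous_const)).mul continuous_const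

variable (N α) in
lemma tendsto_integral_indicator_riesz :
    Tendsto (fun n : ℕ => ∫ y, (Metric.ball (0 : 𝔼) (1 / ((n : ℝ) + 1))).indicator (riesz N α) y)
      atTop (𝓝 0) := by
  have hm := measurable_riesz (N := N) (α := α)
  have := nontrivial_of_pos (StableParams.dim_pos N α)
  rw [show (0 : ℝ) = ∫ _ : 𝔼, (0 : ℝ) by simp]
  refine tendsto_integral_of_dominated_convergence
    ((Metric.ball (0 : 𝔼) 1).indicator (riesz N α))
    (fun n => (integrable_indicator_riesz _).1) (integrable_indicator_riesz 1)
    (fun n => Eventually.of_forall fun y => ?_) ?_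
  · rw [Real.norm_of_nonneg (Set.indicator_nonneg (fun z _ => riesz_nonneg z) y)]
    refine Set.indicator_le_indicator_of_subset (Metric.ball_subset_ball ?_)
      (fun z => riesz_nonneg z) y
    rw [div_le_one (by positivity)]
    have : (0 : ℝ) ≤ n := by positivity
    linarith
  · filter_upwards [Measure.ae_ne volume (0 : 𝔼)] with y hy
    have h1 : ∀ᶠ n : ℕ in atTop, 1 / ((n : ℝ) + 1) < ‖y‖ :=
      (tendsto_one_div_add_atTop_nhds_zero_nat (𝕜 := ℝ)).eventually_lt_const (norm_pos_iff.2 hy)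
    refine tendsto_const_nhds.congr' ?_
    filter_upwards [h1] with n hn
    rw [Set.indicator_of_notMem]
    simpa using hn.le

lemma IsDatum.continuous_rieszPot {C R : ℝ} {g : 𝔼 → ℝ} (hg : IsDatum C R g) :
    Continuous (rieszPot N α g) := by
  have := nontrivial_of_pos (StableParams.dim_pos N α)
  have hp : ∀ n : ℕ, (0 : ℝ) < 1 / ((n : ℝ) + 1) := fun n => by positivity
  have h1 : TendstoUniformly
      (fun (n : ℕ) x => ∫ y, rieszTrunc N α (1 / ((n : ℝ) + 1)) (x - y) * g y)
      (fun x => ∫ y, riesz N α (x - y) * g y) atTop := by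
    rw [Metric.tendstoUniformly_iff]
    intro δ hδ
    have h0 := (tendsto_integral_indicator_riesz N α).const_mul C
    rw [mul_zero] at h0
    filter_upwards [h0.eventually_lt_const hδ] with n hn x
    have ht : Integrable fun y => rieszTrunc N α (1 / ((n : ℝ) + 1)) (x - y) * g y := by
      have hc := continuous_rieszTrunc (N := N) (α := α) (hp n)
      refine hg.integrable.bdd_mul
        ((hc.comp (continuous_const.sub continuous_id)).aestronglyMeasurable)
        (Eventually.of_forall fun y => rieszTrunc_le (hp n) _)
    rw [Real.dist_eq, ← integral_sub (integrable_riesz_sub_mul hg.integrable hg.bdd x) ht]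
    refine lt_of_le_of_lt ?_ hn
    rw [← integral_const_mul, ← integral_sub_left_eq_self (fun y => C *
      (Metric.ball (0 : 𝔼) (1 / ((n : ℝ) + 1))).indicator (riesz N α) y) volume x]
    refine (abs_integral_le_integral_abs).trans (integral_mono_ae ?_ ?_ ?_)
    · exact ((integrable_riesz_sub_mul hg.integrable hg.bdd x).sub ht).abs
    · exact ((integrable_indicator_riesz _).const_mul C).comp_sub_left x
    · filter_upwards [Measure.ae_ne volume x] with y hy
      have hxy : x - y ≠ 0 := sub_ne_zero.2 hy.symm
      rw [← sub_mul, abs_mul, mul_comm C]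
      exact mul_le_mul (abs_riesz_sub_rieszTrunc_le hxy) (hg.bdd y) (abs_nonneg _)
        (Set.indicator_nonneg (fun z _ => riesz_nonneg z) _)
  exact continuous_const.mul (h1.continuous
    (Eventually.of_forall fun n => continuous_rieszTrunc_conv (hp n) hg.integrable).frequently)

lemma IsDatum.tendsto_rieszPot {C R : ℝ} {g : 𝔼 → ℝ} (hg : IsDatum C R g) :
    Tendsto (rieszPot N α g) (cocompact 𝔼) (𝓝 0) := by
  rw [show (0 : ℝ) = -(rieszConst N α)⁻¹ * 0 by simp]
  refine Tendsto.const_mul _ ?_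
  have h1 : Tendsto (fun x : 𝔼 => (‖x‖ - R) ^ (α - (N : ℝ)) * ∫ y, |g y|) (cocompact 𝔼) (𝓝 0) := by
    rw [show (0 : ℝ) = 0 * ∫ y, |g y| by simp]
    refine Tendsto.mul_const _ ?_
    have h2 := tendsto_rpow_neg_atTop (y := N - α) (by linarith [StableParams.sub_neg N α])
    rw [neg_sub] at h2
    exact h2.comp ((tendsto_norm_cocompact_atTop (E := 𝔼)).atTop_add (tendsto_const_nhds (x := -R)))
  refine squeeze_zero_norm' ?_ h1
  filter_upwards [(tendsto_norm_cocompact_atTop (E := 𝔼)).eventually_gt_atTop R] with x hx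
  rw [← integral_const_mul]
  refine (norm_integral_le_integral_norm _).trans
    (integral_mono (integrable_riesz_sub_mul hg.integrable hg.bdd x).norm
      (hg.integrable.abs.const_mul _) fun y => ?_)
  simp only
  rw [norm_mul, Real.norm_of_nonneg (riesz_nonneg _), Real.norm_eq_abs]
  rcases le_or_gt R ‖y‖ with hy | hy
  · simp [hg.supp y hy]
  · refine mul_le_mul_of_nonneg_right ?_ (abs_nonneg _)
    refine Real.rpow_le_rpow_of_nonpos (by linarith) ?_ (StableParams.sub_neg N α).le
    linarith [norm_sub_norm_le x y]

lemma IsTest.comp_add_right {θ : 𝔼 → ℝ} (hθ : IsTest θ) (p : 𝔼) : IsTest fun x => θ (x + p) := by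
  simpa using hθ.comp_scale (-p) (t := 1) one_pos

lemma fracLap_comp_add_right (θ : 𝔼 → ℝ) (p x : 𝔼) :
    fracLap N α (fun x => θ (x + p)) x = fracLap N α θ (x + p) := by
  simp only [fracLap, add_right_comm, sub_add_eq_add_sub]

lemma IsDatum.fracSol_rieszPot {C R : ℝ} {g : 𝔼 → ℝ} (hg : IsDatum C R g) :
    FracSol N α Set.univ (rieszPot N α g) g where
  cont := hg.continuous_rieszPot
  bdd := ⟨_, hg.abs_rieszPot_le⟩
  meas := hg.meas
  rhs_bdd := ⟨C, hg.bdd⟩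
  eq := by
    intro θ hθ _
    have hκ := rieszConst_pos N α
    obtain ⟨M, hM0, hM⟩ := hθ.abs_fracLap_le (α := α)
    have hL := hθ.integrable_fracLap (α := α)
    have hLm := measurable_fracLap (α := α) hθ.measurable
    have hr := measurable_riesz (N := N) (α := α)
    have hgm := hg.meas
    have hshift : ∀ y : 𝔼, Integrable fun x => riesz N α (x - y) * fracLap N α θ x := fun y => by
      have := (integrable_riesz_mul (α := α) (hL.comp_add_right y) (M := M)
        fun x => hM _).comp_sub_right y
      simpa using this
    have hF : Integrable (Function.uncurry fun x y =>
        riesz N α (x - y) * g y * fracLap N α θ x) (volume.prod volume) := by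
      have hmeas : AEStronglyMeasurable (Function.uncurry fun x y =>
          riesz N α (x - y) * g y * fracLap N α θ x) (volume.prod volume) := by
        refine Measurable.aestronglyMeasurable ?_
        change Measurable fun p : 𝔼 × 𝔼 => riesz N α (p.1 - p.2) * g p.2 * fracLap N α θ p.1
        fun_prop
      rw [integrable_prod_iff' hmeas]
      constructor
      · refine Eventually.of_forall fun y => ((hshift y).const_mul (g y)).congr
          (Eventually.of_forall fun x => ?_)
        simp only [Function.uncurry_apply_pair]
        ring
      · refine (hg.integrable.abs.const_mul (M * (∫ y, (Metric.ball (0 : 𝔼) 1).indicator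
          (riesz N α) y) + ∫ y, |fracLap N α θ y|)).mono'
          hmeas.norm.prod_swap.integral_prod_right' (Eventually.of_forall fun y => ?_)
        have e : ∫ x, ‖riesz N α (x - y) * g y * fracLap N α θ x‖ =
            |g y| * ∫ x, riesz N α x * |fracLap N α θ (x + y)| := by
          rw [← integral_const_mul, ← integral_sub_right_eq_self (fun x => |g y| *
            (riesz N α x * |fracLap N α θ (x + y)|)) y]
          refine integral_congr_ae (Eventually.of_forall fun x => ?_)
          simp only [norm_mul, Real.norm_eq_abs, abs_of_nonneg (riesz_nonneg _), sub_add_cancel]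
          ring
        simp only [Function.uncurry_apply_pair]
        rw [e, Real.norm_of_nonneg (mul_nonneg (abs_nonneg _) (integral_nonneg fun x =>
          mul_nonneg (riesz_nonneg _) (abs_nonneg _))), mul_comm]
        refine mul_le_mul_of_nonneg_right ?_ (abs_nonneg _)
        refine (integral_riesz_mul_abs_le (hL.comp_add_right y) fun x => hM _).trans_eq ?_
        rw [integral_add_right_eq_self (fun x => |fracLap N α θ x|) y]
    have hswap := integral_integral_swap hF
    have e1 : ∀ x, ∫ y, riesz N α (x - y) * g y * fracLap N α θ x =
        -rieszConst N α * (rieszPot N α g x * fracLap N α θ x) := fun x => by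
      rw [integral_mul_const, rieszPot]
      field_simp
    have e2 : ∀ y, ∫ x, riesz N α (x - y) * g y * fracLap N α θ x =
        -rieszConst N α * (g y * θ y) := fun y => by
      have h := (hθ.comp_add_right y).integral_riesz_mul_fracLap (α := α)
      simp only [fracLap_comp_add_right, zero_add] at h
      rw [← integral_sub_right_eq_self _ y] at h
      simp only [sub_add_cancel] at h
      rw [mul_left_comm, ← h, ← integral_const_mul]
      congr 1
      ext x
      ring
    simp only [e1, e2, integral_const_mul] at hswap
    exact mul_left_cancel₀ (neg_ne_zero.2 hκ.ne') hswap

/-- Monotone Lipschitz nonlinearities supported in the ball of radius `R`. -/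
structure IsNonlin (Λ R : ℝ) (b : 𝔼 → ℝ → ℝ) : Prop where
  meas : ∀ v : 𝔼 → ℝ, Continuous v → Measurable fun x => b x (v x)
  mono : ∀ x, Monotone (b x)
  lip : ∀ x s t, |b x s - b x t| ≤ Λ * |s - t|
  supp : ∀ x s, R ≤ ‖x‖ → b x s = 0
  bdd : ∃ C, ∀ x, |b x 0| ≤ C

lemma IsNonlin.lip_nonneg {Λ R : ℝ} {b : 𝔼 → ℝ → ℝ} (hb : IsNonlin Λ R b) : 0 ≤ Λ := by
  have := (abs_nonneg _).trans (hb.lip 0 1 0)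
  simpa using this

lemma IsNonlin.isDatum {Λ R : ℝ} {b : 𝔼 → ℝ → ℝ} (hb : IsNonlin Λ R b) {v : 𝔼 → ℝ}
    (hv : Continuous v) {M : ℝ} (hM : ∀ x, |v x| ≤ M) :
    ∃ C, IsDatum C R fun x => b x (v x) := by
  obtain ⟨C, hC⟩ := hb.bdd
  refine ⟨Λ * M + C, hb.meas v hv, fun x => ?_, fun x hx => hb.supp x _ hx⟩
  have h1 := hb.lip x (v x) 0
  rw [sub_zero] at h1
  have h2 := abs_add_le (b x (v x) - b x 0) (b x 0)
  rw [sub_add_cancel] at h2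
  linarith [hC x, mul_le_mul_of_nonneg_left (hM x) hb.lip_nonneg]

lemma IsDatum.add {C C' R : ℝ} {g g' : 𝔼 → ℝ} (hg : IsDatum C R g) (hg' : IsDatum C' R g') :
    IsDatum (C + C') R fun x => g x + g' x :=
  ⟨hg.meas.add hg'.meas, fun x => (abs_add_le _ _).trans (add_le_add (hg.bdd x) (hg'.bdd x)),
    fun x hx => by rw [hg.supp x hx, hg'.supp x hx, add_zero]⟩

lemma IsDatum.const_mul {C R : ℝ} {g : 𝔼 → ℝ} (hg : IsDatum C R g) (c : ℝ) :
    IsDatum (|c| * C) R fun x => c * g x :=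
  ⟨hg.meas.const_mul c, fun x => by
    rw [abs_mul]; exact mul_le_mul_of_nonneg_left (hg.bdd x) (abs_nonneg c),
    fun x hx => by rw [hg.supp x hx, mul_zero]⟩

lemma isDatum_indicator_ball (R : ℝ) :
    IsDatum 1 R ((Metric.ball (0 : 𝔼) R).indicator fun _ => (1 : ℝ)) := by
  refine ⟨measurable_const.indicator measurableSet_ball, fun x => ?_, fun x hx => ?_⟩
  · by_cases h : x ∈ Metric.ball (0 : 𝔼) R <;> simp [h]
  · exact Set.indicator_of_notMem (by simpa using hx) _

variable (α) in
/-- Stability of solutions vanishing at infinity under perturbations of a monotone equation. -/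
lemma FracSol.le_add_of_mono {R η t : ℝ} (ht : 0 ≤ t) {b : 𝔼 → ℝ → ℝ}
    (hb : ∀ x, Monotone (b x)) {v₁ v₂ h₁ h₂ : 𝔼 → ℝ}
    (hv₁ : FracSol N α Set.univ v₁ fun x => t * b x (v₁ x) + h₁ x)
    (hv₂ : FracSol N α Set.univ v₂ fun x => t * b x (v₂ x) + h₂ x)
    (l₁ : Tendsto v₁ (cocompact 𝔼) (𝓝 0)) (l₂ : Tendsto v₂ (cocompact 𝔼) (𝓝 0))
    (hη : 0 ≤ η) (hh : ∀ x, |h₁ x - h₂ x| ≤ η * (Metric.ball (0 : 𝔼) R).indicator 1 x) (x : 𝔼) :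
    v₁ x ≤ v₂ x + potBound N α R * η := by
  have hI := isDatum_indicator_ball (N := N) R
  set s := rieszPot N α ((Metric.ball (0 : 𝔼) R).indicator fun _ => (1 : ℝ)) with hs
  have hS := hI.fracSol_rieszPot (α := α)
  have ls := hI.tendsto_rieszPot (α := α)
  have hs0 : ∀ x, s x ≤ 0 := by
    refine fun x => hS.le_of_tendsto (FracSol.const N α 0) ls tendsto_const_nhds ?_ x
    intro x _
    exact Set.indicator_nonneg (fun _ _ => zero_le_one) x
  have key : v₁ x ≤ v₂ x - η * s x := by
    refine hv₁.le_of_tendsto (hv₂.sub (hS.const_mul η)) l₁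
      (by simpa using l₂.sub (ls.const_mul η)) (fun x hx => ?_) x
    have h1 : v₂ x ≤ v₁ x := by nlinarith [hs0 x]
    have h2 := mul_le_mul_of_nonneg_left (hb x h1) ht
    have h3 := (abs_le.1 (hh x)).1
    simp only [Pi.one_def] at h3
    linarith
  have h4 := hI.abs_rieszPot_le (α := α) x
  have h5 := mul_le_mul_of_nonneg_left ((neg_le_abs _).trans h4) hη
  linarith

variable (α) in
/-- Solvability of `Δ^{α/2} v = t b(x, v) + h` in the class of functions vanishing at infinity. -/
def Solvable (R : ℝ) (b : 𝔼 → ℝ → ℝ) (t : ℝ) : Prop :=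
  ∀ C h, IsDatum C R h → ∃ v, Tendsto v (cocompact 𝔼) (𝓝 0) ∧
    FracSol N α Set.univ v fun x => t * b x (v x) + h x

lemma IsNonlin.solvable_add {Λ R t δ : ℝ} {b : 𝔼 → ℝ → ℝ} (hb : IsNonlin Λ R b) (ht : 0 ≤ t)
    (hδ : 0 ≤ δ) (hδ' : potBound N α R * (δ * Λ) ≤ 1 / 2) (hs : Solvable α R b t) :
    Solvable α R b (t + δ) := by
  intro C h hh
  have hΛ := hb.lip_nonneg
  have hdat : ∀ w : BoundedContinuousFunction 𝔼 ℝ, ∃ C, IsDatum C R fun x =>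
      δ * b x (w x) + h x := fun w => by
    obtain ⟨C', hC'⟩ := hb.isDatum w.continuous w.norm_coe_le_norm
    exact ⟨_, (hC'.const_mul δ).add hh⟩
  have hex : ∀ w : BoundedContinuousFunction 𝔼 ℝ, ∃ v : BoundedContinuousFunction 𝔼 ℝ,
      Tendsto v (cocompact 𝔼) (𝓝 0) ∧
      FracSol N α Set.univ v fun x => t * b x (v x) + (δ * b x (w x) + h x) := fun w => by
    obtain ⟨C', hC'⟩ := hdat w
    obtain ⟨v, lv, hv⟩ := hs C' _ hC'
    obtain ⟨M, hM⟩ := hv.bdd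
    exact ⟨BoundedContinuousFunction.ofNormedAddCommGroup v hv.cont M hM, lv, hv⟩
  choose T lT hT using hex
  have hcon : ContractingWith (1 / 2) T := by
    refine ⟨by
      rw [← NNReal.coe_lt_coe]
      norm_num, LipschitzWith.of_dist_le_mul fun w₁ w₂ => ?_⟩
    rw [BoundedContinuousFunction.dist_le (by positivity)]
    have hd : ∀ w₁ w₂ : BoundedContinuousFunction 𝔼 ℝ, ∀ x, T w₁ x ≤ T w₂ x + 1 / 2 * dist w₁ w₂ := by
      intro w₁ w₂ x
      refine ((hT w₁).le_add_of_mono α (R := R) (η := δ * Λ * dist w₁ w₂) ht hb.mono (hT w₂)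
        (lT w₁) (lT w₂) (by positivity) (fun y => ?_) x).trans ?_
      · by_cases hy : y ∈ Metric.ball (0 : 𝔼) R
        · rw [Set.indicator_of_mem hy, Pi.one_apply, mul_one, add_sub_add_right_eq_sub, ← mul_sub,
            abs_mul, abs_of_nonneg hδ, mul_assoc]
          refine mul_le_mul_of_nonneg_left ((hb.lip _ _ _).trans
            (mul_le_mul_of_nonneg_left ?_ hΛ)) hδ
          exact BoundedContinuousFunction.dist_coe_le_dist (f := w₁) (g := w₂) y
        · have hy' : R ≤ ‖y‖ := by simpa using hy
          simp [hb.supp y _ hy', hy]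
      · have := mul_le_mul_of_nonneg_right hδ' (dist_nonneg (x := w₁) (y := w₂))
        linarith
    intro x
    rw [Real.dist_eq, abs_sub_le_iff]
    have e1 := hd w₁ w₂ x
    have e2 := hd w₂ w₁ x
    rw [dist_comm w₂] at e2
    push_cast
    constructor <;> linarith
  obtain ⟨v, hv, -⟩ := hcon.exists_fixedPoint 0 (edist_ne_top _ _)
  have hv' : T v = v := hv
  refine ⟨v, hv' ▸ lT v, ?_⟩
  have := hT v
  rw [hv'] at this
  convert this using 2
  ring

theorem IsNonlin.exists_fracSol {Λ R : ℝ} {b : 𝔼 → ℝ → ℝ} (hb : IsNonlin Λ R b) :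
    ∃ v, Tendsto v (cocompact 𝔼) (𝓝 0) ∧ FracSol N α Set.univ v fun x => b x (v x) := by
  obtain ⟨n, hn⟩ := exists_nat_gt (potBound N α R * Λ * 2)
  have hP := potBound_nonneg (N := N) (α := α) R
  have hΛ := hb.lip_nonneg
  have hn0 : (0 : ℝ) < n := lt_of_le_of_lt (by positivity) hn
  have hstep : ∀ k : ℕ, Solvable α R b (k * (1 / (n : ℝ))) := by
    intro k
    induction k with
    | zero =>
      intro C h hh
      exact ⟨_, hh.tendsto_rieszPot (α := α), by simpa using hh.fracSol_rieszPot (α := α)⟩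
    | succ k ih =>
      rw [show ((k + 1 : ℕ) : ℝ) * (1 / n) = k * (1 / (n : ℝ)) + 1 / n by push_cast; ring]
      refine hb.solvable_add (by positivity) (by positivity) ?_ ih
      rw [← sub_nonneg]
      have : (1 : ℝ) / 2 - potBound N α R * (1 / n * Λ) =
        (n - potBound N α R * Λ * 2) / (2 * n) := by field_simp
      rw [this]
      exact div_nonneg (by linarith) (by positivity)
  have h0 : IsDatum 0 R fun _ : 𝔼 => (0 : ℝ) := ⟨measurable_const, by simp, by simp⟩
  obtain ⟨v, lv, hv⟩ := hstep n 0 _ h0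
  refine ⟨v, lv, ?_⟩
  simpa [mul_inv_cancel₀ hn0.ne'] using hv

/-- The nonlinearity `h` penalised on the complement of `D`. -/
def penal (D : Set 𝔼) (h : 𝔼 → ℝ → ℝ) (n : ℕ) (x : 𝔼) (s : ℝ) : ℝ :=
  h x s + n * (Metric.ball (0 : 𝔼) n \ D).indicator (fun _ => (1 : ℝ)) x * s

lemma penal_of_mem {D : Set 𝔼} (h : 𝔼 → ℝ → ℝ) (n : ℕ) {x : 𝔼} (hx : x ∈ D) (s : ℝ) :
    penal D h n x s = h x s := by
  simp [penal, hx]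

lemma IsNonlin.penal {Λ R : ℝ} {D : Set 𝔼} (hD : MeasurableSet D) {h : 𝔼 → ℝ → ℝ}
    (hh : IsNonlin Λ R h) (n : ℕ) : IsNonlin (Λ + n) (max R n) (penal D h n) where
  meas v hv := (hh.meas v hv).add (((measurable_const.indicator
    (measurableSet_ball.diff hD)).const_mul _).mul hv.measurable)
  mono x s t hst := by
    have h1 : (0 : ℝ) ≤ (Metric.ball (0 : 𝔼) n \ D).indicator (fun _ => (1 : ℝ)) x :=
      Set.indicator_nonneg (fun _ _ => zero_le_one) x
    have h2 := mul_le_mul_of_nonneg_left hst (mul_nonneg (Nat.cast_nonneg (α := ℝ) n) h1)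
    exact add_le_add (hh.mono x hst) h2
  lip x s t := by
    have h1 : |(Metric.ball (0 : 𝔼) n \ D).indicator (fun _ => (1 : ℝ)) x| ≤ 1 := by
      by_cases hx : x ∈ Metric.ball (0 : 𝔼) n \ D <;> simp [hx]
    have h2 := hh.lip x s t
    have h3 : _root_.penal D h n x s - _root_.penal D h n x t = (h x s - h x t) +
        n * (Metric.ball (0 : 𝔼) n \ D).indicator (fun _ => (1 : ℝ)) x * (s - t) := by
      simp only [_root_.penal]; ring
    rw [h3, add_mul]
    refine (abs_add_le _ _).trans (add_le_add h2 ?_)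
    rw [abs_mul, abs_mul, Nat.abs_cast]
    refine mul_le_mul_of_nonneg_right ?_ (abs_nonneg _)
    exact mul_le_of_le_one_right (Nat.cast_nonneg _) h1
  supp x s hx := by
    have h1 : x ∉ Metric.ball (0 : 𝔼) n \ D := fun hx' => by
      have h2 : ‖x‖ < n := by simpa using hx'.1
      linarith [le_max_right R n]
    rw [_root_.penal, Set.indicator_of_notMem h1, hh.supp x s ((le_max_left _ _).trans hx)]
    simp
  bdd := by
    obtain ⟨C, hC⟩ := hh.bdd
    exact ⟨C, fun x => by simpa [_root_.penal] using hC x⟩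

variable (α) in
/-- Penalised approximations of the solution of `Δ^{α/2} v = -1` in `D`, `v = 0` off `D`. -/
structure IsTorsionSeq (D : Set 𝔼) (M : ℝ) (v : ℕ → 𝔼 → ℝ) : Prop where
  sol : ∀ n, FracSol N α Set.univ (v n) fun x =>
    penal D (fun x _ => -D.indicator (fun _ => (1 : ℝ)) x) n x (v n x)
  tendsto : ∀ n, Tendsto (v n) (cocompact 𝔼) (𝓝 0)
  nonneg : ∀ n x, 0 ≤ v n x
  anti : ∀ x, Antitone fun n => v n x
  le : ∀ n x, v n x ≤ M

variable (α) in
theorem exists_isTorsionSeq {D : Set 𝔼} (hD : MeasurableSet D) (hDb : Bornology.IsBounded D) :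
    ∃ M v, IsTorsionSeq α D M v := by
  obtain ⟨R, hR⟩ := hDb.subset_ball (0 : 𝔼)
  have hnl : IsNonlin (N := N) 0 R fun x _ => -D.indicator (fun _ => (1 : ℝ)) x := by
    refine ⟨fun v _ => (measurable_const.indicator hD).neg, fun x s t _ => le_rfl, by simp,
      fun x s hx => ?_, 1, fun x => ?_⟩
    · rw [Set.indicator_of_notMem, neg_zero]
      intro hx'
      have : ‖x‖ < R := by simpa using hR hx'
      linarith
    · by_cases hx : x ∈ D <;> simp [hx]
  choose v lv hv using fun n => (hnl.penal hD n).exists_fracSol (α := α)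
  have h0 : ∀ n x, 0 ≤ v n x := fun n x => by
    refine (FracSol.const N α 0).le_of_tendsto (hv n) tendsto_const_nhds (lv n) (fun x hx => ?_) x
    have h1 : (0 : ℝ) ≤ (Metric.ball (0 : 𝔼) n \ D).indicator (fun _ => (1 : ℝ)) x :=
      Set.indicator_nonneg (fun _ _ => zero_le_one) x
    have h2 : (0 : ℝ) ≤ D.indicator (fun _ => (1 : ℝ)) x :=
      Set.indicator_nonneg (fun _ _ => zero_le_one) x
    have h3 := mul_nonneg (Nat.cast_nonneg (α := ℝ) n) h1
    simp only [penal, Pi.zero_apply]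
    nlinarith
  have hanti : ∀ x, Antitone fun n => v n x := fun x m n hmn => by
    refine (hv n).le_of_tendsto (hv m) (lv n) (lv m) (fun x hx => ?_) x
    simp only [penal]
    have hmn' : (m : ℝ) ≤ n := by exact_mod_cast hmn
    have h1 : (Metric.ball (0 : 𝔼) m \ D).indicator (fun _ => (1 : ℝ)) x ≤
        (Metric.ball (0 : 𝔼) n \ D).indicator (fun _ => (1 : ℝ)) x :=
      Set.indicator_le_indicator_of_subset
        (Set.sdiff_subset_sdiff_left (Metric.ball_subset_ball hmn')) (fun _ => zero_le_one) x
    have h2 : (0 : ℝ) ≤ (Metric.ball (0 : 𝔼) m \ D).indicator (fun _ => (1 : ℝ)) x :=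
      Set.indicator_nonneg (fun _ _ => zero_le_one) x
    have h3 := h0 m x
    have h4 : 0 ≤ n * (Metric.ball (0 : 𝔼) n \ D).indicator (fun _ => (1 : ℝ)) x :=
      mul_nonneg (Nat.cast_nonneg _) (h2.trans h1)
    gcongr
  obtain ⟨M, hM⟩ := (hv 0).bdd
  exact ⟨M, v, hv, lv, h0, hanti, fun n x =>
    (hanti x (Nat.zero_le n)).trans ((le_abs_self _).trans (hM x))⟩

/-- Smooth bump functions are test functions. -/
lemma isTest_bump {c : 𝔼} (f : ContDiffBump c) : IsTest fun x => f x :=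
  ⟨f.contDiff, f.hasCompactSupport⟩

lemma fracLap_add_const_mul {f g : 𝔼 → ℝ} (hf : IsTest f) (hg : IsTest g) (c : ℝ) (x : 𝔼) :
    fracLap N α (fun x => f x + c * g x) x = fracLap N α f x + c * fracLap N α g x := by
  obtain ⟨C, -, hC⟩ := hf.secDiff_le
  obtain ⟨C', -, hC'⟩ := hg.secDiff_le
  have i1 := SecBound.integrable (α := α) hf.measurable (hC x)
  have i2 := SecBound.integrable (α := α) hg.measurable (hC' x)
  rw [fracLap_def, fracLap_def, fracLap_def, mul_left_comm, ← mul_add, ← integral_const_mul c,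
    ← integral_add i1 (i2.const_mul c)]
  congr 2
  ext z
  simp only [secDiff]
  ring

lemma IsTest.add_const_mul {f g : 𝔼 → ℝ} (hf : IsTest f) (hg : IsTest g) (c : ℝ) :
    IsTest fun x => f x + c * g x :=
  ⟨hf.smooth.add (contDiff_const.mul hg.smooth), hf.compact.add hg.compact.mul_left⟩

/-- A barrier profile: subharmonic near the origin thanks to the mass it carries around `e`. -/
lemma exists_profile {e : 𝔼} {r : ℝ} (hr : 0 < r) (hre : r ≤ ‖e‖ / 2) :
    ∃ P : 𝔼 → ℝ, ∃ κ c : ℝ, IsTest P ∧ 0 < κ ∧ 0 < c ∧ (∀ x, 0 ≤ P x) ∧ (∀ x, P x ≤ 1) ∧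
      (∀ x, ‖x‖ ≤ ‖e‖ / 8 → κ ≤ P x) ∧ (∀ x, ‖x‖ < ‖e‖ / 4 → c ≤ fracLap N α P x) ∧
      ∀ x, P x ≠ 0 → ‖x‖ < ‖e‖ / 4 ∨ ‖x - e‖ < r := by
  have hd : 0 < ‖e‖ := by linarith
  let ψ : ContDiffBump e := ⟨r / 2, r, by positivity, by linarith⟩
  let b : ContDiffBump (0 : 𝔼) := ⟨‖e‖ / 8, ‖e‖ / 4, by positivity, by linarith⟩
  have hψ := isTest_bump ψ
  have hb := isTest_bump b
  have hψs : ∀ x, ψ x ≠ 0 → ‖x - e‖ < r := fun x hx => by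
    have : x ∈ Function.support ψ := hx
    rw [ψ.support_eq] at this
    simpa [dist_eq_norm] using this
  have hbs : ∀ x, b x ≠ 0 → ‖x‖ < ‖e‖ / 4 := fun x hx => by
    have : x ∈ Function.support b := hx
    rw [b.support_eq] at this
    simpa using this
  have hψ0 : ∀ x, ‖x‖ < ‖e‖ / 4 → ψ x = 0 := fun x hx => by
    by_contra h
    have h1 := hψs x h
    have h2 := norm_sub_norm_le e x
    rw [norm_sub_rev] at h2
    linarith
  obtain ⟨K, hK0, hK⟩ := hb.abs_fracLap_le (α := α)
  set c₀ := fracLapCoeff N α / 2 * ((2 * ‖e‖) ^ (-((N : ℝ) + α)) * ∫ x, ψ x) with hc₀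
  have hc₀p : 0 < c₀ := by
    have := fracLapCoeff_pos N α
    have := ψ.integral_pos (μ := volume)
    positivity
  have hψL : ∀ x, ‖x‖ < ‖e‖ / 4 → c₀ ≤ fracLap N α ψ x := fun x hx => by
    refine hψ.le_fracLap (fun x => ψ.nonneg) (hψ0 x hx) (fun y hy => ?_) (by positivity)
    have h1 := hψs y hy
    have h2 : y - x = (y - e) + e - x := by abel
    rw [h2]
    have h3 := norm_sub_le (y - e + e) x
    have h4 := norm_add_le (y - e) e
    linarith
  set κ := min 1 (c₀ / (2 * (K + 1))) with hκ
  have hκ0 : 0 < κ := lt_min one_pos (by positivity)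
  have hκK : κ * K ≤ c₀ / 2 := by
    have h1 : κ ≤ c₀ / (2 * (K + 1)) := min_le_right _ _
    rw [le_div_iff₀ (by positivity)] at h1
    nlinarith
  refine ⟨fun x => ψ x + κ * b x, κ, c₀ / 2, hψ.add_const_mul hb κ, hκ0, by positivity,
    fun x => ?_, fun x => ?_, fun x hx => ?_, fun x hx => ?_, fun x hx => ?_⟩
  · have := ψ.nonneg (x := x)
    have := b.nonneg (x := x)
    positivity
  · beta_reduce
    by_cases hx : ‖x‖ < ‖e‖ / 4
    · rw [hψ0 x hx, zero_add]
      exact mul_le_one₀ (min_le_left _ _) b.nonneg b.le_one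
    · have : b x = 0 := by
        by_contra h
        exact hx (hbs x h)
      rw [this, mul_zero, add_zero]
      exact ψ.le_one
  · have h1 : b x = 1 := b.one_of_mem_closedBall (by simpa using hx)
    beta_reduce
    rw [h1]
    linarith [ψ.nonneg (x := x)]
  · rw [fracLap_add_const_mul hψ hb]
    have h1 := (abs_le.1 (hK x)).1
    have h2 := hψL x hx
    nlinarith
  · by_contra h
    push Not at h
    have h1 : ψ x = 0 := by
      by_contra h'
      exact absurd (hψs x h') (not_lt.2 h.2)
    have h2 : b x = 0 := by
      by_contra h'
      exact absurd (hbs x h') (not_lt.2 h.1)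
    exact hx (by simp [h1, h2])

lemma IsTorsionSeq.nonneg_bound {D : Set 𝔼} {M : ℝ} {v : ℕ → 𝔼 → ℝ} (hv : IsTorsionSeq α D M v) :
    0 ≤ M := (hv.nonneg 0 0).trans (hv.le 0 0)

lemma IsTorsionSeq.neg_one_le {D : Set 𝔼} {M : ℝ} {v : ℕ → 𝔼 → ℝ} (hv : IsTorsionSeq α D M v)
    (n : ℕ) (x : 𝔼) : -1 ≤ penal D (fun x _ => -D.indicator (fun _ => (1 : ℝ)) x) n x (v n x) := by
  have h1 : (0 : ℝ) ≤ (Metric.ball (0 : 𝔼) n \ D).indicator (fun _ => (1 : ℝ)) x :=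
    Set.indicator_nonneg (fun _ _ => zero_le_one) x
  have h2 : D.indicator (fun _ => (1 : ℝ)) x ≤ 1 := by
    by_cases hx : x ∈ D <;> simp [hx]
  have h3 := mul_nonneg (mul_nonneg (Nat.cast_nonneg (α := ℝ) n) h1) (hv.nonneg n x)
  simp only [penal]
  linarith

/-- A sequence of functions is locally small at a point. -/
def LocSmall (v : ℕ → 𝔼 → ℝ) (z : 𝔼) : Prop :=
  ∀ ε > 0, ∃ n, ∃ r > 0, ∀ x ∈ Metric.ball z r, v n x ≤ ε

lemma exists_le_of_locSmall {v : ℕ → 𝔼 → ℝ} (hv : ∀ x, Antitone fun n => v n x) {A : Set 𝔼}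
    (hA : IsCompact A) (h : ∀ z ∈ A, LocSmall v z) {ε : ℝ} (hε : 0 < ε) :
    ∃ n, ∀ x ∈ A, v n x ≤ ε := by
  refine hA.induction_on (p := fun B => ∃ n, ∀ x ∈ B, v n x ≤ ε) ⟨0, by simp⟩
    (fun s t hst ⟨n, hn⟩ => ⟨n, fun x hx => hn x (hst hx)⟩) ?_ ?_
  · rintro s t ⟨n, hn⟩ ⟨m, hm⟩
    refine ⟨max n m, fun x hx => ?_⟩
    rcases hx with hx | hx
    · exact (hv x (le_max_left n m)).trans (hn x hx)
    · exact (hv x (le_max_right n m)).trans (hm x hx)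
  · intro z hz
    obtain ⟨n, r, hr, hn⟩ := h z hz ε hε
    exact ⟨Metric.ball z r, mem_nhdsWithin_of_mem_nhds (Metric.ball_mem_nhds z hr), n, hn⟩

lemma IsTorsionSeq.locSmall_of_mem_interior {D : Set 𝔼} {M : ℝ} {v : ℕ → 𝔼 → ℝ}
    (hv : IsTorsionSeq α D M v) {z : 𝔼} (hz : z ∈ interior Dᶜ) : LocSmall v z := by
  intro ε hε
  have hM := hv.nonneg_bound
  obtain ⟨r, hr, hrD⟩ := Metric.isOpen_iff.1 isOpen_interior z hz
  let b : ContDiffBump z := ⟨r / 2, r, by positivity, by linarith⟩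
  have hb := isTest_bump b
  obtain ⟨K, hK0, hK⟩ := hb.abs_fracLap_le (α := α)
  obtain ⟨n, hn⟩ := exists_nat_gt (max (M * K / ε) (‖z‖ + r))
  have hn1 : M * K / ε < n := (le_max_left _ _).trans_lt hn
  have hn2 : ‖z‖ + r < n := (le_max_right _ _).trans_lt hn
  rw [div_lt_iff₀ hε] at hn1
  refine ⟨n, r / 2, by positivity, fun x hx => ?_⟩
  have key : v n x ≤ ε + (M - M * b x) := by
    have hs := (FracSol.const N α ε).add ((FracSol.const N α M).sub
      ((hb.fracSol (α := α)).const_mul M))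
    refine ((hv.sol n).mono (Set.subset_univ _)).le_of_isBounded
      (hs.mono (Set.subset_univ (Metric.ball z r))) Metric.isBounded_ball (fun y hy => ?_)
      (fun y hy hlt => ?_) x
    · have h0 : b y = 0 := b.zero_of_le_dist (by simpa using hy)
      rw [h0]
      linarith [hv.le n y]
    · have hyD : y ∉ D := interior_subset (hrD hy)
      have hyn : y ∈ Metric.ball (0 : 𝔼) n \ D := by
        refine ⟨?_, hyD⟩
        rw [mem_ball_zero_iff]
        have h1 := norm_sub_norm_le y z
        rw [Metric.mem_ball, dist_eq_norm] at hy
        linarith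
      have h1 := (abs_le.1 (hK y)).1
      have h2 : ε ≤ v n y := by
        have : M * b y ≤ M := mul_le_of_le_one_right hM b.le_one
        linarith
      have h3 := mul_le_mul_of_nonneg_left h2 (Nat.cast_nonneg (α := ℝ) n)
      have h4 := mul_le_mul_of_nonneg_left h1 hM
      simp only [penal, Set.indicator_of_mem hyn, Set.indicator_of_notMem hyD, Pi.zero_apply]
      linarith
  have h1 : b x = 1 := b.one_of_mem_closedBall (Metric.ball_subset_closedBall hx)
  rw [h1] at key
  linarith

/-- The exterior cone condition at a boundary point. -/
def ExteriorCone (D : Set 𝔼) (z : 𝔼) : Prop :=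
  ∃ C : Set 𝔼, C.Nonempty ∧ IsOpen C ∧ (∀ y ∈ C, ∀ t : ℝ, 0 < t → z + t • (y - z) ∈ C) ∧
    ∃ r : ℝ, 0 < r ∧ C ∩ Metric.ball z r ⊆ Dᶜ

lemma ExteriorCone.exists_ball {D : Set 𝔼} {z : 𝔼} (hN : 0 < N) (h : ExteriorCone D z) :
    ∃ e : 𝔼, ∃ ρ > 0, ρ ≤ ‖e‖ / 2 ∧ ∃ τ : ℝ, 0 < τ ∧ ∀ t : ℝ, 0 < t → t < τ →
      ∀ y ∈ Metric.closedBall e ρ, z + t • y ∈ interior Dᶜ := by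
  obtain ⟨C, hCne, hCo, hC, r, hr, hCD⟩ := h
  have := nontrivial_of_pos hN
  obtain ⟨a, haC, haz⟩ : ∃ a ∈ C, a ≠ z := by
    obtain ⟨a, ha⟩ := hCne
    by_cases h : a = z
    · obtain ⟨a', ha', hne⟩ := (Filter.nonempty_of_mem (inter_mem_nhdsWithin ({a}ᶜ)
        (hCo.mem_nhds ha)) : _)
      exact ⟨a', hne, h ▸ ha'⟩
    · exact ⟨a, ha, h⟩
  obtain ⟨ρ', hρ', hρC⟩ := Metric.isOpen_iff.1 hCo a haC
  have hd : 0 < ‖a - z‖ := norm_pos_iff.2 (sub_ne_zero.2 haz)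
  refine ⟨a - z, min (ρ' / 2) (‖a - z‖ / 2), by positivity, min_le_right _ _,
    r / (2 * ‖a - z‖), by positivity, fun t ht htr y hy => ?_⟩
  rw [lt_div_iff₀ (by positivity)] at htr
  have hsub : C ∩ Metric.ball z r ⊆ interior Dᶜ :=
    interior_maximal hCD (hCo.inter Metric.isOpen_ball)
  rw [Metric.mem_closedBall, dist_eq_norm] at hy
  have hy1 := hy.trans (min_le_left _ _)
  have hy2 := hy.trans (min_le_right _ _)
  refine hsub ⟨?_, ?_⟩
  · have h1 : z + y ∈ C := hρC (by
      rw [Metric.mem_ball, dist_eq_norm, show z + y - a = y - (a - z) by abel]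
      linarith)
    simpa using hC _ h1 t ht
  · rw [Metric.mem_ball, dist_eq_norm, add_sub_cancel_left, norm_smul, Real.norm_of_nonneg ht.le]
    have h1 := norm_sub_norm_le y (a - z)
    nlinarith

lemma IsTorsionSeq.locSmall_step {D : Set 𝔼} {M : ℝ} {v : ℕ → 𝔼 → ℝ}
    (hv : IsTorsionSeq α D M v) {z e : 𝔼} {ρ τ : ℝ} (hτ : 0 < τ)
    (hcone : ∀ t, 0 < t → t < τ → ∀ y ∈ Metric.closedBall e ρ,
      z + t • y ∈ interior Dᶜ) {P : 𝔼 → ℝ} {κ c : ℝ} (hP : IsTest P) (he : 0 < ‖e‖)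
    (hc : 0 < c) (hP1 : ∀ x, P x ≤ 1)
    (hPκ : ∀ x, ‖x‖ ≤ ‖e‖ / 8 → κ ≤ P x)
    (hPc : ∀ x, ‖x‖ < ‖e‖ / 4 → c ≤ fracLap N α P x)
    (hPs : ∀ x, P x ≠ 0 → ‖x‖ < ‖e‖ / 4 ∨ ‖x - e‖ < ρ) {m δ : ℝ} (hm : 0 < m) (hδ : 0 < δ)
    (hmv : ∃ n, ∃ r > 0, ∀ x ∈ Metric.ball z r, v n x ≤ m) :
    ∃ n, ∃ r > 0, ∀ x ∈ Metric.ball z r, v n x ≤ δ + m * (1 - κ) := by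
  obtain ⟨n₀, r, hr, hn₀⟩ := hmv
  have hM := hv.nonneg_bound
  have hα := StableParams.pos N (α := α)
  let B : ContDiffBump (0 : 𝔼) := ⟨1, 2, one_pos, one_lt_two⟩
  have hB := isTest_bump B
  obtain ⟨L, hL0, hL⟩ := hB.abs_fracLap_le (α := α)
  obtain ⟨K, hK1, hK2⟩ : ∃ K, ‖e‖ < K ∧ M * L * K ^ (-α) < m * c / 2 := by
    have h1 := (tendsto_rpow_neg_atTop hα).const_mul (M * L)
    rw [mul_zero] at h1
    exact ((eventually_gt_atTop ‖e‖).and (h1.eventually_lt_const (by positivity))).exists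
  have hK0 : 0 < K := he.trans hK1
  obtain ⟨t, ht0, ht1, ht2, ht3⟩ : ∃ t, 0 < t ∧ t < τ ∧ 2 * K * t < r ∧
      1 ≤ t ^ (-α) * (m * c / 2) := by
    have h1 : ∀ᶠ s : ℝ in atTop, 1 ≤ s ^ α * (m * c / 2) :=
      ((tendsto_rpow_atTop hα).atTop_mul_const (by positivity)).eventually_ge_atTop 1
    obtain ⟨s, hs1, hs2, hs3, hs4⟩ := (h1.and ((eventually_gt_atTop (1 / τ)).and
      ((eventually_gt_atTop (2 * K / r)).and (eventually_gt_atTop 0)))).exists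
    refine ⟨s⁻¹, inv_pos.2 hs4, ?_, ?_, ?_⟩
    · rw [div_lt_iff₀ hτ] at hs2
      rw [inv_lt_iff_one_lt_mul₀ hs4]
      linarith
    · rw [div_lt_iff₀ hr] at hs3
      rw [← div_eq_mul_inv, div_lt_iff₀ hs4]
      linarith
    · rwa [Real.inv_rpow hs4.le, ← Real.rpow_neg hs4.le, neg_neg]
  obtain ⟨n₁, hn₁⟩ : ∃ n, ∀ x ∈ (fun y => z + t • y) '' Metric.closedBall e ρ, v n x ≤ δ := by
    refine exists_le_of_locSmall hv.anti ((isCompact_closedBall e ρ).image (by fun_prop)) ?_ hδ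
    rintro x ⟨y, hy, rfl⟩
    exact hv.locSmall_of_mem_interior (hcone t ht0 ht1 y hy)
  set n := max n₀ n₁ with hn
  have hKt : 0 < K * t := by positivity
  refine ⟨n, t * ‖e‖ / 8, by positivity, fun x hx => ?_⟩
  have hnorm : ∀ y : 𝔼, ‖t⁻¹ • (y - z)‖ = ‖y - z‖ / t := fun y => by
    rw [norm_smul, norm_inv, Real.norm_of_nonneg ht0.le, div_eq_inv_mul]
  have key : v n x ≤ δ + ((m - m * P (t⁻¹ • (x - z))) +
      (M - M * B ((K * t)⁻¹ • (x - z)))) := by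
    have hs := (FracSol.const N α δ).add (((FracSol.const N α m).sub
      (((hP.comp_scale z ht0).fracSol (α := α)).const_mul m)).add ((FracSol.const N α M).sub
      (((hB.comp_scale z hKt).fracSol (α := α)).const_mul M)))
    refine ((hv.sol n).mono (Set.subset_univ _)).le_of_isBounded
      (hs.mono (Set.subset_univ (Metric.ball z (t * ‖e‖ / 4)))) Metric.isBounded_ball
      (fun y hy => ?_) (fun y hy _ => ?_) x
    · have hBM : M * B ((K * t)⁻¹ • (y - z)) ≤ M := mul_le_of_le_one_right hM B.le_one
      have hPm : m * P (t⁻¹ • (y - z)) ≤ m := mul_le_of_le_one_right hm.le (hP1 _)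
      by_cases h1 : 2 * (K * t) ≤ ‖y - z‖
      · have h0 : B ((K * t)⁻¹ • (y - z)) = 0 := by
          refine B.zero_of_le_dist ?_
          rw [dist_zero_right, norm_smul, norm_inv, Real.norm_of_nonneg hKt.le,
            ← div_eq_inv_mul, le_div_iff₀ hKt]
          exact h1
        rw [h0]
        linarith [hv.le n y]
      · by_cases h2 : P (t⁻¹ • (y - z)) = 0
        · have h3 : v n y ≤ m := (hv.anti y (le_max_left n₀ n₁)).trans (hn₀ y (by
            rw [Metric.mem_ball, dist_eq_norm]
            linarith))
          rw [h2]
          linarith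
        · rcases hPs _ h2 with h3 | h3
          · refine absurd ?_ hy
            rw [hnorm, div_lt_iff₀ ht0] at h3
            rw [Metric.mem_ball, dist_eq_norm]
            linarith
          · have h4 : v n y ≤ δ := (hv.anti y (le_max_right n₀ n₁)).trans (hn₁ y
              ⟨t⁻¹ • (y - z), by
                rw [Metric.mem_closedBall, dist_eq_norm]
                exact h3.le, by simp [smul_inv_smul₀ ht0.ne']⟩)
            linarith
    · have h1 : ‖t⁻¹ • (y - z)‖ < ‖e‖ / 4 := by
        rw [Metric.mem_ball, dist_eq_norm] at hy
        rw [hnorm, div_lt_iff₀ ht0]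
        linarith
      have h2 := hPc _ h1
      have h3 := (abs_le.1 (hL ((K * t)⁻¹ • (y - z)))).1
      have h4 := hv.neg_one_le n y
      simp only [Pi.zero_apply, fracLap_scale P z ht0, fracLap_scale _ z hKt]
      rw [Real.mul_rpow hK0.le ht0.le]
      set T := t ^ (-α) with hT
      have hT0 : 0 < T := by positivity
      have h5 := mul_le_mul_of_nonneg_left h2 (by positivity : 0 ≤ m * T)
      have hKα : 0 < K ^ (-α) := by positivity
      have h6 := mul_le_mul_of_nonneg_left h3 (by positivity : 0 ≤ M * (K ^ (-α) * T))
      have h7 := mul_lt_mul_of_pos_left hK2 hT0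
      linarith
  have hx' : ‖x - z‖ < t * ‖e‖ / 8 := by rwa [Metric.mem_ball, dist_eq_norm] at hx
  have h1 := hPκ (t⁻¹ • (x - z)) (by
    rw [hnorm, div_le_iff₀ ht0]
    linarith)
  have h2 : B ((K * t)⁻¹ • (x - z)) = 1 := by
    refine B.one_of_mem_closedBall ?_
    rw [mem_closedBall_zero_iff, norm_smul, norm_inv, Real.norm_of_nonneg hKt.le,
      ← div_eq_inv_mul]
    change _ ≤ (1 : ℝ)
    rw [div_le_one hKt]
    nlinarith
  rw [h2] at key
  nlinarith

lemma IsTorsionSeq.locSmall_of_cone {D : Set 𝔼} {M : ℝ} {v : ℕ → 𝔼 → ℝ}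
    (hv : IsTorsionSeq α D M v) {z : 𝔼} (hz : ExteriorCone D z) : LocSmall v z := by
  obtain ⟨e, ρ, hρ, hρe, τ, hτ, hcone⟩ := hz.exists_ball (StableParams.dim_pos N α)
  obtain ⟨P, κ, c, hP, hκ, hc, -, hP1, hPκ, hPc, hPs⟩ := exists_profile (α := α) hρ hρe
  have he : 0 < ‖e‖ := by linarith
  have hM := hv.nonneg_bound
  set 𝓛 : Set ℝ := {m | 0 < m ∧ ∃ n, ∃ r > 0, ∀ x ∈ Metric.ball z r, v n x ≤ m} with h𝓛
  have hne : 𝓛.Nonempty := ⟨M + 1, by positivity, 0, 1, one_pos, fun x _ => by linarith [hv.le 0 x]⟩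
  have hbd : BddBelow 𝓛 := ⟨0, fun m hm => hm.1.le⟩
  have hκ1 : κ ≤ 1 := (hPκ 0 (by rw [norm_zero]; positivity)).trans (hP1 0)
  have hstep : ∀ m ∈ 𝓛, ∀ δ > 0, sInf 𝓛 ≤ δ + m * (1 - κ) := fun m hm δ hδ =>
    csInf_le hbd ⟨by have := mul_nonneg hm.1.le (sub_nonneg.2 hκ1); linarith,
      hv.locSmall_step hτ hcone hP he hc hP1 hPκ hPc hPs hm.1 hδ hm.2⟩
  have hL0 : sInf 𝓛 ≤ 0 := by
    by_contra! hcon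
    obtain ⟨m, hm, hm'⟩ := exists_lt_of_csInf_lt hne
      (show sInf 𝓛 < sInf 𝓛 + κ * sInf 𝓛 / 4 by linarith [mul_pos hκ hcon])
    have h1 := hstep m hm (κ * sInf 𝓛 / 4) (by positivity)
    have h2 := mul_le_mul_of_nonneg_right hm'.le (sub_nonneg.2 hκ1)
    nlinarith [mul_pos hκ hcon, mul_pos hκ (mul_pos hκ hcon)]
  intro ε hε
  obtain ⟨m, hm, hm'⟩ := exists_lt_of_csInf_lt hne (hL0.trans_lt hε)
  obtain ⟨n, r, hr, h⟩ := hm.2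
  exact ⟨n, r, hr, fun x hx => (h x hx).trans hm'.le⟩

/-- The penalised torsion functions become uniformly small off a domain satisfying the exterior
cone condition. -/
theorem IsTorsionSeq.exists_le {D : Set 𝔼} {M : ℝ} {v : ℕ → 𝔼 → ℝ} (hv : IsTorsionSeq α D M v)
    (hDo : IsOpen D) (hcone : ∀ z ∈ frontier D, ExteriorCone D z) {ε : ℝ} (hε : 0 < ε) :
    ∃ n, ∀ x ∉ D, v n x ≤ ε := by
  have hb := isBounded_of_tendsto_cocompact (hv.tendsto 0) hε
  obtain ⟨R, hR⟩ := hb.subset_closedBall (0 : 𝔼)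
  have hloc : ∀ z ∈ Metric.closedBall (0 : 𝔼) R ∩ Dᶜ, LocSmall v z := fun z hz => by
    by_cases hzc : z ∈ closure D
    · exact hv.locSmall_of_cone (hcone z (by
        rw [hDo.frontier_eq]
        exact ⟨hzc, hz.2⟩))
    · exact hv.locSmall_of_mem_interior (by rwa [interior_compl])
  obtain ⟨n, hn⟩ := exists_le_of_locSmall hv.anti
    ((isCompact_closedBall (0 : 𝔼) R).inter_right hDo.isClosed_compl) hloc hε
  refine ⟨n, fun x hx => ?_⟩
  by_cases hxR : x ∈ Metric.closedBall (0 : 𝔼) R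
  · exact hn x ⟨hxR, hx⟩
  · by_contra! hcon
    exact hxR (hR (hcon.le.trans (hv.anti x (Nat.zero_le n))))

lemma exists_tendstoUniformly_of_cauchy {X : Type*} {w : ℕ → X → ℝ}
    (h : ∀ ε > 0, ∃ n₀, ∀ m ≥ n₀, ∀ n ≥ n₀, ∀ x, w n x ≤ w m x + ε) :
    ∃ v : X → ℝ, TendstoUniformly w v atTop := by
  have hd : ∀ ε > 0, ∃ n₀, ∀ m ≥ n₀, ∀ n ≥ n₀, ∀ x, dist (w m x) (w n x) < ε := by
    intro ε hε
    obtain ⟨n₀, h₀⟩ := h (ε / 2) (by positivity)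
    refine ⟨n₀, fun m hm n hn x => ?_⟩
    rw [Real.dist_eq, abs_sub_lt_iff]
    have h1 := h₀ m hm n hn x
    have h2 := h₀ n hn m hm x
    constructor <;> linarith
  have hc : ∀ x, CauchySeq fun n => w n x := fun x => by
    rw [Metric.cauchySeq_iff]
    intro ε hε
    obtain ⟨n₀, h₀⟩ := hd ε hε
    exact ⟨n₀, fun m hm n hn => h₀ m hm n hn x⟩
  choose v hv using fun x => cauchySeq_tendsto_of_complete (hc x)
  refine ⟨v, ?_⟩
  rw [← tendstoUniformlyOn_univ]
  refine UniformCauchySeqOn.tendstoUniformlyOn_of_tendsto ?_ fun x _ => hv x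
  rw [Metric.uniformCauchySeqOn_iff]
  intro ε hε
  obtain ⟨n₀, h₀⟩ := hd ε hε
  exact ⟨n₀, fun m hm n hn x _ => h₀ m hm n hn x⟩

variable (α) in
/-- A bounded domain is Dirichlet regular if its penalised torsion functions vanish off it. -/
structure IsRegularDomain (D : Set 𝔼) : Prop where
  isOpen : IsOpen D
  isBounded : Bornology.IsBounded D
  exists_torsion : ∃ M v, IsTorsionSeq α D M v ∧ ∀ ε > 0, ∃ n, ∀ x ∉ D, v n x ≤ ε

variable (α) in
lemma isRegularDomain_of_cone {D : Set 𝔼} (hDo : IsOpen D) (hDb : Bornology.IsBounded D)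
    (hcone : ∀ z ∈ frontier D, ExteriorCone D z) : IsRegularDomain α D := by
  obtain ⟨M, v, hv⟩ := exists_isTorsionSeq α hDo.measurableSet hDb
  exact ⟨hDo, hDb, M, v, hv, fun ε hε => hv.exists_le hDo hcone hε⟩

lemma IsTorsionSeq.abs_le_of_penal {D : Set 𝔼} {M H : ℝ} {v : ℕ → 𝔼 → ℝ}
    (hv : IsTorsionSeq α D M v) {h : 𝔼 → ℝ → ℝ} (hD : ∀ x ∉ D, ∀ s, h x s = 0)
    (hH : ∀ x s, |h x s| ≤ H) {n : ℕ} {w : 𝔼 → ℝ}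
    (hw : FracSol N α Set.univ w fun x => penal D h n x (w x))
    (lw : Tendsto w (cocompact 𝔼) (𝓝 0)) (x : 𝔼) : |w x| ≤ H * v n x := by
  have hs := (hv.sol n).const_mul H
  have ls : Tendsto (fun x => H * v n x) (cocompact 𝔼) (𝓝 0) := by
    simpa using (hv.tendsto n).const_mul H
  have hI : ∀ x, (0 : ℝ) ≤ n * (Metric.ball (0 : 𝔼) n \ D).indicator (fun _ => (1 : ℝ)) x :=
    fun x => mul_nonneg (Nat.cast_nonneg _) (Set.indicator_nonneg (fun _ _ => zero_le_one) x)
  have hh : ∀ x s, |h x s| ≤ H * D.indicator (fun _ => (1 : ℝ)) x := fun x s => by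
    by_cases hx : x ∈ D
    · simpa [hx] using hH x s
    · simp [hx, hD x hx]
  rw [abs_le]
  constructor
  · have hn : Tendsto (fun x => -(H * v n x)) (cocompact 𝔼) (𝓝 0) := by simpa using ls.neg
    refine hs.neg.le_of_tendsto hw hn lw (fun y hy => ?_) x
    have h1 := (abs_le.1 (hh y (w y))).2
    have h2 := mul_le_mul_of_nonneg_left hy.le (hI y)
    simp only [penal] at h2 ⊢
    linarith
  · refine hw.le_of_tendsto hs lw ls (fun y hy => ?_) x
    have h1 := (abs_le.1 (hh y (w y))).1
    have h2 := mul_le_mul_of_nonneg_left hy.le (hI y)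
    simp only [penal] at h2 ⊢
    linarith

/-- The Dirichlet problem with vanishing exterior data and a bounded monotone Lipschitz
nonlinearity. -/
theorem IsRegularDomain.exists_dirichlet {D : Set 𝔼} (hD : IsRegularDomain α D) {Λ R H : ℝ}
    {h : 𝔼 → ℝ → ℝ} (hh : IsNonlin Λ R h) (hhD : ∀ x ∉ D, ∀ s, h x s = 0)
    (hH : ∀ x s, |h x s| ≤ H) :
    ∃ v, (∀ x ∉ D, v x = 0) ∧ FracSol N α D v fun x => h x (v x) := by
  obtain ⟨M, τ, hτ, hsmall⟩ := hD.exists_torsion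
  have hH0 : 0 ≤ H := (abs_nonneg _).trans (hH 0 0)
  have hDm := hD.isOpen.measurableSet
  choose w lw hw using fun n => (hh.penal hDm n).exists_fracSol (α := α)
  have hwτ : ∀ n x, |w n x| ≤ H * τ n x := fun n x =>
    hτ.abs_le_of_penal hhD hH (hw n) (lw n) x
  have hoff : ∀ ε > 0, ∃ n₀, ∀ n ≥ n₀, ∀ x ∉ D, |w n x| ≤ ε := by
    intro ε hε
    obtain ⟨n₀, h₀⟩ := hsmall (ε / (H + 1)) (by positivity)
    refine ⟨n₀, fun n hn x hx => (hwτ n x).trans ?_⟩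
    have h1 := (hτ.anti x hn).trans (h₀ x hx)
    rw [le_div_iff₀ (by positivity)] at h1
    nlinarith [hτ.nonneg n x]
  have hwD : ∀ n, FracSol N α D (w n) fun x => penal D h n x (w n x) := fun n =>
    (hw n).mono (Set.subset_univ _)
  obtain ⟨v, hv⟩ := exists_tendstoUniformly_of_cauchy (w := w) (by
    intro ε hε
    obtain ⟨n₀, h₀⟩ := hoff (ε / 2) (by positivity)
    refine ⟨n₀, fun m hm n hn x => ?_⟩
    refine (hwD n).le_of_isBounded ((hwD m).add ((FracSol.const N α ε).mono (Set.subset_univ _)))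
      hD.isBounded (fun y hy => ?_) (fun y hy hlt => ?_) x
    · have h1 := abs_le.1 (h₀ m hm y hy)
      have h2 := abs_le.1 (h₀ n hn y hy)
      linarith
    · simp only [penal_of_mem _ _ hy, Pi.zero_apply, add_zero]
      exact hh.mono y (by linarith))
  have hvc : Continuous v := hv.continuous (Frequently.of_forall fun n => (hw n).cont)
  have hpt : ∀ x, Tendsto (fun n => w n x) atTop (𝓝 (v x)) := fun x => hv.tendsto_at x
  have hvb : ∀ x, |v x| ≤ H * M := fun x =>
    le_of_tendsto (hpt x).abs (Eventually.of_forall fun n =>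
      (hwτ n x).trans (mul_le_mul_of_nonneg_left (hτ.le n x) hH0))
  refine ⟨v, fun x hx => ?_, hvc, ⟨_, hvb⟩, hh.meas v hvc, ⟨H, fun x => hH x _⟩, ?_⟩
  · refine abs_nonpos_iff.1 (le_of_forall_pos_le_add fun ε hε => ?_)
    obtain ⟨n₀, h₀⟩ := hoff ε hε
    rw [zero_add]
    exact le_of_tendsto (hpt x).abs ((eventually_ge_atTop n₀).mono fun n hn => h₀ n hn x hx)
  · refine FracEq.of_tendstoUniformly hwD hv (fun x hx => ?_) (K := H) fun n x hx => ?_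
    · simp only [penal_of_mem _ _ hx]
      have hlip : Continuous (h x) := (LipschitzWith.of_dist_le_mul (K := ⟨Λ, hh.lip_nonneg⟩)
        fun s t => hh.lip x s t).continuous
      exact (hlip.tendsto _).comp (hpt x)
    · rw [penal_of_mem _ _ hx]
      exact hH x _

/-- Bounded monotone uniformly continuous functions are uniform limits of Lipschitz ones. -/
lemma exists_monotone_lipschitz_approx {φ : ℝ → ℝ} {B : ℝ} (hm : Monotone φ)
    (hu : UniformContinuous φ) (h0 : ∀ t, 0 ≤ φ t) (hB : ∀ t, φ t ≤ B) {ε : ℝ} (hε : 0 < ε) :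
    ∃ K, ∃ ψ : ℝ → ℝ, Monotone ψ ∧ (∀ s t, |ψ s - ψ t| ≤ K * |s - t|) ∧ (∀ t, 0 ≤ ψ t) ∧
      (∀ t, ψ t ≤ B) ∧ ∀ t, |ψ t - φ t| ≤ ε := by
  obtain ⟨δ, hδ, hd⟩ := Metric.uniformContinuous_iff.1 hu ε hε
  have hB0 : 0 ≤ B := (h0 0).trans (hB 0)
  set K := B / δ with hK
  have hK0 : 0 ≤ K := by positivity
  have hpos : ∀ t s, 0 ≤ φ s + K * |t - s| := fun t s => by have := h0 s; positivity
  have hbb : ∀ t, BddBelow (Set.range fun s => φ s + K * |t - s|) := fun t =>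
    ⟨0, by rintro _ ⟨s, rfl⟩; exact hpos t s⟩
  have hle : ∀ t s, ⨅ s, φ s + K * |t - s| ≤ φ s + K * |t - s| := fun t s => ciInf_le (hbb t) s
  have hleφ : ∀ t, ⨅ s, φ s + K * |t - s| ≤ φ t := fun t => by simpa using hle t t
  have hlip : ∀ t t', ⨅ s, φ s + K * |t - s| ≤ (⨅ s, φ s + K * |t' - s|) + K * |t - t'| := by
    intro t t'
    rw [← sub_le_iff_le_add]
    refine le_ciInf fun s => ?_
    have h1 := hle t s
    have h2 := mul_le_mul_of_nonneg_left (abs_sub_le t t' s) hK0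
    linarith
  refine ⟨K, fun t => ⨅ s, φ s + K * |t - s|, fun t t' htt => le_ciInf fun s => ?_,
    fun s t => ?_, fun t => le_ciInf (hpos t), fun t => (hleφ t).trans (hB t), fun t => ?_⟩
  · refine (hle t (s - (t' - t))).trans (add_le_add (hm (by linarith)) (le_of_eq ?_))
    congr 2
    ring
  · have h1 := hlip s t
    have h2 := hlip t s
    rw [abs_sub_comm t s] at h2
    rw [abs_le]
    constructor <;> linarith
  · have h2 : φ t - ε ≤ ⨅ s, φ s + K * |t - s| := by
      refine le_ciInf fun s => ?_
      rcases lt_or_ge |t - s| δ with h | h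
      · have h3 := (abs_lt.1 (hd (a := t) (b := s) h)).2
        have h4 : 0 ≤ K * |t - s| := by positivity
        linarith
      · have h3 : B ≤ K * |t - s| := by
          rw [hK, div_mul_eq_mul_div, le_div_iff₀ hδ]
          exact mul_le_mul_of_nonneg_left h hB0
        linarith [hB t, h0 s]
    rw [abs_le]
    constructor <;> linarith [hleφ t]

/-- Bounded smooth functions solve an equation with bounded right-hand side on bounded sets. -/
lemma exists_fracSol_of_contDiff {D : Set 𝔼} (hDm : MeasurableSet D) (hDb : Bornology.IsBounded D)
    {G : 𝔼 → ℝ} (hG : ContDiff ℝ (⊤ : ℕ∞) G) {M : ℝ} (hM : ∀ x, |G x| ≤ M) :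
    ∃ g, FracSol N α D G g := by
  obtain ⟨R, hR0, hR⟩ := hDb.subset_ball_lt 0 0
  let χ : ContDiffBump (0 : 𝔼) := ⟨R + 1, R + 2, by linarith, by linarith⟩
  have hχ : IsTest fun x => χ x * G x := ⟨χ.contDiff.mul hG, χ.hasCompactSupport.mul_right⟩
  set W : 𝔼 → ℝ := fun x => (1 - χ x) * G x with hW
  have hM0 : 0 ≤ M := (abs_nonneg _).trans (hM 0)
  have hWM : ∀ x, |W x| ≤ M := fun x => by
    rw [hW, abs_mul, abs_of_nonneg (sub_nonneg.2 χ.le_one)]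
    calc _ ≤ 1 * M := mul_le_mul (by linarith [χ.nonneg (x := x)]) (hM x) (abs_nonneg _) zero_le_one
      _ = M := one_mul M
  have hW0 : ∀ x : 𝔼, ‖x‖ ≤ R + 1 → W x = 0 := fun x hx => by
    have : χ x = 1 := χ.one_of_mem_closedBall (by simpa using hx)
    simp [hW, this]
  have hWc : Continuous W := (continuous_const.sub χ.continuous).mul hG.continuous
  have hsec : ∀ x ∈ D, SecBound W (4 * M) x := by
    intro x hx z
    have hxR : ‖x‖ < R := by simpa using hR hx
    rcases le_total ‖z‖ 1 with hz | hz
    · have h1 := hW0 (x + z) ((norm_add_le _ _).trans (by linarith))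
      have h2 := hW0 (x - z) ((norm_sub_le _ _).trans (by linarith))
      have h3 := hW0 x (by linarith)
      simp only [secDiff, h1, h2, h3]
      norm_num
      positivity
    · rw [min_eq_left (by nlinarith), mul_one]
      exact secDiff_bound_of_abs_le hWM x z
  have hWs : FracSol N α D W (D.indicator (fracLap N α W)) := by
    refine .of_secBound hWc ⟨M, hWM⟩ hsec ((measurable_fracLap hWc.measurable).indicator hDm)
      ⟨fracLapCoeff N α / 2 * (4 * M * ∫ z, levyWeight N α z), fun x => ?_⟩
      fun x hx => Set.indicator_of_mem hx _
    by_cases hx : x ∈ D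
    · rw [Set.indicator_of_mem hx]
      exact (hsec x hx).abs_fracLap_le
    · rw [Set.indicator_of_notMem hx, abs_zero]
      have h1 := fracLapCoeff_pos N α
      have h2 : 0 ≤ ∫ z, levyWeight N α z := integral_nonneg levyWeight_nonneg
      positivity
  have hsum : (fun x => χ x * G x + W x) = G := by
    ext x
    rw [hW]
    ring
  exact ⟨_, hsum ▸ ((hχ.fracSol (α := α)).mono (Set.subset_univ D)).add hWs⟩

/-- The nonlinear Dirichlet problem with smooth data and a Lipschitz nonlinearity. -/
lemma IsRegularDomain.exists_fracSol_of_lipschitz {D : Set 𝔼} (hD : IsRegularDomain α D)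
    {ρ : 𝔼 → ℝ} (hρ : Measurable ρ) (hρ0 : ∀ x, 0 ≤ ρ x) {P : ℝ} (hP : ∀ x ∈ D, ρ x ≤ P)
    {G : 𝔼 → ℝ} (hG : ContDiff ℝ (⊤ : ℕ∞) G) {M : ℝ} (hM : ∀ x, |G x| ≤ M)
    {K B : ℝ} {ψ : ℝ → ℝ} (hψm : Monotone ψ) (hψl : ∀ s t, |ψ s - ψ t| ≤ K * |s - t|)
    (hψ0 : ∀ t, 0 ≤ ψ t) (hψB : ∀ t, ψ t ≤ B) :
    ∃ u, (∀ x ∉ D, u x = G x) ∧ FracSol N α D u (D.indicator fun x => ρ x * ψ (u x)) := by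
  have hDm := hD.isOpen.measurableSet
  obtain ⟨g, hg⟩ := exists_fracSol_of_contDiff (α := α) hDm hD.isBounded hG hM
  obtain ⟨L, hL⟩ := hg.rhs_bdd
  obtain ⟨R, hR⟩ := hD.isBounded.subset_ball 0
  have hK0 : 0 ≤ K := by simpa using (abs_nonneg _).trans (hψl 0 1)
  have hψc : Continuous ψ := (LipschitzWith.of_dist_le_mul (K := ⟨K, hK0⟩)
    fun s t => hψl s t).continuous
  have hB0 : 0 ≤ B := (hψ0 0).trans (hψB 0)
  have hP0 : 0 ≤ |P| := abs_nonneg P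
  have hP' : ∀ x ∈ D, ρ x ≤ |P| := fun x hx => (hP x hx).trans (le_abs_self P)
  have hL0 : 0 ≤ L := (abs_nonneg _).trans (hL 0)
  have hρψ : ∀ x ∈ D, ∀ s, |ρ x * ψ s| ≤ |P| * B := fun x hx s => by
    rw [abs_of_nonneg (mul_nonneg (hρ0 x) (hψ0 s))]
    exact mul_le_mul (hP' x hx) (hψB s) (hψ0 s) hP0
  set h : 𝔼 → ℝ → ℝ := fun x s => D.indicator (fun x => ρ x * ψ (G x + s) - g x) x with hh
  have hin : ∀ x ∈ D, ∀ s, h x s = ρ x * ψ (G x + s) - g x := fun x hx s =>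
    Set.indicator_of_mem hx _
  have hout : ∀ x ∉ D, ∀ s, h x s = 0 := fun x hx s => Set.indicator_of_notMem hx _
  have hbd : ∀ x s, |h x s| ≤ |P| * B + L := fun x s => by
    by_cases hx : x ∈ D
    · rw [hin x hx]
      exact (abs_sub _ _).trans (add_le_add (hρψ x hx _) (hL x))
    · rw [hout x hx, abs_zero]
      positivity
  have hnl : IsNonlin (|P| * K) R h := by
    refine ⟨fun v hv => ?_, fun x s t hst => ?_, fun x s t => ?_, fun x s hx => ?_,
      ⟨_, fun x => hbd x 0⟩⟩
    · have h1 : Measurable fun x => ρ x * ψ (G x + v x) - g x :=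
        (hρ.mul (hψc.comp (hG.continuous.add hv)).measurable).sub hg.meas
      exact h1.indicator hDm
    · by_cases hx : x ∈ D
      · rw [hin x hx, hin x hx]
        have := mul_le_mul_of_nonneg_left (hψm (add_le_add_right hst (G x))) (hρ0 x)
        linarith
      · rw [hout x hx, hout x hx]
    · by_cases hx : x ∈ D
      · rw [hin x hx, hin x hx]
        have h1 := hψl (G x + s) (G x + t)
        rw [add_sub_add_left_eq_sub] at h1
        rw [sub_sub_sub_cancel_right, ← mul_sub, abs_mul, abs_of_nonneg (hρ0 x), mul_assoc]
        exact mul_le_mul (hP' x hx) h1 (abs_nonneg _) hP0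
      · rw [hout x hx, hout x hx, sub_zero, abs_zero]
        positivity
    · refine hout x (fun hxD => ?_) s
      have := hR hxD
      rw [mem_ball_zero_iff] at this
      linarith
  obtain ⟨v, hv0, hv⟩ := hD.exists_dirichlet hnl hout hbd
  refine ⟨fun x => G x + v x, fun x hx => by simp [hv0 x hx], (hg.add hv).congr_rhs ?_
    ⟨|P| * B, fun x => ?_⟩ fun x hx => ?_⟩
  · exact (hρ.mul (hψc.comp (hG.continuous.add hv.cont)).measurable).indicator hDm
  · by_cases hx : x ∈ D
    · rw [Set.indicator_of_mem hx]
      exact hρψ x hx _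
    · rw [Set.indicator_of_notMem hx, abs_zero]
      positivity
  · rw [hin x hx, Set.indicator_of_mem hx]
    ring

lemma IsRegularDomain.exists_torsion_function {D : Set 𝔼} (hD : IsRegularDomain α D) :
    ∃ T, (∀ x, 0 ≤ T x) ∧ FracSol N α D T (D.indicator fun _ => -1) := by
  have hDm := hD.isOpen.measurableSet
  obtain ⟨R, hR⟩ := hD.isBounded.subset_ball 0
  have hb : ∀ x, |D.indicator (fun _ => (-1 : ℝ)) x| ≤ 1 := fun x => by
    by_cases hx : x ∈ D
    · simp [hx]
    · simp [hx]
  have hnl : IsNonlin 0 R fun (x : 𝔼) (_ : ℝ) => D.indicator (fun _ => (-1 : ℝ)) x := by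
    refine ⟨fun v hv => measurable_const.indicator hDm, fun x => monotone_const, fun x s t => ?_,
      fun x s hx => Set.indicator_of_notMem (fun hxD => ?_) _, ⟨1, hb⟩⟩
    · simp
    · have := hR hxD
      rw [mem_ball_zero_iff] at this
      linarith
  obtain ⟨T, hT0, hT⟩ := hD.exists_dirichlet hnl
    (fun x hx s => Set.indicator_of_notMem hx _) (fun x _ => hb x)
  refine ⟨T, fun x => ?_, hT⟩
  refine ((FracSol.const N α 0).mono (Set.subset_univ D)).le_of_isBounded hT hD.isBounded
    (fun y hy => (hT0 y hy).ge) (fun y hy _ => ?_) x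
  rw [Set.indicator_of_mem hy]
  simp

/-- The nonlinear Dirichlet problem with a bounded monotone nonlinearity. -/
theorem IsRegularDomain.exists_fracSol {D : Set 𝔼} (hD : IsRegularDomain α D)
    {ρ : 𝔼 → ℝ} (hρ : Measurable ρ) (hρ0 : ∀ x, 0 ≤ ρ x) {P : ℝ} (hP : ∀ x ∈ D, ρ x ≤ P)
    {F : 𝔼 → ℝ} (hF : Continuous F) {M : ℝ} (hM : ∀ x, |F x| ≤ M)
    {B : ℝ} {φ : ℝ → ℝ} (hφm : Monotone φ) (hφu : UniformContinuous φ)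
    (hφ0 : ∀ t, 0 ≤ φ t) (hφB : ∀ t, φ t ≤ B) :
    ∃ u, (∀ x ∉ D, u x = F x) ∧ FracSol N α D u (D.indicator fun x => ρ x * φ (u x)) := by
  have hDm := hD.isOpen.measurableSet
  have hB0 : 0 ≤ B := (hφ0 0).trans (hφB 0)
  have hP0 : 0 ≤ |P| := abs_nonneg P
  have hP' : ∀ x ∈ D, ρ x ≤ |P| := fun x hx => (hP x hx).trans (le_abs_self P)
  obtain ⟨T, hT0, hT⟩ := hD.exists_torsion_function
  obtain ⟨τ, hτ⟩ := hT.bdd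
  set e : ℕ → ℝ := fun n => 1 / ((n : ℝ) + 1) with he
  have he0 : ∀ n, 0 < e n := fun n => Nat.one_div_pos_of_nat
  have helim : Tendsto e atTop (𝓝 0) := tendsto_one_div_add_atTop_nhds_zero_nat
  choose K ψ hψm hψl hψ0 hψB hψφ using fun n =>
    exists_monotone_lipschitz_approx hφm hφu hφ0 hφB (he0 n)
  choose G hGs hGF using fun n =>
    hF.exists_contDiff_approx ⊤ (continuous_const (y := e n)) fun _ => he0 n
  have hGF' : ∀ n x, |G n x - F x| ≤ e n := fun n x => ((hGF n).1 x).le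
  have hGM : ∀ n x, |G n x| ≤ M + e n := fun n x => by
    have h1 := abs_le.1 (hGF' n x)
    have h2 := abs_le.1 (hM x)
    rw [abs_le]
    constructor <;> linarith
  choose u huG hu using fun n => hD.exists_fracSol_of_lipschitz hρ hρ0 hP (hGs n) (hGM n)
    (hψm n) (hψl n) (hψ0 n) (hψB n)
  have hcomp : ∀ m n x, u n x ≤ u m x + (e m + e n) * (1 + |P| * τ) := by
    intro m n x
    have hs := (hu m).add ((((FracSol.const N α (e m + e n)).mono (Set.subset_univ D))).add
      (hT.const_mul (|P| * (e m + e n))))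
    refine ((hu n).le_of_isBounded hs hD.isBounded (fun y hy => ?_) (fun y hy hlt => ?_) x).trans ?_
    · rw [huG n y hy, huG m y hy]
      have h1 := abs_le.1 (hGF' n y)
      have h2 := abs_le.1 (hGF' m y)
      have h3 : 0 ≤ |P| * (e m + e n) * T y :=
        mul_nonneg (mul_nonneg hP0 (add_pos (he0 m) (he0 n)).le) (hT0 y)
      linarith
    · simp only [Set.indicator_of_mem hy, Pi.zero_apply]
      have h3 : 0 ≤ |P| * (e m + e n) * T y :=
        mul_nonneg (mul_nonneg hP0 (add_pos (he0 m) (he0 n)).le) (hT0 y)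
      have h1 := abs_le.1 (hψφ n (u n y))
      have h2 := abs_le.1 (hψφ m (u m y))
      have h4 := hφm (show u m y ≤ u n y by linarith [he0 m, he0 n])
      have h5 : ψ m (u m y) - (e m + e n) ≤ ψ n (u n y) := by linarith
      have h6 := mul_le_mul_of_nonneg_left h5 (hρ0 y)
      have h7 := mul_le_mul_of_nonneg_right (hP' y hy) (add_pos (he0 m) (he0 n)).le
      linarith
    · have h1 := mul_le_mul_of_nonneg_left ((le_abs_self _).trans (hτ x))
        (mul_nonneg hP0 (add_pos (he0 m) (he0 n)).le)
      linarith
  have hτ0 : 0 ≤ τ := (abs_nonneg _).trans (hτ 0)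
  obtain ⟨v, hv⟩ := exists_tendstoUniformly_of_cauchy (w := u) (by
    intro ε hε
    have h1 : Tendsto (fun n => e n * (1 + |P| * τ)) atTop (𝓝 0) := by
      simpa using helim.mul_const (1 + |P| * τ)
    obtain ⟨n₀, h₀⟩ := (eventually_atTop.1 (h1.eventually_le_const (half_pos hε)))
    refine ⟨n₀, fun m hm n hn x => (hcomp m n x).trans ?_⟩
    linarith [h₀ m hm, h₀ n hn])
  have hpt : ∀ x, Tendsto (fun n => u n x) atTop (𝓝 (v x)) := fun x => hv.tendsto_at x
  have hvc : Continuous v := hv.continuous (Frequently.of_forall fun n => (hu n).cont)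
  have hle : ∀ {η : ℝ → ℝ}, (∀ t, 0 ≤ η t) → (∀ t, η t ≤ B) → ∀ {w : 𝔼 → ℝ} x,
      |D.indicator (fun x => ρ x * η (w x)) x| ≤ |P| * B := by
    intro η h0 hB w x
    by_cases hx : x ∈ D
    · rw [Set.indicator_of_mem hx, abs_of_nonneg (mul_nonneg (hρ0 x) (h0 _))]
      exact mul_le_mul (hP' x hx) (hB _) (h0 _) hP0
    · rw [Set.indicator_of_notMem hx, abs_zero]
      positivity
  refine ⟨v, fun x hx => ?_, hvc, ?_, ?_, ⟨_, hle hφ0 hφB⟩, ?_⟩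
  · refine tendsto_nhds_unique (hpt x) ?_
    rw [tendsto_iff_dist_tendsto_zero]
    refine squeeze_zero (fun _ => dist_nonneg) (fun n => ?_) helim
    rw [huG n x hx]
    exact hGF' n x
  · obtain ⟨M₀, hM₀⟩ := (hu 0).bdd
    refine ⟨M₀ + (e 0 + 1) * (1 + |P| * τ), fun x => ?_⟩
    have he1 : ∀ n, e n ≤ 1 := fun n => by
      rw [he]
      exact div_le_one_of_le₀ (by linarith [n.cast_nonneg (α := ℝ)]) (by positivity)
    refine le_of_tendsto (hpt x).abs (Eventually.of_forall fun n => ?_)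
    have h1 := hcomp 0 n x
    have h2 := hcomp n 0 x
    have h3 := abs_le.1 (hM₀ x)
    have h4 := mul_le_mul_of_nonneg_right (he1 n) (show 0 ≤ 1 + |P| * τ by positivity)
    rw [abs_le]
    constructor <;> linarith
  · exact (hρ.mul (hφu.continuous.comp hvc).measurable).indicator hDm
  · refine FracEq.of_tendstoUniformly hu hv (fun x hx => ?_) (K := |P| * B)
      fun n x _ => hle (hψ0 n) (hψB n) x
    simp only [Set.indicator_of_mem hx]
    refine Tendsto.const_mul _ ?_
    have h1 : Tendsto (fun n => ψ n (u n x) - φ (u n x)) atTop (𝓝 0) :=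
      squeeze_zero_norm (fun n => hψφ n _) helim
    simpa using h1.add ((hφu.continuous.tendsto _).comp (hpt x))

lemma FracSol.mem_Icc {U : Set 𝔼} {u g f : 𝔼 → ℝ} (h : FracSol N α U u g) {M : ℝ}
    (hb : Bornology.IsBounded U) (hf0 : ∀ x ∈ Uᶜ, 0 ≤ f x) (hfM : ∀ x ∈ Uᶜ, f x ≤ M)
    (hu : ∀ x ∈ Uᶜ, u x = f x) (hneg : ∀ x ∈ U, u x < 0 → g x = 0)
    (hpos : ∀ x ∈ U, 0 ≤ g x) (x : 𝔼) : u x ∈ Set.Icc 0 M := by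
  refine ⟨?_, ?_⟩
  · refine ((FracSol.const N α 0).mono (Set.subset_univ U)).le_of_isBounded h hb
      (fun y hy => ?_) (fun y hy hlt => (hneg y hy hlt).le) x
    rw [hu y hy]
    exact hf0 y hy
  · refine h.le_of_isBounded ((FracSol.const N α M).mono (Set.subset_univ U)) hb
      (fun y hy => ?_) (fun y hy _ => hpos y hy) x
    rw [hu y hy]
    exact hfM y hy

/-- Nonnegative bounded continuous solutions are determined by their exterior data. -/
theorem FracSol.eq_of_monotoneOn {D : Set 𝔼} (hD : Bornology.IsBounded D) {ρ : 𝔼 → ℝ}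
    (hρ0 : ∀ x, 0 ≤ ρ x) {φ : ℝ → ℝ} (hφ : MonotoneOn φ (Set.Ici 0)) {u v : 𝔼 → ℝ}
    (hu0 : ∀ x, 0 ≤ u x) (hv0 : ∀ x, 0 ≤ v x) (huv : ∀ x ∈ Dᶜ, u x = v x)
    (hu : FracSol N α D u (D.indicator fun x => ρ x * φ (u x)))
    (hv : FracSol N α D v (D.indicator fun x => ρ x * φ (v x))) : u = v := by
  ext x
  refine le_antisymm (hu.le_of_isBounded hv hD (fun y hy => (huv y hy).le) (fun y hy h => ?_) x)
    (hv.le_of_isBounded hu hD (fun y hy => (huv y hy).ge) (fun y hy h => ?_) x)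
  · rw [Set.indicator_of_mem hy, Set.indicator_of_mem hy]
    exact mul_le_mul_of_nonneg_left (hφ (hv0 y) (hu0 y) h.le) (hρ0 y)
  · rw [Set.indicator_of_mem hy, Set.indicator_of_mem hy]
    exact mul_le_mul_of_nonneg_left (hφ (hu0 y) (hv0 y) h.le) (hρ0 y)

lemma integral_indicator_mul_eq_setIntegral {D : Set 𝔼} (hDm : MeasurableSet D) (g θ : 𝔼 → ℝ) :
    ∫ x, D.indicator g x * θ x = ∫ x in D, g x * θ x := by
  rw [← integral_indicator hDm]
  congr with x
  by_cases hx : x ∈ D <;> simp [hx]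

lemma measurable_mul_comp {ρ : 𝔼 → ℝ} (hρ : Measurable ρ) {φ : ℝ → ℝ}
    (hφ : ContinuousOn φ (Set.Ici 0)) {u : 𝔼 → ℝ} (hu : Continuous u) (hu0 : ∀ x, 0 ≤ u x) :
    Measurable fun x => ρ x * φ (u x) :=
  hρ.mul (hφ.comp_continuous hu hu0).measurable

lemma abs_mul_comp_le {ρ : 𝔼 → ℝ} (hρ0 : ∀ x, 0 ≤ ρ x) {D : Set 𝔼} {P : ℝ}
    (hP : ∀ x ∈ D, ρ x ≤ P) {φ : ℝ → ℝ} (hφ : MonotoneOn φ (Set.Ici 0))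
    (hφ0 : ∀ t, 0 ≤ t → 0 ≤ φ t) {u : 𝔼 → ℝ} {M : ℝ} (hu0 : ∀ x, 0 ≤ u x) (hM : ∀ x, u x ≤ M)
    {x : 𝔼} (hx : x ∈ D) : |ρ x * φ (u x)| ≤ P * φ M := by
  rw [abs_of_nonneg (mul_nonneg (hρ0 x) (hφ0 _ (hu0 x)))]
  exact mul_le_mul (hP x hx) (hφ (hu0 x) ((hu0 x).trans (hM x)) (hM x)) (hφ0 _ (hu0 x))
    ((hρ0 x).trans (hP x hx))

end FracLapTheory

/-- existence and uniqueness of the solution to the nonlinear Dirichlet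
problem `Δ^{α/2}u = ρ·φ(u)` in a bounded open set `D` satisfying the exterior cone
condition, with datum `f` on `Dᶜ`. -/
theorem stmt5 (N : ℕ) (hN : 3 ≤ N) (α : ℝ) (hα1 : 0 < α) (hα2 : α < 2)
    (ρ : EuclideanSpace ℝ (Fin N) → ℝ) (hρm : Measurable ρ) (hρnn : ∀ x, 0 ≤ ρ x)
    (hρlb : ∀ R : ℝ, ∃ M : ℝ, ∀ x : EuclideanSpace ℝ (Fin N), ‖x‖ ≤ R → ρ x ≤ M)
    (φ : ℝ → ℝ) (hφc : ContinuousOn φ (Set.Ici 0)) (hφm : MonotoneOn φ (Set.Ici 0))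
    (hφ0 : φ 0 = 0) (hφnn : ∀ t : ℝ, 0 ≤ t → 0 ≤ φ t)
    (D : Set (EuclideanSpace ℝ (Fin N))) (hDo : IsOpen D)
    (hDb : Bornology.IsBounded D)
    (hcone : ∀ z ∈ frontier D, ∃ C : Set (EuclideanSpace ℝ (Fin N)),
      C.Nonempty ∧ IsOpen C ∧ (∀ y ∈ C, ∀ t : ℝ, 0 < t → z + t • (y - z) ∈ C) ∧
      ∃ r : ℝ, 0 < r ∧ C ∩ Metric.ball z r ⊆ Dᶜ) :
    ∀ f : EuclideanSpace ℝ (Fin N) → ℝ, ContinuousOn f Dᶜ →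
      (∃ M, ∀ x ∈ Dᶜ, |f x| ≤ M) → (∀ x ∈ Dᶜ, 0 ≤ f x) →
      ∃! u : EuclideanSpace ℝ (Fin N) → ℝ,
        Continuous u ∧ (∃ M, ∀ x, |u x| ≤ M) ∧ (∀ x, 0 ≤ u x) ∧
        (∀ x ∈ Dᶜ, u x = f x) ∧
        LocallyIntegrableOn (fun x => ρ x * φ (u x)) D ∧
        ∀ θ : EuclideanSpace ℝ (Fin N) → ℝ, ContDiff ℝ (⊤ : ℕ∞) θ →
          HasCompactSupport θ → tsupport θ ⊆ D →
          (∫ x, u x * fracLap N α θ x) = ∫ x in D, ρ x * φ (u x) * θ x := by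
  intro f hfc hfb hf0
  have : StableParams N α := ⟨hN, hα1, hα2⟩
  have hDm := hDo.measurableSet
  have hD : IsRegularDomain α D := isRegularDomain_of_cone α hDo hDb hcone
  obtain ⟨P, hP⟩ : ∃ P, ∀ x ∈ D, ρ x ≤ P := by
    obtain ⟨R, hR⟩ := hDb.exists_norm_le
    obtain ⟨P, hP⟩ := hρlb R
    exact ⟨P, fun x hx => hP x (hR x hx)⟩
  have hsol : ∀ u : EuclideanSpace ℝ (Fin N) → ℝ, Continuous u → (∃ M, ∀ x, |u x| ≤ M) →
      (∀ x, 0 ≤ u x) → (∀ θ : EuclideanSpace ℝ (Fin N) → ℝ, ContDiff ℝ (⊤ : ℕ∞) θ →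
          HasCompactSupport θ → tsupport θ ⊆ D →
          (∫ x, u x * fracLap N α θ x) = ∫ x in D, ρ x * φ (u x) * θ x) →
      FracSol N α D u (D.indicator fun x => ρ x * φ (u x)) := by
    rintro u huc ⟨M, hM⟩ hu0 hu
    refine ⟨huc, ⟨M, hM⟩, (measurable_mul_comp hρm hφc huc hu0).indicator hDm,
      ⟨|P * φ M|, fun x => ?_⟩, fun θ hθ hs => ?_⟩
    · by_cases hx : x ∈ D
      · rw [Set.indicator_of_mem hx]
        exact (abs_mul_comp_le hρnn hP hφm hφnn hu0 (fun x => (le_abs_self _).trans (hM x))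
          hx).trans (le_abs_self _)
      · rw [Set.indicator_of_notMem hx, abs_zero]
        exact abs_nonneg _
    · rw [hu θ hθ.smooth hθ.compact hs, integral_indicator_mul_eq_setIntegral hDm]
  obtain ⟨M, hM0, hfM⟩ : ∃ M, 0 ≤ M ∧ ∀ x ∈ Dᶜ, f x ≤ M := by
    obtain ⟨M, hM⟩ := hfb
    exact ⟨|M|, abs_nonneg M, fun x hx => (le_abs_self _).trans ((hM x hx).trans (le_abs_self M))⟩
  obtain ⟨F, hFM, hFf⟩ := (ContinuousMap.mk _ hfc.domRestrict).exists_restrict_eq_forall_mem_of_closed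
    (t := Set.Icc 0 M) (fun x => ⟨hf0 x x.2, hfM x x.2⟩) ⟨0, le_rfl, hM0⟩ hDo.isClosed_compl
  have hFf' : ∀ x ∈ Dᶜ, F x = f x := fun x hx => DFunLike.congr_fun hFf ⟨x, hx⟩
  set ψ : ℝ → ℝ := Set.IccExtend hM0 (Set.domRestrict (Set.Icc 0 M) φ) with hψ
  have hψφ : ∀ t ∈ Set.Icc 0 M, ψ t = φ t := fun t ht => by
    rw [hψ, Set.IccExtend_of_mem hM0 _ ht]
    rfl
  have hψm : Monotone ψ := Monotone.IccExtend hM0 fun s t hst => hφm s.2.1 t.2.1 hst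
  have hψu : UniformContinuous ψ :=
    (CompactSpace.uniformContinuous_of_continuous
      (hφc.mono fun t ht => ht.1).domRestrict).comp (LipschitzWith.projIcc hM0).uniformContinuous
  have hψ0 : ∀ t, 0 ≤ ψ t := fun t => hφnn _ (Set.projIcc 0 M hM0 t).2.1
  have hψM : ∀ t, ψ t ≤ φ M := fun t =>
    hφm (Set.projIcc 0 M hM0 t).2.1 hM0 (Set.projIcc 0 M hM0 t).2.2
  have hψneg : ∀ t < 0, ψ t = 0 := fun t ht => by
    rw [hψ, Set.IccExtend_of_le_left hM0 _ ht.le]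
    exact hφ0
  obtain ⟨u, huF, hu⟩ := hD.exists_fracSol hρm hρnn hP F.continuous
    (fun x => by rw [abs_of_nonneg (hFM x).1]; exact (hFM x).2) hψm hψu hψ0 hψM
  have huf : ∀ x ∈ Dᶜ, u x = f x := fun x hx => (huF x hx).trans (hFf' x hx)
  have huM : ∀ x, u x ∈ Set.Icc 0 M := hu.mem_Icc hDb hf0 hfM huf
    (fun x hx h => by rw [Set.indicator_of_mem hx, hψneg _ h, mul_zero])
    fun x hx => by
      rw [Set.indicator_of_mem hx]
      exact mul_nonneg (hρnn x) (hψ0 _)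
  have hu0 : ∀ x, 0 ≤ u x := fun x => (huM x).1
  simp only [fun x => hψφ _ (huM x)] at hu
  refine ⟨u, ⟨hu.cont, hu.bdd, hu0, huf, ?_, fun θ hθ hθc hs => ?_⟩, ?_⟩
  · refine IntegrableOn.locallyIntegrableOn (Measure.integrableOn_of_bounded
      (M := P * φ M) hDb.measure_lt_top.ne
      (measurable_mul_comp hρm hφc hu.cont hu0).aestronglyMeasurable ?_)
    exact (ae_restrict_mem hDm).mono fun x hx =>
      abs_mul_comp_le hρnn hP hφm hφnn hu0 (fun x => (huM x).2) hx
  · rw [hu.eq θ ⟨hθ, hθc⟩ hs, integral_indicator_mul_eq_setIntegral hDm]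
  · rintro v ⟨hvc, hvb, hv0, hvf, -, hv⟩
    exact (hsol v hvc hvb hv0 hv).eq_of_monotoneOn hDb hρnn hφm hv0 hu0
      (fun x hx => (hvf x hx).trans (huf x hx).symm) hu
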